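/- For all sufficiently large N, the ternary logarithmic inequality |p₁·log p₁ + p₂·log p₂ + p₃·log p₃ − N| < X^(−1/25)·(log X)^8 has a solution in prime numbers p₁, p₂, p₃, where X is defined by N = 2X·log(2X/3). -/

import Mathlib

namespace TLI

/-- The additive character. -/
noncomputable def ee (x : ℝ) : ℂ := Complex.exp (((2 * Real.pi * x : ℝ) : ℂ) * Complex.I)

lemma norm_ee (x : ℝ) : ‖ee x‖ = 1 := by
  unfold ee; exact Complex.norm_exp_ofReal_mul_I _

lemma ee_add (x y : ℝ) : ee (x + y) = ee x * ee y := by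
  unfold ee; rw [← Complex.exp_add]; congr 1; push_cast; ring

lemma ee_zero : ee 0 = 1 := by simp [ee]

lemma ee_neg_mul (x : ℝ) : ee (-x) * ee x = 1 := by
  rw [← ee_add]; simp [ee_zero]

lemma ee_neg (x : ℝ) : ee (-x) = (starRingEnd ℂ) (ee x) := by
  unfold ee; rw [← Complex.exp_conj, map_mul, Complex.conj_ofReal, Complex.conj_I]; congr 1; push_cast; ring

lemma ee_int (k : ℤ) : ee k = 1 := by
  unfold ee
  rw [Complex.exp_eq_one_iff]
  exact ⟨k, by push_cast; ring⟩

lemma ee_sub_int_mul (x : ℝ) (k : ℤ) (n : ℕ) : ee (x - k * n) = ee x := by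
  have : ee (x - k * n) = ee x * ee (((-(k * n) : ℤ)) : ℝ) := by
    rw [← ee_add]; congr 1; push_cast; ring
  rw [this, ee_int, mul_one]

/-- summation by parts -/
lemma sum_parts (F g : ℕ → ℂ) (a b : ℕ) (hab : a ≤ b) :
    ∑ n ∈ Finset.Ico a b, g n * (F n - F (n + 1)) =
      g a * F a - g b * F b + ∑ n ∈ Finset.Ico a b, (g (n + 1) - g n) * F (n + 1) := by
  induction b, hab using Nat.le_induction with
  | base => simp
  | succ m hm ih => rw [Finset.sum_Ico_succ_top hm, Finset.sum_Ico_succ_top hm, ih]; ring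

/-- the function cot -/
noncomputable def ct (d : ℝ) : ℝ := Real.cos (Real.pi * d) / Real.sin (Real.pi * d)

lemma one_sub_ee (d : ℝ) (h : Real.sin (Real.pi * d) ≠ 0) :
    (1 / 2 + Complex.I / 2 * (ct d : ℂ)) * (1 - ee d) = 1 := by
  have h1 : ee d = (Complex.cos ((Real.pi * d : ℝ) : ℂ) + Complex.sin ((Real.pi * d : ℝ) : ℂ) * Complex.I) ^ 2 := by
    rw [← Complex.exp_mul_I, ← Complex.exp_nat_mul]
    unfold ee; congr 1; push_cast; ring
  have h2 : (Complex.sin ((Real.pi * d : ℝ) : ℂ)) ≠ 0 := by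
    rw [← Complex.ofReal_sin]; exact_mod_cast h
  have h3 := Complex.sin_sq_add_cos_sq ((Real.pi * d : ℝ) : ℂ)
  rw [h1, ct, Complex.ofReal_div, Complex.ofReal_cos, Complex.ofReal_sin]
  set s := Complex.sin ((Real.pi * d : ℝ) : ℂ)
  set c := Complex.cos ((Real.pi * d : ℝ) : ℂ)
  have hI := Complex.I_sq
  field_simp
  have : c ^ 2 = 1 - s ^ 2 := by linear_combination h3
  linear_combination (-s ^3 - 2 * c * c * s - c * s ^ 2 * Complex.I) * hI + (s  - Complex.I * c ) * h3

lemma sin_ge {D d : ℝ} (hD : 0 < D) (h1 : D ≤ d) (h2 : d ≤ 1 - D) :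
    2 * D ≤ Real.sin (Real.pi * d) := by
  have hpi := Real.pi_pos
  by_cases hd : d ≤ 1 / 2
  · have := Real.mul_le_sin (x := Real.pi * d) (by nlinarith) (by nlinarith)
    have h3 : 2 / Real.pi * (Real.pi * d) = 2 * d := by field_simp
    linarith
  · push Not at hd
    have := Real.mul_le_sin (x := Real.pi * (1 - d)) (by nlinarith) (by nlinarith)
    have h3 : 2 / Real.pi * (Real.pi * (1 - d)) = 2 * (1 - d) := by field_simp
    have h4 : Real.sin (Real.pi * (1 - d)) = Real.sin (Real.pi * d) := by
      rw [mul_sub, mul_one, Real.sin_pi_sub]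
    linarith

lemma ct_anti {D d d' : ℝ} (hD : 0 < D) (h1 : D ≤ d) (h3 : d ≤ d') (h2 : d' ≤ 1 - D) :
    ct d' ≤ ct d := by
  have s1 := sin_ge hD h1 (h3.trans h2)
  have s2 := sin_ge hD (h1.trans h3) h2
  unfold ct
  rw [div_le_div_iff₀ (by linarith) (by linarith)]
  have : 0 ≤ Real.sin (Real.pi * d' - Real.pi * d) := by
    have hpi := Real.pi_pos
    apply Real.sin_nonneg_of_nonneg_of_le_pi <;> nlinarith
  rw [Real.sin_sub] at this
  linarith

lemma ct_abs {D d : ℝ} (hD : 0 < D) (h1 : D ≤ d) (h2 : d ≤ 1 - D) :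
    |ct d| ≤ 1 / (2 * D) := by
  have s1 := sin_ge hD h1 h2
  unfold ct
  rw [abs_div, abs_of_pos (by linarith : 0 < Real.sin (Real.pi * d))]
  exact div_le_div₀ zero_le_one (Real.abs_cos_le_one _) (by linarith) s1

lemma norm_g {D d : ℝ} (hD : 0 < D) (h1 : D ≤ d) (h2 : d ≤ 1 - D) :
    ‖(1 / 2 + Complex.I / 2 * (ct d : ℂ))‖ ≤ 1 / (2 * D) := by
  have hD2 : D ≤ 1 / 2 := by linarith
  have h := ct_abs hD h1 h2
  calc _ ≤ ‖(1 / 2 : ℂ)‖ + ‖Complex.I / 2 * (ct d : ℂ)‖ := norm_add_le _ _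
    _ = 1 / 2 + 1 / 2 * |ct d| := by
      rw [norm_mul, norm_div, norm_div]; simp
    _ ≤ 1 / 2 * (1 / (2 * D)) + 1 / 2 * (1 / (2 * D)) := by
      have : 1 ≤ 1 / (2 * D) := by rw [le_div_iff₀ (by positivity)]; linarith
      linarith
    _ = _ := by ring

/-- Kusmin-Landau, restricted to (0,1). -/
lemma kl0 (f : ℕ → ℝ) (a b : ℕ) (D : ℝ) (hab : a ≤ b) (hD : 0 < D)
    (h1 : ∀ n, a ≤ n → n ≤ b → D ≤ f (n + 1) - f n)
    (h2 : ∀ n, a ≤ n → n ≤ b → f (n + 1) - f n ≤ 1 - D)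
    (hm : ∀ n, a ≤ n → n < b → f (n + 1) - f n ≤ f (n + 2) - f (n + 1)) :
    ‖∑ n ∈ Finset.Ico a b, ee (f n)‖ ≤ 2 / D := by
  set g : ℕ → ℂ := fun n => 1 / 2 + Complex.I / 2 * (ct (f (n + 1) - f n) : ℂ) with hg
  have e1 : ∑ n ∈ Finset.Ico a b, ee (f n) =
      ∑ n ∈ Finset.Ico a b, g n * (ee (f n) - ee (f (n + 1))) := by
    apply Finset.sum_congr rfl
    intro n hn
    rw [Finset.mem_Ico] at hn
    have hs := sin_ge hD (h1 n hn.1 hn.2.le) (h2 n hn.1 hn.2.le)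
    have := one_sub_ee (f (n + 1) - f n) (by linarith)
    have h4 : ee (f (n + 1)) = ee (f n) * ee (f (n + 1) - f n) := by
      rw [← ee_add]; congr 1; ring
    rw [h4]
    calc ee (f n) = ee (f n) * 1 := by ring
      _ = _ := by rw [← this]; simp only [hg]; ring
  rw [e1, sum_parts (fun n => ee (f n)) g a b hab]
  have t1 : ‖g a * ee (f a)‖ ≤ 1 / (2 * D) := by
    rw [norm_mul, norm_ee, mul_one]; exact norm_g hD (h1 a le_rfl hab) (h2 a le_rfl hab)
  have t2 : ‖g b * ee (f b)‖ ≤ 1 / (2 * D) := by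
    rw [norm_mul, norm_ee, mul_one]; exact norm_g hD (h1 b hab le_rfl) (h2 b hab le_rfl)
  have t3 : ‖∑ n ∈ Finset.Ico a b, (g (n + 1) - g n) * ee (f (n + 1))‖ ≤ 1 / (2 * D) := by
    calc _ ≤ ∑ n ∈ Finset.Ico a b, ‖(g (n + 1) - g n) * ee (f (n + 1))‖ := norm_sum_le _ _
      _ ≤ ∑ n ∈ Finset.Ico a b, (-(1 / 2) * (ct (f (n + 1 + 1) - f (n + 1))) - -(1 / 2) * ct (f (n + 1) - f n)) := by
        apply Finset.sum_le_sum
        intro n hn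
        rw [Finset.mem_Ico] at hn
        rw [norm_mul, norm_ee, mul_one]
        have h5 := ct_anti hD (h1 n hn.1 hn.2.le) (hm n hn.1 hn.2)
          (h2 (n + 1) (by omega) (by omega))
        have : g (n + 1) - g n = Complex.I / 2 * ((ct (f (n + 1 + 1) - f (n + 1)) - ct (f (n + 1) - f n) : ℝ) : ℂ) := by
          simp only [hg]; push_cast; ring
        rw [this, norm_mul, norm_div, Complex.norm_real, Real.norm_eq_abs, abs_of_nonpos]
        · simp; linarith
        · have : f (n + 2) = f (n + 1 + 1) := rfl
          rw [this] at h5; linarith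
      _ = -(1 / 2) * ct (f (b + 1) - f b) - -(1 / 2) * ct (f (a + 1) - f a) := by
        rw [Finset.sum_Ico_sub (fun n => -(1 / 2) * ct (f (n + 1) - f n)) hab]
      _ ≤ _ := by
        have h6 := abs_le.mp (ct_abs hD (h1 a le_rfl hab) (h2 a le_rfl hab))
        have h7 := abs_le.mp (ct_abs hD (h1 b hab le_rfl) (h2 b hab le_rfl))
        linarith [h6.1, h6.2, h7.1, h7.2]
  calc _ ≤ ‖g a * ee (f a)‖ + ‖g b * ee (f b)‖ + ‖∑ n ∈ Finset.Ico a b, (g (n + 1) - g n) * ee (f (n + 1))‖ :=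
        (norm_add_le _ _).trans (add_le_add_left (norm_sub_le _ _) _)
    _ ≤ 1 / (2 * D) + 1 / (2 * D) + 1 / (2 * D) := by linarith
    _ ≤ 2 / D := by
      have : 0 < 1 / (2 * D) := by positivity
      have h8 : 2 / D = 4 * (1 / (2 * D)) := by field_simp; norm_num
      rw [h8]; linarith

/-- Kusmin-Landau for a general integer shift, with the end point removed. -/
lemma kl (f : ℕ → ℝ) (a b : ℕ) (D : ℝ) (k : ℤ) (hD : 0 < D) (hD2 : D ≤ 1 / 2)
    (h1 : ∀ n, a ≤ n → n < b → k + D ≤ f (n + 1) - f n)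
    (h2 : ∀ n, a ≤ n → n < b → f (n + 1) - f n ≤ k + 1 - D)
    (hm : ∀ n, a ≤ n → n < b → f (n + 1) - f n ≤ f (n + 2) - f (n + 1)) :
    ‖∑ n ∈ Finset.Ico a b, ee (f n)‖ ≤ 3 / D := by
  rcases le_or_gt b a with h | h
  · rw [Finset.Ico_eq_empty (by omega)]; simp; positivity
  · obtain ⟨b, rfl⟩ : ∃ c, b = c + 1 := ⟨b - 1, by omega⟩
    rw [Finset.sum_Ico_succ_top (by omega)]
    have key := kl0 (fun n => f n - k * n) a b D (by omega) hD
      (fun n hn hn' => by have := h1 n hn (by omega); push_cast; linarith)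
      (fun n hn hn' => by have := h2 n hn (by omega); push_cast; linarith)
      (fun n hn hn' => by have := hm n hn (by omega); push_cast; linarith)
    simp only [ee_sub_int_mul] at key
    calc _ ≤ _ := norm_add_le _ _
      _ ≤ 2 / D + 1 := by rw [norm_ee]; linarith
      _ ≤ _ := by
        have : 1 ≤ 1 / D := by rw [le_div_iff₀ hD]; linarith
        have h8 : 3 / D = 2 / D + 1 / D := by ring
        linarith


lemma convex_finset_eq (S : Finset ℕ) (hS : ∀ x ∈ S, ∀ y ∈ S, ∀ z, x ≤ z → z ≤ y → z ∈ S) :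
    ∃ a b, S = Finset.Ico a b := by
  rcases S.eq_empty_or_nonempty with h | h
  · exact ⟨0, 0, by simp [h]⟩
  · refine ⟨S.min' h, S.max' h + 1, ?_⟩
    ext z
    rw [Finset.mem_Ico]
    constructor
    · intro hz; exact ⟨S.min'_le z hz, Nat.lt_succ_of_le (S.le_max' z hz)⟩
    · rintro ⟨h1, h2⟩
      exact hS _ (S.min'_mem h) _ (S.max'_mem h) z h1 (by omega)

lemma card_le_of_gap (S : Finset ℕ) (δ : ℕ → ℝ) (lam D u : ℝ) (hl : 0 < lam) (hD : 0 ≤ D)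
    (hgap : ∀ x ∈ S, ∀ y ∈ S, x ≤ y → lam * ((y : ℝ) - x) ≤ δ y - δ x)
    (h1 : ∀ x ∈ S, u ≤ δ x) (h2 : ∀ x ∈ S, δ x ≤ u + D) : (S.card : ℝ) ≤ D / lam + 1 := by
  rcases S.eq_empty_or_nonempty with h | h
  · simp [h]; positivity
  · have hsub : S ⊆ Finset.Icc (S.min' h) (S.max' h) := fun z hz =>
      Finset.mem_Icc.mpr ⟨S.min'_le z hz, S.le_max' z hz⟩
    have hc := Finset.card_le_card hsub
    rw [Nat.card_Icc] at hc
    have hle : S.min' h ≤ S.max' h := S.min'_le _ (S.max'_mem h)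
    have hc' : (S.card : ℝ) ≤ (S.max' h : ℝ) - S.min' h + 1 := by
      have : S.card + S.min' h ≤ S.max' h + 1 := by omega
      have : ((S.card + S.min' h : ℕ) : ℝ) ≤ ((S.max' h + 1 : ℕ) : ℝ) := by exact_mod_cast this
      push_cast at this; linarith
    have g := hgap _ (S.min'_mem h) _ (S.max'_mem h) hle
    have g1 := h1 _ (S.min'_mem h)
    have g2 := h2 _ (S.max'_mem h)
    have : (S.max' h : ℝ) - S.min' h ≤ D / lam := by
      rw [le_div_iff₀ hl]; nlinarith
    linarith

/-- second difference test -/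
lemma second_diff (f : ℕ → ℝ) (a b : ℕ) (lam R : ℝ) (hab : a ≤ b) (hl : 0 < lam) (hl4 : lam ≤ 1 / 4)
    (hgap : ∀ n, a ≤ n → n < b → lam ≤ (f (n + 2) - f (n + 1)) - (f (n + 1) - f n))
    (hR : (f (b + 1) - f b) - (f (a + 1) - f a) ≤ R) :
    ‖∑ n ∈ Finset.Ico a b, ee (f n)‖ ≤ (R + 2) * (7 / Real.sqrt lam) := by
  set δ : ℕ → ℝ := fun n => f (n + 1) - f n with hδ
  have hsl : 0 < Real.sqrt lam := Real.sqrt_pos.mpr hl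
  have hsl2 : Real.sqrt lam ≤ 1 / 2 := by
    rw [Real.sqrt_le_left (by norm_num)]; norm_num; linarith
  have hsq : Real.sqrt lam * Real.sqrt lam = lam := Real.mul_self_sqrt hl.le
  have gap : ∀ x y, a ≤ x → x ≤ y → y ≤ b → lam * ((y : ℝ) - x) ≤ δ y - δ x := by
    intro x y hx hxy
    induction y, hxy using Nat.le_induction with
    | base => intro _; simp
    | succ m hm ih =>
      intro hb
      have i1 := ih (by omega)
      have i2 := hgap m (by omega) (by omega)
      have : δ (m + 1) - δ m = (f (m + 2) - f (m + 1)) - (f (m + 1) - f m) := rfl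
      push_cast
      nlinarith
  have mono : ∀ x y, a ≤ x → x ≤ y → y ≤ b → δ x ≤ δ y := by
    intro x y hx hxy hy
    have := gap x y hx hxy hy
    have h3 : (x : ℝ) ≤ y := by exact_mod_cast hxy
    nlinarith
  have hfib : ∑ n ∈ Finset.Ico a b, ee (f n) =
      ∑ k ∈ Finset.Icc ⌊δ a⌋ ⌊δ b⌋, ∑ n ∈ Finset.Ico a b with ⌊δ n⌋ = k, ee (f n) := by
    rw [Finset.sum_fiberwise_of_maps_to]
    intro n hn
    rw [Finset.mem_Ico] at hn
    rw [Finset.mem_Icc]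
    exact ⟨Int.floor_le_floor (mono a n le_rfl hn.1 hn.2.le), Int.floor_le_floor (mono n b hn.1 hn.2.le le_rfl)⟩
  have each : ∀ k : ℤ, ‖∑ n ∈ Finset.Ico a b with ⌊δ n⌋ = k, ee (f n)‖ ≤ 7 / Real.sqrt lam := by
    intro k
    set S := (Finset.Ico a b).filter (fun n => ⌊δ n⌋ = k) with hS
    have hSmem : ∀ n ∈ S, (a ≤ n ∧ n < b) ∧ (k : ℝ) ≤ δ n ∧ δ n < k + 1 := by
      intro n hn
      rw [hS, Finset.mem_filter, Finset.mem_Ico, Int.floor_eq_iff] at hn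
      exact hn
    rw [← Finset.sum_filter_add_sum_filter_not S (fun n => k + Real.sqrt lam ≤ δ n ∧ δ n ≤ k + 1 - Real.sqrt lam)]
    have m1 : ‖∑ n ∈ S with (k + Real.sqrt lam ≤ δ n ∧ δ n ≤ k + 1 - Real.sqrt lam), ee (f n)‖ ≤ 3 / Real.sqrt lam := by
      obtain ⟨a', b', hab'⟩ := convex_finset_eq (S.filter (fun n => k + Real.sqrt lam ≤ δ n ∧ δ n ≤ k + 1 - Real.sqrt lam)) (by
        intro x hx y hy z hxz hzy
        rw [Finset.mem_filter] at hx hy ⊢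
        have x1 := hSmem x hx.1
        have y1 := hSmem y hy.1
        have m1 := mono x z x1.1.1 hxz (by omega)
        have m2 := mono z y (by omega) hzy (by omega)
        refine ⟨?_, by linarith [hx.2.1], by linarith [hy.2.2]⟩
        rw [hS, Finset.mem_filter, Finset.mem_Ico, Int.floor_eq_iff]
        exact ⟨by omega, by linarith, by linarith⟩)
      have hmem : ∀ n, a' ≤ n → n < b' → n ∈ S ∧ (k + Real.sqrt lam ≤ δ n ∧ δ n ≤ k + 1 - Real.sqrt lam) := by
        intro n h1 h2
        have : n ∈ Finset.Ico a' b' := Finset.mem_Ico.mpr ⟨h1, h2⟩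
        rw [← hab', Finset.mem_filter] at this
        exact this
      rw [hab']
      apply kl f a' b' _ k hsl hsl2
      · intro n h1 h2; exact (hmem n h1 h2).2.1
      · intro n h1 h2; exact (hmem n h1 h2).2.2
      · intro n h1 h2
        have := (hSmem n (hmem n h1 h2).1).1
        have := hgap n this.1 this.2
        linarith
    have m2 : ‖∑ n ∈ S with ¬ (k + Real.sqrt lam ≤ δ n ∧ δ n ≤ k + 1 - Real.sqrt lam), ee (f n)‖ ≤ 4 / Real.sqrt lam := by
      have c1 := card_le_of_gap (S.filter (fun n => δ n ≤ k + Real.sqrt lam)) δ lam (Real.sqrt lam) k hl hsl.le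
        (by
          intro x hx y hy hxy
          rw [Finset.mem_filter] at hx hy
          exact gap x y (hSmem x hx.1).1.1 hxy (hSmem y hy.1).1.2.le)
        (fun x hx => (hSmem x (Finset.mem_filter.mp hx).1).2.1)
        (fun x hx => (Finset.mem_filter.mp hx).2)
      have c2 := card_le_of_gap (S.filter (fun n => k + 1 - Real.sqrt lam ≤ δ n)) δ lam (Real.sqrt lam) (k + 1 - Real.sqrt lam) hl hsl.le
        (by
          intro x hx y hy hxy
          rw [Finset.mem_filter] at hx hy
          exact gap x y (hSmem x hx.1).1.1 hxy (hSmem y hy.1).1.2.le)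
        (fun x hx => (Finset.mem_filter.mp hx).2)
        (fun x hx => by have := (hSmem x (Finset.mem_filter.mp hx).1).2.2; linarith)
      have hsub : S.filter (fun n => ¬ (k + Real.sqrt lam ≤ δ n ∧ δ n ≤ k + 1 - Real.sqrt lam)) ⊆
          S.filter (fun n => δ n ≤ k + Real.sqrt lam) ∪ S.filter (fun n => k + 1 - Real.sqrt lam ≤ δ n) := by
        intro n hn
        rw [Finset.mem_filter] at hn
        rw [Finset.mem_union]
        by_cases h : δ n ≤ k + Real.sqrt lam
        · exact Or.inl (Finset.mem_filter.mpr ⟨hn.1, h⟩)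
        · right
          refine Finset.mem_filter.mpr ⟨hn.1, ?_⟩
          by_contra h'
          exact hn.2 ⟨by linarith, by linarith⟩
      have hcard := (Finset.card_le_card hsub).trans (Finset.card_union_le _ _)
      have hcard' : ((S.filter (fun n => ¬ (k + Real.sqrt lam ≤ δ n ∧ δ n ≤ k + 1 - Real.sqrt lam))).card : ℝ) ≤
          (S.filter (fun n => δ n ≤ k + Real.sqrt lam)).card + (S.filter (fun n => k + 1 - Real.sqrt lam ≤ δ n)).card := by
        exact_mod_cast hcard
      have hq : Real.sqrt lam / lam = 1 / Real.sqrt lam := by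
        rw [div_eq_div_iff hl.ne' hsl.ne', hsq, one_mul]
      have h1 : 1 ≤ 1 / Real.sqrt lam := by rw [le_div_iff₀ hsl]; linarith
      calc _ ≤ ∑ n ∈ S with ¬ (k + Real.sqrt lam ≤ δ n ∧ δ n ≤ k + 1 - Real.sqrt lam), ‖ee (f n)‖ := norm_sum_le _ _
        _ = ((S.filter (fun n => ¬ (k + Real.sqrt lam ≤ δ n ∧ δ n ≤ k + 1 - Real.sqrt lam))).card : ℝ) := by
          simp [norm_ee]
        _ ≤ 4 * (1 / Real.sqrt lam) := by rw [hq] at c1 c2; linarith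
        _ = _ := by ring
    calc _ ≤ 3 / Real.sqrt lam + 4 / Real.sqrt lam := (norm_add_le _ _).trans (add_le_add m1 m2)
      _ = _ := by ring
  rw [hfib]
  calc _ ≤ ∑ k ∈ Finset.Icc ⌊δ a⌋ ⌊δ b⌋, (7 / Real.sqrt lam) := norm_sum_le_of_le _ (fun k _ => each k)
    _ = ((⌊δ b⌋ + 1 - ⌊δ a⌋).toNat : ℝ) * (7 / Real.sqrt lam) := by
      rw [Finset.sum_const, Int.card_Icc, nsmul_eq_mul]
    _ ≤ _ := by
      apply mul_le_mul_of_nonneg_right _ (by positivity)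
      have h1 : ⌊δ a⌋ ≤ ⌊δ b⌋ := Int.floor_le_floor (mono a b le_rfl hab le_rfl)
      have h2 : (((⌊δ b⌋ + 1 - ⌊δ a⌋).toNat : ℤ) : ℝ) = ((⌊δ b⌋ + 1 - ⌊δ a⌋ : ℤ) : ℝ) := by
        rw [Int.toNat_of_nonneg (by omega)]
      have h3 : (((⌊δ b⌋ + 1 - ⌊δ a⌋).toNat : ℤ) : ℝ) = ((⌊δ b⌋ + 1 - ⌊δ a⌋).toNat : ℝ) := by norm_cast
      rw [← h3, h2]
      push_cast
      have := Int.floor_le (δ b)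
      have := Int.lt_floor_add_one (δ a)
      have h5 : δ b - δ a ≤ R := hR
      linarith

/-- `x log x` -/
noncomputable def xl (x : ℝ) : ℝ := x * Real.log x

lemma xl_diff {x y : ℝ} (hx : 0 < x) (hxy : x ≤ y) :
    (y - x) * (Real.log x + 1) ≤ xl y - xl x ∧ xl y - xl x ≤ (y - x) * (Real.log y + 1) := by
  have hy : 0 < y := hx.trans_le hxy
  unfold xl
  have h1 : Real.log y - Real.log x ≤ y / x - 1 := by
    rw [← Real.log_div hy.ne' hx.ne']; exact Real.log_le_sub_one_of_pos (by positivity)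
  have h2 : Real.log x - Real.log y ≤ x / y - 1 := by
    rw [← Real.log_div hx.ne' hy.ne']; exact Real.log_le_sub_one_of_pos (by positivity)
  have h1' : x * (Real.log y - Real.log x) ≤ y - x := by
    have := mul_le_mul_of_nonneg_left h1 hx.le
    have e : x * (y / x - 1) = y - x := by field_simp
    linarith
  have h2' : y * (Real.log x - Real.log y) ≤ x - y := by
    have := mul_le_mul_of_nonneg_left h2 hy.le
    have e : y * (x / y - 1) = x - y := by field_simp
    linarith
  constructor <;> nlinarith

lemma xl_second {m : ℝ} (hm : 0 < m) :
    1 / (m + 2) ≤ (xl (m + 2) - xl (m + 1)) - (xl (m + 1) - xl m) := by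
  unfold xl
  have h1 : Real.log (m + 1) - Real.log (m + 2) ≤ (m + 1) / (m + 2) - 1 := by
    rw [← Real.log_div (by positivity) (by positivity)]; exact Real.log_le_sub_one_of_pos (by positivity)
  have key : ∀ y : ℝ, 0 < y → 1 - 1 / y ≤ Real.log y := fun y hy => by
    have := Real.one_sub_inv_le_log_of_pos hy; simpa using this
  have h2 : 2 * Real.log (m + 1) ≤ Real.log (m + 2) + Real.log m + 1 / (m * (m + 2)) := by
    have h3 : Real.log ((m + 1) ^ 2 / (m * (m + 2))) ≤ (m + 1) ^ 2 / (m * (m + 2)) - 1 :=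
      Real.log_le_sub_one_of_pos (by positivity)
    rw [Real.log_div (by positivity) (by positivity), Real.log_pow, Real.log_mul (by positivity) (by positivity)] at h3
    have : (m + 1) ^ 2 / (m * (m + 2)) - 1 = 1 / (m * (m + 2)) := by field_simp; ring
    push_cast at h3
    linarith
  have h3 : (m + 1) / (m + 2) - 1 = - (1 / (m + 2)) := by field_simp; ring
  rw [h3] at h1
  have h4 : m * (1 / (m * (m + 2))) = 1 / (m + 2) := by field_simp
  have h5 := mul_le_mul_of_nonneg_left h2 hm.le
  have h6 : m * (Real.log (m + 2) + Real.log m + 1 / (m * (m + 2))) = m * Real.log (m + 2) + m * Real.log m + 1 / (m + 2) := by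
    rw [← h4]; ring
  rw [h6] at h5
  nlinarith

lemma vdc (c β : ℝ) (a b : ℕ) (ha : 1 ≤ a) (hb : b ≤ 2 * a) (hβ : 0 < β) :
    ‖∑ m ∈ Finset.Ico a b, ee (c * m + β * xl m)‖ ≤
      30 * (Real.sqrt (β * b) + Real.sqrt (b / β)) := by
  rcases le_or_gt b a with h | hab
  · rw [Finset.Ico_eq_empty (by omega)]; simp; positivity
  have ha' : (1 : ℝ) ≤ a := by exact_mod_cast ha
  have hb' : (b : ℝ) ≤ 2 * a := by exact_mod_cast hb
  have hab' : (a : ℝ) + 1 ≤ b := by exact_mod_cast hab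
  have hb0 : (0 : ℝ) < b := by linarith
  rcases le_or_gt (β / (2 * b)) (1 / 4) with hl | hl
  · have key := second_diff (fun m => c * m + β * xl m) a b (β / (2 * b)) (3 * β) hab.le (by positivity) hl
      (by
        intro n hn hn'
        have hn0 : (0 : ℝ) < n := by exact_mod_cast (by omega : 0 < n)
        have := mul_le_mul_of_nonneg_left (xl_second hn0) hβ.le
        have h2 : β / (2 * b) ≤ β * (1 / ((n : ℝ) + 2)) := by
          rw [mul_one_div]
          apply div_le_div_of_nonneg_left hβ.le (by linarith)
          have : (n : ℝ) + 1 ≤ b := by exact_mod_cast hn'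
          linarith
        push_cast
        nlinarith)
      (by
        have x1 := (xl_diff hb0 (by linarith : (b : ℝ) ≤ b + 1)).2
        have x2 := (xl_diff (by linarith : (0 : ℝ) < a) (by linarith : (a : ℝ) ≤ a + 1)).1
        have x3 : Real.log ((b : ℝ) + 1) - Real.log a ≤ 3 := by
          rw [← Real.log_div (by positivity) (by positivity)]
          have := Real.log_le_sub_one_of_pos (by positivity : 0 < ((b : ℝ) + 1) / a)
          have : ((b : ℝ) + 1) / a ≤ 3 := by rw [div_le_iff₀ (by linarith)]; linarith
          linarith
        have x4 : (xl ((b : ℝ) + 1) - xl b) - (xl ((a : ℝ) + 1) - xl a) ≤ 3 := by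
          have : ((b : ℝ) + 1 - b) = 1 := by ring
          have : ((a : ℝ) + 1 - a) = 1 := by ring
          nlinarith
        have := mul_le_mul_of_nonneg_left x4 hβ.le
        push_cast
        nlinarith)
    refine key.trans ?_
    have hs : 7 / Real.sqrt (β / (2 * b)) ≤ 10 * Real.sqrt (b / β) := by
      have e : Real.sqrt (β / (2 * b)) = 1 / (Real.sqrt 2 * Real.sqrt (b / β)) := by
        rw [← Real.sqrt_mul (by norm_num), one_div, ← Real.sqrt_inv]; congr 1; field_simp
      rw [e]
      have h2 : Real.sqrt 2 ≤ 10 / 7 := by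
        rw [Real.sqrt_le_left (by norm_num)]; norm_num
      have h3 : 0 ≤ Real.sqrt (b / β) := Real.sqrt_nonneg _
      rw [div_div_eq_mul_div, div_one]
      nlinarith
    have e2 : β * Real.sqrt (b / β) = Real.sqrt (β * b) := by
      rw [show β * b = β ^ 2 * (b / β) by field_simp, Real.sqrt_mul (by positivity), Real.sqrt_sq hβ.le]
    calc _ ≤ (3 * β + 2) * (10 * Real.sqrt (b / β)) := mul_le_mul_of_nonneg_left hs (by positivity)
      _ = 30 * (β * Real.sqrt (b / β)) + 20 * Real.sqrt (b / β) := by ring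
      _ ≤ _ := by rw [e2]; have := Real.sqrt_nonneg (b / β); linarith
  · have hbig : (b : ℝ) ≤ 2 * β := by
      rw [lt_div_iff₀ (by positivity)] at hl; linarith
    calc _ ≤ ∑ m ∈ Finset.Ico a b, ‖ee (c * m + β * xl m)‖ := norm_sum_le _ _
      _ = (b - a : ℕ) := by simp [norm_ee]
      _ ≤ b := by exact_mod_cast Nat.sub_le b a
      _ = Real.sqrt (b * b) := (Real.sqrt_mul_self hb0.le).symm
      _ ≤ Real.sqrt (30 ^ 2 * (β * b)) := Real.sqrt_le_sqrt (by nlinarith)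
      _ = 30 * Real.sqrt (β * b) := by rw [Real.sqrt_mul (by norm_num), Real.sqrt_sq (by norm_num)]
      _ ≤ _ := by have := Real.sqrt_nonneg (b / β); linarith

end TLI


namespace TLI

/-- The phase function. -/
noncomputable def EE (t : ℝ) (n : ℕ) : ℂ := ee (t * xl n)

lemma norm_EE (t : ℝ) (n : ℕ) : ‖EE t n‖ = 1 := norm_ee _

/-- The k with X/2 < d k ≤ X. -/
noncomputable def JJ (X : ℝ) (d : ℕ) : Finset ℕ :=
  Finset.Ico (⌊X / (2 * d)⌋₊ + 1) (⌊X / d⌋₊ + 1)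

lemma mem_JJ {X : ℝ} (hX : 0 ≤ X) {d : ℕ} (hd : 0 < d) (k : ℕ) :
    k ∈ JJ X d ↔ (X / 2 < d * k ∧ (d : ℝ) * k ≤ X) := by
  have hd' : (0 : ℝ) < d := by exact_mod_cast hd
  unfold JJ
  rw [Finset.mem_Ico, Nat.succ_le_iff, Nat.floor_lt (by positivity), Nat.lt_succ_iff, Nat.le_floor_iff (by positivity),
    div_lt_iff₀ (by positivity), le_div_iff₀ (by positivity)]
  constructor
  · rintro ⟨h1, h2⟩; constructor <;> linarith
  · rintro ⟨h1, h2⟩; constructor <;> linarith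

lemma xl_mul (d k : ℕ) (hd : 0 < d) (hk : 0 < k) :
    xl ((d * k : ℕ) : ℝ) = d * Real.log d * k + d * xl k := by
  have hd' : (d : ℝ) ≠ 0 := by exact_mod_cast hd.ne'
  have hk' : (k : ℝ) ≠ 0 := by exact_mod_cast hk.ne'
  unfold xl
  push_cast
  rw [Real.log_mul hd' hk']; ring

lemma EE_mul (t : ℝ) (d k : ℕ) (hd : 0 < d) (hk : 0 < k) :
    EE t (d * k) = ee ((t * (d * Real.log d)) * k + (t * d) * xl k) := by
  unfold EE; rw [xl_mul d k hd hk]; congr 1; ring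

lemma abel_log (c : ℕ → ℂ) (a b : ℕ) (ha : 1 ≤ a) (hab : a ≤ b) (B : ℝ)
    (hB : ∀ b', b' ≤ b → ‖∑ k ∈ Finset.Ico a b', c k‖ ≤ B) :
    ‖∑ k ∈ Finset.Ico a b, (Real.log k : ℂ) * c k‖ ≤ 2 * B * Real.log b := by
  have id1 : ∀ b', a ≤ b' → ∑ k ∈ Finset.Ico a b', (Real.log k : ℂ) * c k =
      (Real.log b' : ℂ) * ∑ k ∈ Finset.Ico a b', c k -
      ∑ k ∈ Finset.Ico a b', ((Real.log (k + 1 : ℕ) - Real.log k : ℝ) : ℂ) * ∑ j ∈ Finset.Ico a (k + 1), c j := by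
    intro b' hb'
    induction b', hb' using Nat.le_induction with
    | base => simp
    | succ m hm ih =>
      rw [Finset.sum_Ico_succ_top hm, ih, Finset.sum_Ico_succ_top hm, Finset.sum_Ico_succ_top hm, Finset.sum_Ico_succ_top hm]
      push_cast; ring
  have hB0 : 0 ≤ B := (norm_nonneg _).trans (hB b le_rfl)
  rw [id1 b hab]
  have hlogb : 0 ≤ Real.log b := Real.log_natCast_nonneg b
  have t1 : ‖(Real.log b : ℂ) * ∑ k ∈ Finset.Ico a b, c k‖ ≤ Real.log b * B := by
    rw [norm_mul, Complex.norm_real, Real.norm_of_nonneg hlogb]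
    exact mul_le_mul_of_nonneg_left (hB b le_rfl) hlogb
  have t2 : ‖∑ k ∈ Finset.Ico a b, ((Real.log (k + 1 : ℕ) - Real.log k : ℝ) : ℂ) * ∑ j ∈ Finset.Ico a (k + 1), c j‖ ≤
      ∑ k ∈ Finset.Ico a b, (Real.log (k + 1 : ℕ) - Real.log k) * B := by
    apply norm_sum_le_of_le
    intro k hk
    rw [Finset.mem_Ico] at hk
    have h0 : 0 ≤ Real.log (k + 1 : ℕ) - Real.log k := by
      rw [sub_nonneg]
      apply Real.log_le_log
      · exact_mod_cast (by omega : 0 < k)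
      · push_cast; linarith
    rw [norm_mul, Complex.norm_real, Real.norm_of_nonneg h0]
    exact mul_le_mul_of_nonneg_left (hB _ (by omega)) h0
  rw [← Finset.sum_mul, Finset.sum_Ico_sub (fun k : ℕ => Real.log k) hab] at t2
  have hloga : 0 ≤ Real.log a := Real.log_natCast_nonneg a
  calc _ ≤ _ := norm_sub_le _ _
    _ ≤ Real.log b * B + (Real.log b - Real.log a) * B := add_le_add t1 t2
    _ ≤ _ := by nlinarith

lemma JJ_bounds {X : ℝ} {d : ℕ} (hd : 0 < d) (hdX : (d : ℝ) ≤ X) :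
    (⌊X / d⌋₊ + 1 ≤ 2 * (⌊X / (2 * d)⌋₊ + 1)) ∧ (((⌊X / d⌋₊ + 1 : ℕ) : ℝ) ≤ 2 * (X / d)) := by
  have hd' : (0 : ℝ) < d := by exact_mod_cast hd
  have hX : 0 < X := hd'.trans_le hdX
  have h1 : 1 ≤ X / d := by rw [le_div_iff₀ hd']; linarith
  have f1 := Nat.floor_le (by positivity : 0 ≤ X / d)
  constructor
  · have : ⌊X / d⌋₊ < 2 * (⌊X / (2 * d)⌋₊ + 1) := by
      rw [Nat.floor_lt (by positivity)]
      have := Nat.lt_floor_add_one (X / (2 * d))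
      push_cast
      have e : X / d = 2 * (X / (2 * d)) := by field_simp
      linarith
    omega
  · push_cast; linarith

/-- inner smooth sum, any initial piece -/
lemma inner_piece {X t : ℝ} {d : ℕ} (hd : 0 < d) (hdX : (d : ℝ) ≤ X) (ht : 0 < t) (b' : ℕ)
    (hb' : b' ≤ ⌊X / d⌋₊ + 1) :
    ‖∑ k ∈ Finset.Ico (⌊X / (2 * d)⌋₊ + 1) b', EE t (d * k)‖ ≤
      60 * (Real.sqrt (t * X) + Real.sqrt (X / t) / d) := by
  have hd' : (0 : ℝ) < d := by exact_mod_cast hd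
  have hX : 0 < X := hd'.trans_le hdX
  obtain ⟨h1, h2⟩ := JJ_bounds hd hdX
  have e : ∑ k ∈ Finset.Ico (⌊X / (2 * d)⌋₊ + 1) b', EE t (d * k) =
      ∑ k ∈ Finset.Ico (⌊X / (2 * d)⌋₊ + 1) b', ee ((t * (d * Real.log d)) * k + (t * d) * xl k) := by
    apply Finset.sum_congr rfl
    intro k hk
    rw [Finset.mem_Ico] at hk
    exact EE_mul t d k hd (by omega)
  rw [e]
  refine (vdc _ _ _ _ (by omega) (by omega) (by positivity)).trans ?_
  have hb2 : (b' : ℝ) ≤ 2 * (X / d) := le_trans (by exact_mod_cast hb') h2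
  have s1 : Real.sqrt (t * d * b') ≤ 2 * Real.sqrt (t * X) := by
    rw [show (2 : ℝ) = Real.sqrt (2 ^ 2) by rw [Real.sqrt_sq (by norm_num)], ← Real.sqrt_mul (by norm_num)]
    apply Real.sqrt_le_sqrt
    have := mul_le_mul_of_nonneg_left hb2 (by positivity : 0 ≤ t * d)
    have e2 : t * d * (2 * (X / d)) = 2 * (t * X) := by field_simp
    have : 0 < t * X := by positivity
    linarith
  have s2 : Real.sqrt (b' / (t * d)) ≤ 2 * (Real.sqrt (X / t) / d) := by
    have e3 : Real.sqrt (2 ^ 2 * (X / t) / (d : ℝ) ^ 2) = 2 * (Real.sqrt (X / t) / d) := by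
      rw [Real.sqrt_div (by positivity : (0 : ℝ) ≤ 2 ^ 2 * (X / t)), Real.sqrt_mul (by norm_num),
        Real.sqrt_sq (by norm_num), Real.sqrt_sq hd'.le]; ring
    rw [← e3]
    apply Real.sqrt_le_sqrt
    rw [div_le_iff₀ (by positivity)]
    have e2 : 2 ^ 2 * (X / t) / (d : ℝ) ^ 2 * (t * d) = 4 * (X / d) := by field_simp; ring
    have : 0 < X / d := by positivity
    linarith
  linarith

lemma inner_one {X t : ℝ} {d : ℕ} (hd : 0 < d) (hdX : (d : ℝ) ≤ X) (ht : 0 < t) :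
    ‖∑ k ∈ JJ X d, EE t (d * k)‖ ≤ 60 * (Real.sqrt (t * X) + Real.sqrt (X / t) / d) :=
  inner_piece hd hdX ht _ le_rfl

lemma inner_log {X t : ℝ} {d : ℕ} (hd : 0 < d) (hdX : (d : ℝ) ≤ X) (ht : 0 < t) :
    ‖∑ k ∈ JJ X d, (Real.log k : ℂ) * EE t (d * k)‖ ≤
      120 * (Real.log (2 * X)) * (Real.sqrt (t * X) + Real.sqrt (X / t) / d) := by
  have hd' : (1 : ℝ) ≤ d := by exact_mod_cast hd
  have hX : 0 < X := by linarith
  have hle : ⌊X / (2 * d)⌋₊ + 1 ≤ ⌊X / d⌋₊ + 1 := by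
    gcongr
    nlinarith
  refine (abel_log _ _ _ (by omega) hle _ (fun b' hb' => inner_piece hd hdX ht b' hb')).trans ?_
  have h2 := (JJ_bounds hd hdX).2
  have h3 : Real.log ((⌊X / d⌋₊ + 1 : ℕ) : ℝ) ≤ Real.log (2 * X) := by
    apply Real.log_le_log (by positivity)
    refine h2.trans ?_
    have : X / d ≤ X := div_le_self hX.le hd'
    linarith
  have : 0 ≤ Real.sqrt (t * X) + Real.sqrt (X / t) / d := by positivity
  nlinarith

/-- Double sum unfolding of a Dirichlet convolution. -/
lemma conv_sum {X : ℝ} (hX : 0 ≤ X) (f g : ArithmeticFunction ℝ) (E : ℕ → ℂ) :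
    ∑ n ∈ JJ X 1, (((f * g) n : ℝ) : ℂ) * E n =
      ∑ d ∈ Finset.Ioc 0 ⌊X⌋₊, ∑ k ∈ JJ X d, (f d : ℂ) * ((g k : ℂ) * E (d * k)) := by
  have step : ∀ n ∈ JJ X 1, (((f * g) n : ℝ) : ℂ) * E n =
      ∑ p ∈ Finset.Ioc 0 ⌊X⌋₊ ×ˢ Finset.Ioc 0 ⌊X⌋₊, if p.1 * p.2 = n then (f p.1 : ℂ) * ((g p.2 : ℂ) * E (p.1 * p.2)) else 0 := by
    intro n hn
    rw [mem_JJ hX one_pos] at hn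
    have hn0 : n ≠ 0 := by
      rintro rfl; simp at hn; linarith
    have hnX : n ≤ ⌊X⌋₊ := Nat.le_floor (by simpa using hn.2)
    rw [ArithmeticFunction.mul_apply, Nat.divisorsAntidiagonal_eq_prod_filter_of_le hn0 hnX, ← Finset.sum_filter]
    push_cast
    rw [Finset.sum_mul]
    apply Finset.sum_congr rfl
    intro p hp
    rw [(Finset.mem_filter.mp hp).2]; ring
  rw [Finset.sum_congr rfl step, Finset.sum_comm, Finset.sum_product]
  apply Finset.sum_congr rfl
  intro d hd
  rw [Finset.mem_Ioc] at hd
  have hsub : JJ X d ⊆ Finset.Ioc 0 ⌊X⌋₊ := by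
    intro k hk
    rw [mem_JJ hX hd.1] at hk
    have hd' : (1 : ℝ) ≤ d := by exact_mod_cast hd.1
    have hk0 : k ≠ 0 := by rintro rfl; simp at hk; linarith
    have hk1 : (1 : ℝ) ≤ k := by exact_mod_cast Nat.one_le_iff_ne_zero.mpr hk0
    rw [Finset.mem_Ioc]
    exact ⟨by omega, Nat.le_floor (by nlinarith)⟩
  rw [← Finset.sum_subset hsub]
  · apply Finset.sum_congr rfl
    intro k hk
    rw [Finset.sum_ite_eq, if_pos]
    rw [mem_JJ hX hd.1] at hk
    rw [mem_JJ hX one_pos]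
    push_cast; simpa using hk
  · intro k _ hk
    rw [Finset.sum_ite_eq, if_neg]
    rw [mem_JJ hX hd.1] at hk
    rw [mem_JJ hX one_pos]
    push_cast; simpa using hk

lemma sum_inv_le {X : ℝ} (hX : 1 ≤ X) : ∑ d ∈ Finset.Ioc 0 ⌊X⌋₊, (1 : ℝ) / d ≤ 1 + Real.log X := by
  have h := harmonic_le_one_add_log ⌊X⌋₊
  have h2 : ((harmonic ⌊X⌋₊ : ℚ) : ℝ) = ∑ d ∈ Finset.Ioc 0 ⌊X⌋₊, (1 : ℝ) / d := by
    rw [harmonic_eq_sum_Icc]; push_cast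
    have : Finset.Icc 1 ⌊X⌋₊ = Finset.Ioc 0 ⌊X⌋₊ := by ext; simp [Nat.succ_le_iff]
    rw [this]; simp
  rw [← h2]
  refine h.trans ?_
  have : Real.log (⌊X⌋₊ : ℝ) ≤ Real.log X := by
    apply Real.log_le_log
    · exact_mod_cast Nat.floor_pos.mpr hX
    · exact Nat.floor_le (by linarith)
  linarith

/-- Type I estimate. -/
lemma type1 {X t : ℝ} (hX : 1 ≤ X) (ht : 0 < t) (f g : ArithmeticFunction ℝ) (F G D : ℝ) (hF : 0 ≤ F) (hG : 0 ≤ G)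
    (hD : 0 ≤ D)
    (hf : ∀ d : ℕ, 0 < d → (d : ℝ) ≤ X → |f d| ≤ F) (hf2 : ∀ d : ℕ, D < d → f d = 0)
    (hg : ∀ d : ℕ, 0 < d → (d : ℝ) ≤ X → ‖∑ k ∈ JJ X d, (g k : ℂ) * EE t (d * k)‖ ≤ G * (Real.sqrt (t * X) + Real.sqrt (X / t) / d)) :
    ‖∑ n ∈ JJ X 1, (((f * g) n : ℝ) : ℂ) * EE t n‖ ≤
      F * G * (D * Real.sqrt (t * X) + Real.sqrt (X / t) * (1 + Real.log X)) := by
  rw [conv_sum (by linarith)]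
  have h1 : ∀ d ∈ Finset.Ioc 0 ⌊X⌋₊, ‖∑ k ∈ JJ X d, (f d : ℂ) * ((g k : ℂ) * EE t (d * k))‖ ≤
      F * G * ((if (d : ℝ) ≤ D then Real.sqrt (t * X) else 0) + Real.sqrt (X / t) * (1 / d)) := by
    intro d hd
    rw [Finset.mem_Ioc] at hd
    have hdX : (d : ℝ) ≤ X := (Nat.le_floor_iff (by linarith)).mp hd.2
    rw [← Finset.mul_sum, norm_mul, Complex.norm_real, Real.norm_eq_abs]
    split_ifs with h
    · have a1 := hf d hd.1 hdX
      have a2 := hg d hd.1 hdX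
      calc _ ≤ F * (G * (Real.sqrt (t * X) + Real.sqrt (X / t) / d)) :=
            mul_le_mul a1 a2 (norm_nonneg _) hF
        _ = _ := by ring
    · rw [hf2 d (by linarith)]; simp; positivity
  refine (norm_sum_le_of_le _ h1).trans ?_
  rw [← Finset.mul_sum, Finset.sum_add_distrib, ← Finset.mul_sum]
  apply mul_le_mul_of_nonneg_left _ (by positivity)
  apply add_le_add
  · rw [← Finset.sum_filter, Finset.sum_const, nsmul_eq_mul]
    apply mul_le_mul_of_nonneg_right _ (Real.sqrt_nonneg _)
    have : (Finset.Ioc 0 ⌊X⌋₊).filter (fun d : ℕ => (d : ℝ) ≤ D) ⊆ Finset.Ioc 0 ⌊D⌋₊ := by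
      intro d hd
      rw [Finset.mem_filter, Finset.mem_Ioc] at hd
      rw [Finset.mem_Ioc]
      exact ⟨hd.1.1, Nat.le_floor hd.2⟩
    have := Finset.card_le_card this
    rw [Nat.card_Ioc] at this
    exact le_trans (by exact_mod_cast this) (Nat.floor_le hD)
  · exact mul_le_mul_of_nonneg_left (sum_inv_le hX) (Real.sqrt_nonneg _)

end TLI


namespace TLI

open Finset in
lemma dual_bound (T MM : Finset ℕ) (v : ℕ → ℕ → ℂ) (b : ℕ → ℝ) (H : ℕ) (Ψ : ℕ → ℝ) (hΨ : ∀ h, 0 ≤ Ψ h)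
    (hv : ∀ n₁ ∈ T, ∀ n₂ ∈ T, ‖∑ m ∈ MM, v n₁ m * (starRingEnd ℂ) (v n₂ m)‖ ≤ Ψ (Nat.dist n₁ n₂))
    (hT : ∀ n₁ ∈ T, ∀ n₂ ∈ T, Nat.dist n₁ n₂ < H) :
    ∑ m ∈ MM, ‖∑ n ∈ T, (b n : ℂ) * v n m‖ ^ 2 ≤ (∑ n ∈ T, b n ^ 2) * (2 * ∑ h ∈ range H, Ψ h) := by
  have hsum : ∀ n₁ ∈ T, ∑ n₂ ∈ T, Ψ (Nat.dist n₁ n₂) ≤ 2 * ∑ h ∈ range H, Ψ h := by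
    intro n₁ h1
    rw [← Finset.sum_filter_add_sum_filter_not T (fun n => n ≤ n₁), two_mul]
    apply add_le_add
    · rw [← Finset.sum_image (f := Ψ) (g := fun n₂ => Nat.dist n₁ n₂) (s := T.filter (fun n => n ≤ n₁))]
      · apply Finset.sum_le_sum_of_subset_of_nonneg
        · intro h hh
          rw [mem_image] at hh
          obtain ⟨n, hn, rfl⟩ := hh
          rw [mem_range]
          exact hT _ h1 _ (mem_filter.mp hn).1
        · intros; exact hΨ _
      · intro x hx y hy hxy
        have := (mem_filter.mp hx).2
        have := (mem_filter.mp hy).2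
        simp only [Nat.dist] at hxy
        omega
    · rw [← Finset.sum_image (f := Ψ) (g := fun n₂ => Nat.dist n₁ n₂) (s := T.filter (fun n => ¬ n ≤ n₁))]
      · apply Finset.sum_le_sum_of_subset_of_nonneg
        · intro h hh
          rw [mem_image] at hh
          obtain ⟨n, hn, rfl⟩ := hh
          rw [mem_range]
          exact hT _ h1 _ (mem_filter.mp hn).1
        · intros; exact hΨ _
      · intro x hx y hy hxy
        have := (mem_filter.mp hx).2
        have := (mem_filter.mp hy).2
        simp only [Nat.dist] at hxy
        omega
  have key : ((∑ m ∈ MM, ‖∑ n ∈ T, (b n : ℂ) * v n m‖ ^ 2 : ℝ) : ℂ) =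
      ∑ n₁ ∈ T, ∑ n₂ ∈ T, ((b n₁ : ℂ) * b n₂) * ∑ m ∈ MM, v n₁ m * (starRingEnd ℂ) (v n₂ m) := by
    push_cast
    have : ∀ m ∈ MM, ((‖∑ n ∈ T, (b n : ℂ) * v n m‖ : ℂ)) ^ 2 =
        ∑ n₁ ∈ T, ∑ n₂ ∈ T, ((b n₁ : ℂ) * b n₂) * (v n₁ m * (starRingEnd ℂ) (v n₂ m)) := by
      intro m _
      rw [← Complex.mul_conj', map_sum, Finset.sum_mul_sum]
      apply Finset.sum_congr rfl; intro n₁ _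
      apply Finset.sum_congr rfl; intro n₂ _
      rw [map_mul, Complex.conj_ofReal]; ring
    rw [Finset.sum_congr rfl this, Finset.sum_comm]
    apply Finset.sum_congr rfl; intro n₁ _
    rw [Finset.sum_comm]
    apply Finset.sum_congr rfl; intro n₂ _
    rw [Finset.mul_sum]
  have h0 : 0 ≤ ∑ m ∈ MM, ‖∑ n ∈ T, (b n : ℂ) * v n m‖ ^ 2 := Finset.sum_nonneg (fun _ _ => by positivity)
  have h2 : ∑ m ∈ MM, ‖∑ n ∈ T, (b n : ℂ) * v n m‖ ^ 2 =
      ‖∑ n₁ ∈ T, ∑ n₂ ∈ T, ((b n₁ : ℂ) * b n₂) * ∑ m ∈ MM, v n₁ m * (starRingEnd ℂ) (v n₂ m)‖ := by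
    rw [← key, Complex.norm_real, Real.norm_of_nonneg h0]
  rw [h2]
  have h3 : ‖∑ n₁ ∈ T, ∑ n₂ ∈ T, ((b n₁ : ℂ) * b n₂) * ∑ m ∈ MM, v n₁ m * (starRingEnd ℂ) (v n₂ m)‖ ≤
      ∑ n₁ ∈ T, ∑ n₂ ∈ T, (b n₁ ^ 2 / 2 * Ψ (Nat.dist n₁ n₂) + b n₂ ^ 2 / 2 * Ψ (Nat.dist n₁ n₂)) := by
    apply norm_sum_le_of_le; intro n₁ hn1
    apply norm_sum_le_of_le; intro n₂ hn2
    rw [norm_mul, norm_mul, Complex.norm_real, Complex.norm_real, Real.norm_eq_abs, Real.norm_eq_abs]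
    have e1 : |b n₁| * |b n₂| ≤ b n₁ ^ 2 / 2 + b n₂ ^ 2 / 2 := by
      nlinarith [sq_nonneg (|b n₁| - |b n₂|), sq_abs (b n₁), sq_abs (b n₂)]
    calc _ ≤ (b n₁ ^ 2 / 2 + b n₂ ^ 2 / 2) * Ψ (Nat.dist n₁ n₂) :=
          mul_le_mul e1 (hv _ hn1 _ hn2) (norm_nonneg _) (by positivity)
      _ = _ := by ring
  refine h3.trans ?_
  have h4 : ∑ n₁ ∈ T, ∑ n₂ ∈ T, b n₁ ^ 2 / 2 * Ψ (Nat.dist n₁ n₂) ≤ (∑ n ∈ T, b n ^ 2 / 2) * (2 * ∑ h ∈ range H, Ψ h) := by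
    rw [Finset.sum_mul]
    apply Finset.sum_le_sum; intro n₁ hn1
    rw [← Finset.mul_sum]
    exact mul_le_mul_of_nonneg_left (hsum n₁ hn1) (by positivity)
  have h5 : ∑ n₁ ∈ T, ∑ n₂ ∈ T, b n₂ ^ 2 / 2 * Ψ (Nat.dist n₁ n₂) = ∑ n₁ ∈ T, ∑ n₂ ∈ T, b n₁ ^ 2 / 2 * Ψ (Nat.dist n₁ n₂) := by
    rw [Finset.sum_comm]
    apply Finset.sum_congr rfl; intro n₁ _
    apply Finset.sum_congr rfl; intro n₂ _
    rw [Nat.dist_comm]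
  simp only [Finset.sum_add_distrib]
  rw [h5]
  rw [← Finset.sum_div] at h4
  nlinarith

/-- The cut-off phase. -/
noncomputable def vv (X t : ℝ) (n m : ℕ) : ℂ := if m ∈ JJ X n then EE t (n * m) else 0

lemma norm_vv_le (X t : ℝ) (n m : ℕ) : ‖vv X t n m‖ ≤ 1 := by
  unfold vv; split_ifs
  · rw [norm_EE]
  · simp

lemma vv_corr_lt {X t : ℝ} {N : ℕ} (hN : 0 < N) (hNX : 2 * (N : ℝ) ≤ X) (ht : 0 < t) (MM : Finset ℕ)
    (hMM : ∀ n, N < n → JJ X n ⊆ MM) (n₁ n₂ : ℕ) (h1 : N < n₁) (h12 : n₁ < n₂) (h2 : n₂ ≤ 2 * N) :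
    ‖∑ m ∈ MM, vv X t n₁ m * (starRingEnd ℂ) (vv X t n₂ m)‖ ≤
      60 * (Real.sqrt (t * (n₂ - n₁ : ℕ) * (X / N)) + Real.sqrt (X / N / (t * (n₂ - n₁ : ℕ)))) := by
  have hN' : (0 : ℝ) < N := by exact_mod_cast hN
  have hX : 0 < X := by linarith
  have h1' : (N : ℝ) < n₁ := by exact_mod_cast h1
  have h12' : (n₁ : ℝ) < n₂ := by exact_mod_cast h12
  have h2' : (n₂ : ℝ) ≤ 2 * N := by exact_mod_cast h2
  have n1p : (0 : ℝ) < n₁ := by linarith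
  have n2p : (0 : ℝ) < n₂ := by linarith
  set a := ⌊X / (2 * n₁)⌋₊ + 1 with ha
  set b := ⌊X / n₂⌋₊ + 1 with hb
  have h_inter : ∀ m, (m ∈ JJ X n₁ ∧ m ∈ JJ X n₂) ↔ m ∈ Finset.Ico a b := by
    intro m
    unfold JJ
    simp only [Finset.mem_Ico]
    have e1 : ⌊X / (2 * n₂)⌋₊ ≤ ⌊X / (2 * n₁)⌋₊ := by gcongr
    have e2 : ⌊X / n₂⌋₊ ≤ ⌊X / n₁⌋₊ := by gcongr
    omega
  have hsub : Finset.Ico a b ⊆ MM := fun m hm => hMM n₁ h1 ((h_inter m).mpr hm).1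
  rw [← Finset.sum_subset hsub]
  · have e : ∀ m ∈ Finset.Ico a b, vv X t n₁ m * (starRingEnd ℂ) (vv X t n₂ m) =
        (starRingEnd ℂ) (ee ((t * (n₂ * Real.log n₂ - n₁ * Real.log n₁)) * m + (t * (n₂ - n₁ : ℕ)) * xl m)) := by
      intro m hm
      have hm' := (h_inter m).mpr hm
      have mp : 0 < m := by
        rw [Finset.mem_Ico] at hm; omega
      unfold vv
      rw [if_pos hm'.1, if_pos hm'.2, EE_mul t n₁ m (by omega) mp, EE_mul t n₂ m (by omega) mp,
        ← ee_neg, ← ee_neg, ← ee_add]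
      congr 1
      rw [Nat.cast_sub h12.le]; ring
    rw [Finset.sum_congr rfl e, ← map_sum, RCLike.norm_conj]
    have hd : 0 < ((n₂ - n₁ : ℕ) : ℝ) := by exact_mod_cast (by omega : 0 < n₂ - n₁)
    have jb := JJ_bounds (X := X) (d := n₁) (by omega) (by linarith)
    have jb2 := JJ_bounds (X := X) (d := n₂) (by omega) (by linarith)
    have hba : b ≤ 2 * a := by
      have e2 : ⌊X / n₂⌋₊ ≤ ⌊X / n₁⌋₊ := by gcongr
      omega
    refine (vdc _ _ _ _ (by omega) hba (by positivity)).trans ?_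
    have hb2 : (b : ℝ) ≤ 2 * (X / N) := by
      refine jb2.2.trans ?_
      have : X / n₂ ≤ X / N := by gcongr; linarith
      linarith
    have hM : 0 < X / N := by positivity
    have s1 : Real.sqrt (t * (n₂ - n₁ : ℕ) * b) ≤ 2 * Real.sqrt (t * (n₂ - n₁ : ℕ) * (X / N)) := by
      rw [show (2 : ℝ) * Real.sqrt (t * (n₂ - n₁ : ℕ) * (X / N)) = Real.sqrt (2 ^ 2 * (t * (n₂ - n₁ : ℕ) * (X / N))) by
        rw [Real.sqrt_mul (by norm_num) (t * (n₂ - n₁ : ℕ) * (X / N)), Real.sqrt_sq (by norm_num)]]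
      apply Real.sqrt_le_sqrt
      have := mul_le_mul_of_nonneg_left hb2 (by positivity : 0 ≤ t * ((n₂ - n₁ : ℕ) : ℝ))
      have : 0 < t * ((n₂ - n₁ : ℕ) : ℝ) * (X / N) := by positivity
      linarith
    have s2 : Real.sqrt (b / (t * (n₂ - n₁ : ℕ))) ≤ 2 * Real.sqrt (X / N / (t * (n₂ - n₁ : ℕ))) := by
      rw [show (2 : ℝ) * Real.sqrt (X / N / (t * (n₂ - n₁ : ℕ))) = Real.sqrt (2 ^ 2 * (X / N / (t * (n₂ - n₁ : ℕ)))) by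
        rw [Real.sqrt_mul (by norm_num) (X / N / (t * (n₂ - n₁ : ℕ))), Real.sqrt_sq (by norm_num)]]
      apply Real.sqrt_le_sqrt
      have : b / (t * ((n₂ - n₁ : ℕ) : ℝ)) ≤ 2 * (X / N) / (t * ((n₂ - n₁ : ℕ) : ℝ)) := by gcongr
      have e3 : 2 * (X / N) / (t * ((n₂ - n₁ : ℕ) : ℝ)) = 2 * (X / N / (t * ((n₂ - n₁ : ℕ) : ℝ))) := by ring
      have : 0 < (X / N / (t * ((n₂ - n₁ : ℕ) : ℝ))) := by positivity
      linarith
    linarith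
  · intro m _ hm
    have := (not_congr (h_inter m)).mpr hm
    unfold vv
    by_cases c1 : m ∈ JJ X n₁
    · have c2 : m ∉ JJ X n₂ := fun h => this ⟨c1, h⟩
      rw [if_neg c2]; simp
    · rw [if_neg c1]; simp

lemma sum_inv_sqrt' (H : ℕ) : ∑ h ∈ Finset.range (H + 1), 1 / Real.sqrt (h : ℝ) ≤ 2 * Real.sqrt H := by
  induction H with
  | zero => simp
  | succ H ih =>
    rw [Finset.sum_range_succ]
    have h1 : 0 < Real.sqrt ((H + 1 : ℕ) : ℝ) := by
      apply Real.sqrt_pos.mpr; positivity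
    have h0 : 0 ≤ Real.sqrt (H : ℝ) := Real.sqrt_nonneg _
    have q1 : Real.sqrt ((H + 1 : ℕ) : ℝ) ^ 2 = H + 1 := by rw [Real.sq_sqrt (by positivity)]; push_cast; ring
    have q0 : Real.sqrt (H : ℝ) ^ 2 = H := Real.sq_sqrt (by positivity)
    have : 1 / Real.sqrt ((H + 1 : ℕ) : ℝ) ≤ 2 * (Real.sqrt ((H + 1 : ℕ) : ℝ) - Real.sqrt H) := by
      rw [div_le_iff₀ h1]
      nlinarith [sq_nonneg (Real.sqrt ((H + 1 : ℕ) : ℝ) - Real.sqrt H)]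
    linarith

lemma sum_inv_sqrt (H : ℕ) : ∑ h ∈ Finset.range H, 1 / Real.sqrt (h : ℝ) ≤ 2 * Real.sqrt H := by
  cases H with
  | zero => simp
  | succ H =>
    refine (sum_inv_sqrt' H).trans ?_
    gcongr
    linarith

lemma type2_block {X t : ℝ} {N H : ℕ} (hN : 0 < N) (hNX : 2 * (N : ℝ) ≤ X) (ht : 0 < t)
    (b : ℕ → ℝ) (T : Finset ℕ) (hT1 : T ⊆ Finset.Ioc N (2 * N)) (hT : ∀ n₁ ∈ T, ∀ n₂ ∈ T, Nat.dist n₁ n₂ < H) :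
    ∑ m ∈ Finset.Ioc 0 ⌊X / N⌋₊, ‖∑ n ∈ T, (b n : ℂ) * vv X t n m‖ ^ 2 ≤
      (∑ n ∈ T, b n ^ 2) * (2 * (X / N) + 120 * H * Real.sqrt (t * H * (X / N)) + 240 * Real.sqrt (X / N * H / t)) := by
  have hN' : (0 : ℝ) < N := by exact_mod_cast hN
  have hX : 0 < X := by linarith
  set M := X / N with hM
  have hM0 : 0 < M := by positivity
  have hMM : ∀ n, N < n → JJ X n ⊆ Finset.Ioc 0 ⌊M⌋₊ := by
    intro n hn m hm
    have hn' : (N : ℝ) < n := by exact_mod_cast hn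
    unfold JJ at hm
    rw [Finset.mem_Ico] at hm
    rw [Finset.mem_Ioc]
    have : ⌊X / n⌋₊ ≤ ⌊M⌋₊ := by rw [hM]; gcongr
    omega
  set Ψ : ℕ → ℝ := fun h => if h = 0 then M else 60 * (Real.sqrt (t * h * M) + Real.sqrt (M / (t * h))) with hΨ
  have hd := dual_bound T (Finset.Ioc 0 ⌊M⌋₊) (vv X t) b H Ψ ?_ ?_ hT
  · refine hd.trans ?_
    apply mul_le_mul_of_nonneg_left _ (Finset.sum_nonneg (fun _ _ => by positivity))
    by_cases hH : H = 0
    · subst hH; simp; positivity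
    have hle : ∀ h ∈ Finset.range H, Ψ h ≤ (if h = 0 then M else 0) + 60 * Real.sqrt (t * H * M) + 60 * Real.sqrt (M / t) * (1 / Real.sqrt h) := by
      intro h hh
      rw [Finset.mem_range] at hh
      simp only [hΨ]
      split_ifs with h0
      · subst h0; simp
      · have hp : (0 : ℝ) < h := by exact_mod_cast Nat.pos_of_ne_zero h0
        have hhH : (h : ℝ) ≤ H := by exact_mod_cast hh.le
        have e1 : Real.sqrt (t * h * M) ≤ Real.sqrt (t * H * M) := by
          apply Real.sqrt_le_sqrt; gcongr
        have e2 : Real.sqrt (M / (t * h)) = Real.sqrt (M / t) * (1 / Real.sqrt h) := by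
          rw [← div_div, Real.sqrt_div (by positivity : 0 ≤ M / t)]; ring
        rw [e2]; linarith
    have hs := Finset.sum_le_sum hle
    rw [Finset.sum_add_distrib, Finset.sum_add_distrib, ← Finset.mul_sum, Finset.sum_const, Finset.sum_ite_eq' ,
      if_pos (Finset.mem_range.mpr (Nat.pos_of_ne_zero hH)), Finset.card_range, nsmul_eq_mul] at hs
    have h5 := mul_le_mul_of_nonneg_left (sum_inv_sqrt H) (by positivity : 0 ≤ 60 * Real.sqrt (M / t))
    have e4 : Real.sqrt (M * H / t) = Real.sqrt (M / t) * Real.sqrt H := by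
      rw [← Real.sqrt_mul (by positivity)]; congr 1; ring
    rw [e4]
    rw [Finset.mul_sum] at h5
    linarith
  · intro h
    simp only [hΨ]; split_ifs <;> positivity
  · intro n₁ hn1 n₂ hn2
    have m1 := Finset.mem_Ioc.mp (hT1 hn1)
    have m2 := Finset.mem_Ioc.mp (hT1 hn2)
    simp only [hΨ]
    rcases lt_trichotomy n₁ n₂ with hlt | heq | hgt
    · rw [if_neg (by simp only [Nat.dist]; omega), Nat.dist_eq_sub_of_le hlt.le]
      exact vv_corr_lt hN hNX ht _ hMM n₁ n₂ m1.1 hlt m2.2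
    · subst heq
      rw [if_pos (Nat.dist_self _)]
      refine (norm_sum_le_of_le (f := fun m => vv X t n₁ m * (starRingEnd ℂ) (vv X t n₁ m)) _ (n := fun _ => 1) ?_).trans ?_
      · intro m _
        rw [norm_mul, RCLike.norm_conj]
        have := norm_vv_le X t n₁ m
        nlinarith [norm_nonneg (vv X t n₁ m)]
      · simp; exact Nat.floor_le hM0.le
    · rw [if_neg (by simp only [Nat.dist]; omega), Nat.dist_comm, Nat.dist_eq_sub_of_le hgt.le]
      refine le_trans (le_of_eq ?_) (vv_corr_lt hN hNX ht _ hMM n₂ n₁ m2.1 hgt m1.2)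
      rw [← RCLike.norm_conj, map_sum]
      congr 1
      apply Finset.sum_congr rfl; intro m _
      simp [mul_comm]

/-- Type II estimate. -/
lemma type2 {X t : ℝ} {N H : ℕ} (hH : 0 < H) (hHN : H ≤ N) (hNX : 2 * (N : ℝ) ≤ X) (ht : 0 < t)
    (a b : ℕ → ℝ) (Ka Kb : ℝ) (hKa : ∑ m ∈ Finset.Ioc 0 ⌊X / N⌋₊, a m ^ 2 ≤ Ka)
    (hKb : ∑ n ∈ Finset.Ioc N (2 * N), b n ^ 2 ≤ Kb) :
    ‖∑ n ∈ Finset.Ioc N (2 * N), ∑ m ∈ JJ X n, (b n : ℂ) * (a m * EE t (n * m))‖ ^ 2 ≤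
      (5 * N / H * Ka) * (Kb * (2 * (X / N) + 120 * H * Real.sqrt (t * H * (X / N)) + 240 * Real.sqrt (X / N * H / t))) := by
  have hN : 0 < N := by omega
  have hN' : (0 : ℝ) < N := by exact_mod_cast hN
  have hH' : (0 : ℝ) < H := by exact_mod_cast hH
  have hHN' : (H : ℝ) ≤ N := by exact_mod_cast hHN
  have hX : 0 < X := by linarith
  set MM := Finset.Ioc 0 ⌊X / N⌋₊ with hMMdef
  have hMM : ∀ n, N < n → JJ X n ⊆ MM := by
    intro n hn m hm
    have hn' : (N : ℝ) < n := by exact_mod_cast hn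
    unfold JJ at hm
    rw [Finset.mem_Ico] at hm
    rw [hMMdef, Finset.mem_Ioc]
    have : ⌊X / n⌋₊ ≤ ⌊X / N⌋₊ := by gcongr
    omega
  set R := 2 * (X / N) + 120 * H * Real.sqrt (t * H * (X / N)) + 240 * Real.sqrt (X / N * H / t) with hR
  have hR0 : 0 ≤ R := by positivity
  set KK := Finset.range (2 * N / H + 1) with hKK
  set T : ℕ → Finset ℕ := fun κ => (Finset.Ioc N (2 * N)).filter (fun n => n / H = κ) with hTdef
  have hmaps : ∀ n ∈ Finset.Ioc N (2 * N), n / H ∈ KK := by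
    intro n hn
    rw [Finset.mem_Ioc] at hn
    rw [hKK, Finset.mem_range, Nat.lt_succ_iff]
    exact Nat.div_le_div_right hn.2
  have e1 : ∑ n ∈ Finset.Ioc N (2 * N), ∑ m ∈ JJ X n, (b n : ℂ) * (a m * EE t (n * m)) =
      ∑ p ∈ KK ×ˢ MM, (a p.2 : ℂ) * ∑ n ∈ T p.1, (b n : ℂ) * vv X t n p.2 := by
    rw [Finset.sum_product, ← Finset.sum_fiberwise_of_maps_to hmaps]
    apply Finset.sum_congr rfl
    intro κ _
    have : ∀ n ∈ T κ, ∑ m ∈ JJ X n, (b n : ℂ) * (a m * EE t (n * m)) =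
        ∑ m ∈ MM, (a m : ℂ) * ((b n : ℂ) * vv X t n m) := by
      intro n hn
      have hn' := (Finset.mem_Ioc.mp (Finset.mem_filter.mp hn).1).1
      rw [← Finset.sum_subset (hMM n hn')]
      · apply Finset.sum_congr rfl
        intro m hm
        unfold vv; rw [if_pos hm]; ring
      · intro m _ hm
        unfold vv; rw [if_neg hm]; ring
    rw [Finset.sum_congr rfl this, Finset.sum_comm]
    apply Finset.sum_congr rfl; intro m _
    rw [Finset.mul_sum]
  rw [e1]
  have c1 : ‖∑ p ∈ KK ×ˢ MM, (a p.2 : ℂ) * ∑ n ∈ T p.1, (b n : ℂ) * vv X t n p.2‖ ≤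
      ∑ p ∈ KK ×ˢ MM, |a p.2| * ‖∑ n ∈ T p.1, (b n : ℂ) * vv X t n p.2‖ := by
    apply norm_sum_le_of_le
    intro p _
    rw [norm_mul, Complex.norm_real, Real.norm_eq_abs]
  have c2 := Finset.sum_mul_sq_le_sq_mul_sq (KK ×ˢ MM) (fun p => |a p.2|) (fun p => ‖∑ n ∈ T p.1, (b n : ℂ) * vv X t n p.2‖)
  have c3 := pow_le_pow_left₀ (norm_nonneg _) c1 2
  refine (c3.trans c2).trans ?_
  have hKa0 : 0 ≤ ∑ m ∈ MM, a m ^ 2 := Finset.sum_nonneg (fun _ _ => by positivity)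
  have hKb0 : 0 ≤ ∑ n ∈ Finset.Ioc N (2 * N), b n ^ 2 := Finset.sum_nonneg (fun _ _ => by positivity)
  apply mul_le_mul
  · rw [Finset.sum_product]
    simp only [sq_abs]
    rw [Finset.sum_const, nsmul_eq_mul, hKK, Finset.card_range]
    apply mul_le_mul _ hKa hKa0 (by positivity)
    push_cast
    have : ((2 * N / H : ℕ) : ℝ) ≤ (2 * N : ℕ) / H := Nat.cast_div_le
    push_cast at this
    have h1 : 1 ≤ (N : ℝ) / H := by rw [le_div_iff₀ hH']; linarith
    have h2 : 2 * (N : ℝ) / H = 2 * (N / H) := by ring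
    have h3 : 5 * (N : ℝ) / H = 5 * (N / H) := by ring
    rw [h3]; linarith
  · rw [Finset.sum_product]
    have : ∀ κ ∈ KK, ∑ m ∈ MM, ‖∑ n ∈ T κ, (b n : ℂ) * vv X t n m‖ ^ 2 ≤ (∑ n ∈ T κ, b n ^ 2) * R := by
      intro κ _
      apply type2_block hN hNX ht b (T κ) (Finset.filter_subset _ _)
      intro n₁ h1 n₂ h2
      have g1 := (Finset.mem_filter.mp h1).2
      have g2 := (Finset.mem_filter.mp h2).2
      have m1 := Nat.mod_lt n₁ hH
      have m2 := Nat.mod_lt n₂ hH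
      have d1 := Nat.div_add_mod n₁ H
      have d2 := Nat.div_add_mod n₂ H
      rw [g1] at d1; rw [g2] at d2
      simp only [Nat.dist]
      omega
    refine (Finset.sum_le_sum this).trans ?_
    rw [← Finset.sum_mul, Finset.sum_fiberwise_of_maps_to hmaps]
    exact mul_le_mul_of_nonneg_right hKb hR0
  · exact Finset.sum_nonneg (fun _ _ => by positivity)
  · have : 0 ≤ Ka := hKa0.trans hKa
    positivity

end TLI


namespace TLI

open ArithmeticFunction in
/-- real divisor function -/
noncomputable def dd : ArithmeticFunction ℝ := (zeta : ArithmeticFunction ℝ) * (zeta : ArithmeticFunction ℝ)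

open ArithmeticFunction in
lemma dd_apply (n : ℕ) : dd n = (n.divisors.card : ℝ) := by
  unfold dd
  rw [coe_mul_zeta_apply]
  rw [Finset.sum_congr rfl (g := fun _ => (1 : ℝ))]
  · simp
  · intro i hi
    have := Nat.pos_of_mem_divisors hi
    simp [natCoe_apply, zeta_apply, this.ne']

lemma dd_nonneg (n : ℕ) : 0 ≤ dd n := by rw [dd_apply]; positivity

lemma one_le_dd {n : ℕ} (hn : 0 < n) : 1 ≤ dd n := by
  rw [dd_apply]
  have : 0 < n.divisors.card := Finset.card_pos.mpr ⟨1, by simp; omega⟩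
  exact_mod_cast this

lemma dd_sq_le (n : ℕ) : dd n ^ 2 ≤ (dd * dd) n := by
  rw [ArithmeticFunction.mul_apply]
  have : ∀ x ∈ n.divisorsAntidiagonal, dd n ≤ dd x.1 * dd x.2 := by
    intro x hx
    have h := (Nat.mem_divisorsAntidiagonal.mp hx).1
    rw [← h, dd_apply, dd_apply, dd_apply, Nat.divisors_mul]
    exact_mod_cast Finset.card_mul_le
  refine le_trans (le_of_eq ?_) (Finset.sum_le_sum this)
  rw [Finset.sum_const, nsmul_eq_mul, ← Nat.map_div_right_divisors, Finset.card_map, dd_apply]; ring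

lemma sum_dd_le (N : ℕ) (K : ℕ) (hK : 0 < K) (hNK : N ≤ K) : ∑ n ∈ Finset.Ioc 0 N, dd n ≤ N * (1 + Real.log K) := by
  unfold dd
  rw [ArithmeticFunction.sum_Ioc_mul_zeta_eq_sum]
  have : ∀ n ∈ Finset.Ioc 0 N, (ArithmeticFunction.zeta : ArithmeticFunction ℝ) n * ((N / n : ℕ) : ℝ) ≤ N * (1 / (n : ℝ)) := by
    intro n hn
    have := (Finset.mem_Ioc.mp hn).1
    rw [ArithmeticFunction.natCoe_apply, ArithmeticFunction.zeta_apply, if_neg this.ne']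
    have h2 : ((N / n : ℕ) : ℝ) ≤ N / n := Nat.cast_div_le
    simp; rw [← div_eq_mul_inv]; exact h2
  refine (Finset.sum_le_sum this).trans ?_
  rw [← Finset.mul_sum]
  apply mul_le_mul_of_nonneg_left _ (by positivity)
  have h3 := sum_inv_le (X := K) (by exact_mod_cast hK)
  rw [Nat.floor_natCast] at h3
  refine le_trans ?_ h3
  apply Finset.sum_le_sum_of_subset_of_nonneg
  · exact Finset.Ioc_subset_Ioc_right hNK
  · intros; positivity

lemma dd_div (n : ℕ) : dd n * (1 / (n : ℝ)) = ∑ x ∈ n.divisorsAntidiagonal, (1 / (x.1 : ℝ)) * (1 / (x.2 : ℝ)) := by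
  have : ∀ x ∈ n.divisorsAntidiagonal, (1 / (x.1 : ℝ)) * (1 / (x.2 : ℝ)) = 1 / (n : ℝ) := by
    intro x hx
    have h := (Nat.mem_divisorsAntidiagonal.mp hx).1
    rw [← h]; push_cast; rw [one_div_mul_one_div]
  rw [Finset.sum_congr rfl this, Finset.sum_const, nsmul_eq_mul, ← Nat.map_div_right_divisors, Finset.card_map, dd_apply]

/-- the function 1/n -/
noncomputable def iv : ArithmeticFunction ℝ := ⟨fun n => 1 / (n : ℝ), by simp⟩

lemma sum_dd_div_le (N : ℕ) (hN : 0 < N) : ∑ n ∈ Finset.Ioc 0 N, dd n * (1 / (n : ℝ)) ≤ (1 + Real.log N) ^ 2 := by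
  have e : ∀ n ∈ Finset.Ioc 0 N, dd n * (1 / (n : ℝ)) = (iv * iv) n := by
    intro n _
    rw [dd_div, ArithmeticFunction.mul_apply]; rfl
  rw [Finset.sum_congr rfl e, ArithmeticFunction.sum_Ioc_mul_eq_sum_sum]
  have h3 := sum_inv_le (X := N) (by exact_mod_cast hN)
  rw [Nat.floor_natCast] at h3
  have hlog : 0 ≤ Real.log N := Real.log_natCast_nonneg N
  have h4 : ∀ n ∈ Finset.Ioc 0 N, iv n * ∑ m ∈ Finset.Ioc 0 (N / n), iv m ≤ (1 / (n : ℝ)) * (1 + Real.log N) := by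
    intro n _
    apply mul_le_mul_of_nonneg_left _ (by positivity : 0 ≤ 1 / (n : ℝ))
    refine le_trans ?_ h3
    apply Finset.sum_le_sum_of_subset_of_nonneg (f := fun m : ℕ => 1 / (m : ℝ))
    · exact Finset.Ioc_subset_Ioc_right (Nat.div_le_self _ _)
    · intros; positivity
  refine (Finset.sum_le_sum h4).trans ?_
  rw [← Finset.sum_mul]
  nlinarith

lemma sum_dd_sq_le (N : ℕ) : ∑ n ∈ Finset.Ioc 0 N, dd n ^ 2 ≤ N * (1 + Real.log N) ^ 3 := by
  rcases Nat.eq_zero_or_pos N with rfl | hN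
  · simp
  have hlog : 0 ≤ Real.log N := Real.log_natCast_nonneg N
  refine (Finset.sum_le_sum (fun n _ => dd_sq_le n)).trans ?_
  rw [ArithmeticFunction.sum_Ioc_mul_eq_sum_sum]
  have h4 : ∀ n ∈ Finset.Ioc 0 N, dd n * ∑ m ∈ Finset.Ioc 0 (N / n), dd m ≤ (dd n * (1 / (n : ℝ))) * (N * (1 + Real.log N)) := by
    intro n _
    rw [mul_assoc]
    apply mul_le_mul_of_nonneg_left _ (dd_nonneg n)
    refine (sum_dd_le (N / n) N hN (Nat.div_le_self _ _)).trans ?_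
    have h2 : ((N / n : ℕ) : ℝ) ≤ N / n := Nat.cast_div_le
    calc _ ≤ ((N : ℝ) / n) * (1 + Real.log N) := by gcongr
      _ = _ := by ring
  refine (Finset.sum_le_sum h4).trans ?_
  rw [← Finset.sum_mul]
  have := mul_le_mul_of_nonneg_right (sum_dd_div_le N hN) (by positivity : 0 ≤ N * (1 + Real.log N))
  refine this.trans (le_of_eq ?_); ring

/-- truncation -/
noncomputable def cut (u : ℕ) (f : ArithmeticFunction ℝ) : ArithmeticFunction ℝ :=
  ⟨fun n => if n ≤ u then f n else 0, by simp⟩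

lemma cut_apply (u : ℕ) (f : ArithmeticFunction ℝ) (n : ℕ) : cut u f n = if n ≤ u then f n else 0 := rfl

/-- real Moebius -/
noncomputable def mu : ArithmeticFunction ℝ := (ArithmeticFunction.moebius : ArithmeticFunction ℝ)

lemma mu_apply (n : ℕ) : mu n = (ArithmeticFunction.moebius n : ℝ) := rfl

lemma abs_mu_le (n : ℕ) : |mu n| ≤ 1 := by
  rw [mu_apply]
  have := ArithmeticFunction.abs_moebius_le_one (n := n)
  exact_mod_cast this

/-- real zeta -/
noncomputable def ze : ArithmeticFunction ℝ := (ArithmeticFunction.zeta : ArithmeticFunction ℝ)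

lemma ze_apply {n : ℕ} (hn : 0 < n) : ze n = 1 := by
  unfold ze; rw [ArithmeticFunction.natCoe_apply, ArithmeticFunction.zeta_apply, if_neg hn.ne']; simp

lemma vaughan (u : ℕ) : ArithmeticFunction.vonMangoldt =
    cut u ArithmeticFunction.vonMangoldt + cut u mu * ArithmeticFunction.log
      - (cut u mu * cut u ArithmeticFunction.vonMangoldt) * ze
      + (ArithmeticFunction.vonMangoldt - cut u ArithmeticFunction.vonMangoldt) * ((mu - cut u mu) * ze) := by
  have h1 : ArithmeticFunction.vonMangoldt * ze = ArithmeticFunction.log := ArithmeticFunction.vonMangoldt_mul_zeta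
  have h2 : mu * ze = 1 := by unfold mu ze; exact ArithmeticFunction.coe_moebius_mul_coe_zeta
  rw [← h1]
  have e : (ArithmeticFunction.vonMangoldt - cut u ArithmeticFunction.vonMangoldt) * ((mu - cut u mu) * ze)
     = (ArithmeticFunction.vonMangoldt - cut u ArithmeticFunction.vonMangoldt) * (mu * ze) -
       (ArithmeticFunction.vonMangoldt - cut u ArithmeticFunction.vonMangoldt) * (cut u mu * ze) := by ring
  rw [e, h2]; ring

end TLI


namespace TLI

lemma sqrt_rpow {X : ℝ} (hX : 0 < X) (a : ℝ) : Real.sqrt (X ^ a) = X ^ (a / 2) := by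
  rw [Real.sqrt_eq_rpow, ← Real.rpow_mul hX.le]; congr 1; ring

/-- choice of the shift parameter -/
lemma choose_H {X t : ℝ} {u N : ℕ} (hX : 1 ≤ X) (hu1 : X ^ (1 / 5 : ℝ) ≤ u) (hu2 : (u : ℝ) ≤ 2 * X ^ (1 / 5 : ℝ))
    (ht1 : 0 < t) (ht2 : t ≤ X ^ (2 / 25 : ℝ)) (huN : u ≤ N) (hN : (N : ℝ) ^ 2 ≤ X) :
    ∃ H : ℕ, 0 < H ∧ H ≤ N ∧ 2 / (H : ℝ) + 120 * Real.sqrt (t * H * N / X) + 240 * Real.sqrt (N / (X * H * t)) ≤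
      500 * (X ^ (-(1 / 10) : ℝ) + (t * X) ^ (-(1 / 2) : ℝ)) := by
  have hX0 : 0 < X := by linarith
  have hup : 0 < u := by
    have : 0 < (u : ℝ) := lt_of_lt_of_le (by positivity) hu1
    exact_mod_cast this
  have hup' : (0 : ℝ) < u := by exact_mod_cast hup
  have hNp : (0 : ℝ) < N := by exact_mod_cast (by omega : 0 < N)
  have huN' : (u : ℝ) ≤ N := by exact_mod_cast huN
  have hNs : (N : ℝ) ≤ X ^ (1 / 2 : ℝ) := by
    rw [← Real.sqrt_eq_rpow]; exact Real.le_sqrt_of_sq_le hN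
  have htX : (0 : ℝ) < (t * X) ^ (-(1 / 2) : ℝ) := by positivity
  have hp : ∀ a b : ℝ, a ≤ b → X ^ a ≤ X ^ b := fun a b h => Real.rpow_le_rpow_of_exponent_le hX h
  have hu' : 2 / (u : ℝ) ≤ 2 * X ^ (-(1 / 10) : ℝ) := by
    have : 1 / (u : ℝ) ≤ X ^ (-(1 / 5) : ℝ) := by
      rw [Real.rpow_neg hX0.le, ← one_div]
      exact one_div_le_one_div_of_le (by positivity) hu1
    have h2 := hp (-(1/5)) (-(1/10)) (by norm_num)
    have : 2 / (u : ℝ) = 2 * (1 / u) := by ring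
    linarith
  by_cases hc : t ≤ X ^ (-(1 / 4) : ℝ)
  · refine ⟨N, by omega, le_rfl, ?_⟩
    have a1 : 2 / (N : ℝ) ≤ 2 / u := by gcongr
    have a2 : Real.sqrt (t * N * N / X) ≤ X ^ (-(1 / 10) : ℝ) := by
      refine le_trans (Real.sqrt_le_sqrt (y := X ^ (-(1 / 4) : ℝ)) ?_) ?_
      · rw [div_le_iff₀ hX0]
        calc t * N * N = t * N ^ 2 := by ring
          _ ≤ X ^ (-(1 / 4) : ℝ) * X := by gcongr
      · rw [sqrt_rpow hX0]; exact hp _ _ (by norm_num)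
    have a3 : Real.sqrt (N / (X * N * t)) = (t * X) ^ (-(1 / 2) : ℝ) := by
      rw [Real.rpow_neg (by positivity), ← Real.sqrt_eq_rpow, ← Real.sqrt_inv]
      congr 1; field_simp
    rw [a3]
    have : 0 < X ^ (-(1 / 10) : ℝ) := by positivity
    linarith
  · push Not at hc
    refine ⟨u, hup, huN, ?_⟩
    have a2 : Real.sqrt (t * u * N / X) ≤ 2 * X ^ (-(1 / 10) : ℝ) := by
      refine le_trans (Real.sqrt_le_sqrt (y := 2 ^ 2 * X ^ (-(1 / 5) : ℝ)) ?_) ?_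
      · rw [div_le_iff₀ hX0]
        calc t * u * N ≤ X ^ (2 / 25 : ℝ) * (2 * X ^ (1 / 5 : ℝ)) * X ^ (1 / 2 : ℝ) := by gcongr
          _ = 2 * (X ^ (2 / 25 : ℝ) * X ^ (1 / 5 : ℝ) * X ^ (1 / 2 : ℝ)) := by ring
          _ = 2 * X ^ (39 / 50 : ℝ) := by rw [← Real.rpow_add hX0, ← Real.rpow_add hX0]; norm_num
          _ ≤ 4 * X ^ (4 / 5 : ℝ) := by
            have := hp (39 / 50) (4 / 5) (by norm_num)
            have : 0 < X ^ (4 / 5 : ℝ) := by positivity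
            linarith
          _ = 2 ^ 2 * (X ^ (-(1 / 5) : ℝ) * X ^ (1 : ℝ)) := by rw [← Real.rpow_add hX0]; norm_num
          _ = _ := by rw [Real.rpow_one]; ring
      · rw [Real.sqrt_mul (by norm_num), Real.sqrt_sq (by norm_num), sqrt_rpow hX0]
        have := hp (-(1 / 5) / 2) (-(1 / 10)) (by norm_num)
        linarith
    have a3 : Real.sqrt (N / (X * u * t)) ≤ X ^ (-(1 / 10) : ℝ) := by
      refine le_trans (Real.sqrt_le_sqrt (y := X ^ (-(9 / 20) : ℝ)) ?_) ?_
      · rw [div_le_iff₀ (by positivity)]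
        calc (N : ℝ) ≤ X ^ (1 / 2 : ℝ) := hNs
          _ = X ^ (-(9 / 20) : ℝ) * (X ^ (1 : ℝ) * X ^ (1 / 5 : ℝ) * X ^ (-(1 / 4) : ℝ)) := by
            rw [← Real.rpow_add hX0, ← Real.rpow_add hX0, ← Real.rpow_add hX0]; norm_num
          _ ≤ X ^ (-(9 / 20) : ℝ) * (X * u * t) := by rw [Real.rpow_one]; gcongr
      · rw [sqrt_rpow hX0]; exact hp _ _ (by norm_num)
    have : 0 < X ^ (-(1 / 10) : ℝ) := by positivity
    linarith

lemma block_bound {X t : ℝ} {u N : ℕ} (hX : 4 ≤ X) (hL : 1 ≤ Real.log X) (hu1 : X ^ (1 / 5 : ℝ) ≤ u) (hu2 : (u : ℝ) ≤ 2 * X ^ (1 / 5 : ℝ))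
    (ht1 : 0 < t) (ht2 : t ≤ X ^ (2 / 25 : ℝ)) (huN : u ≤ N) (hN : (N : ℝ) ^ 2 ≤ X)
    (f g : ℕ → ℝ) (hf : ∀ n : ℕ, 0 < n → (n : ℝ) ≤ X → |f n| ≤ Real.log X * dd n)
    (hg : ∀ n : ℕ, 0 < n → (n : ℝ) ≤ X → |g n| ≤ Real.log X * dd n) :
    ‖∑ n ∈ Finset.Ioc N (2 * N), ∑ m ∈ JJ X n, (f n : ℂ) * (g m * EE t (n * m))‖ ≤
      600 * Real.log X ^ 5 * X * (X ^ (-(1 / 20) : ℝ) + (t * X) ^ (-(1 / 4) : ℝ)) := by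
  have hX0 : 0 < X := by linarith
  obtain ⟨H, hH, hHN, hb⟩ := choose_H (by linarith) hu1 hu2 ht1 ht2 huN hN
  have hH' : (0 : ℝ) < H := by exact_mod_cast hH
  have hNp : (0 : ℝ) < N := by exact_mod_cast (by omega : 0 < N)
  have hN1 : (1 : ℝ) ≤ N := by exact_mod_cast (by omega : 1 ≤ N)
  have h2N : 2 * (N : ℝ) ≤ X := by nlinarith [sq_nonneg ((N : ℝ) - 2)]
  set L := Real.log X with hLdef
  have gen : ∀ (h : ℕ → ℝ) (K : ℕ), (K : ℝ) ≤ X → (∀ n : ℕ, 0 < n → (n : ℝ) ≤ X → |h n| ≤ L * dd n) →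
      ∑ n ∈ Finset.Ioc 0 K, h n ^ 2 ≤ 8 * L ^ 5 * K := by
    intro h K hK hh
    rcases Nat.eq_zero_or_pos K with rfl | hKp
    · simp
    have hKp' : (0 : ℝ) < K := by exact_mod_cast hKp
    have : ∀ n ∈ Finset.Ioc 0 K, h n ^ 2 ≤ L ^ 2 * dd n ^ 2 := by
      intro n hn
      rw [Finset.mem_Ioc] at hn
      have hnX : (n : ℝ) ≤ X := le_trans (by exact_mod_cast hn.2) hK
      have := hh n hn.1 hnX
      rw [← mul_pow, ← sq_abs]
      gcongr
    refine (Finset.sum_le_sum this).trans ?_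
    rw [← Finset.mul_sum]
    have h5 := sum_dd_sq_le K
    have h6 : Real.log K ≤ L := Real.log_le_log hKp' hK
    have h7 : 0 ≤ Real.log K := Real.log_natCast_nonneg K
    calc _ ≤ L ^ 2 * (K * (1 + Real.log K) ^ 3) := by gcongr
      _ ≤ L ^ 2 * (K * (2 * L) ^ 3) := by gcongr; linarith
      _ = _ := by ring
  have hKa : ∑ m ∈ Finset.Ioc 0 ⌊X / N⌋₊, g m ^ 2 ≤ 8 * L ^ 5 * (X / N) := by
    have hfl := Nat.floor_le (by positivity : 0 ≤ X / N)
    have : X / N ≤ X := div_le_self hX0.le hN1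
    refine (gen g _ (by linarith) hg).trans ?_
    gcongr
  have hKb : ∑ n ∈ Finset.Ioc N (2 * N), f n ^ 2 ≤ 16 * L ^ 5 * N := by
    have h1 := gen f (2 * N) (by push_cast; exact h2N) hf
    have h2 : ∑ n ∈ Finset.Ioc N (2 * N), f n ^ 2 ≤ ∑ n ∈ Finset.Ioc 0 (2 * N), f n ^ 2 := by
      apply Finset.sum_le_sum_of_subset_of_nonneg
      · exact Finset.Ioc_subset_Ioc_left (by omega)
      · intros; positivity
    push_cast at h1
    linarith
  have ht := type2 hH hHN h2N ht1 g f _ _ hKa hKb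
  have e1 : Real.sqrt (t * H * (X / N)) = X / N * Real.sqrt (t * H * N / X) := by
    rw [← Real.sqrt_sq (by positivity : 0 ≤ X / N), ← Real.sqrt_mul (by positivity), Real.sqrt_sq (by positivity)]
    congr 1; field_simp
  have e2 : Real.sqrt (X / N * H / t) = X * H / N * Real.sqrt (N / (X * H * t)) := by
    have : Real.sqrt ((X * H / N) ^ 2) = X * H / N := Real.sqrt_sq (by positivity)
    rw [← this, ← Real.sqrt_mul (by positivity)]
    congr 1; field_simp
  have e3 : (5 * N / H * (8 * L ^ 5 * (X / N))) * (16 * L ^ 5 * N * (2 * (X / N) + 120 * H * Real.sqrt (t * H * (X / N)) + 240 * Real.sqrt (X / N * H / t)))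
      = 640 * L ^ 10 * X ^ 2 * (2 / (H : ℝ) + 120 * Real.sqrt (t * H * N / X) + 240 * Real.sqrt (N / (X * H * t))) := by
    rw [e1, e2]; field_simp; ring
  rw [e3] at ht
  have h8 : 640 * L ^ 10 * X ^ 2 * (2 / (H : ℝ) + 120 * Real.sqrt (t * H * N / X) + 240 * Real.sqrt (N / (X * H * t))) ≤
      640 * L ^ 10 * X ^ 2 * (500 * (X ^ (-(1 / 10) : ℝ) + (t * X) ^ (-(1 / 2) : ℝ))) :=
    mul_le_mul_of_nonneg_left hb (by positivity)
  apply le_of_sq_le_sq _ (by positivity)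
  refine (ht.trans h8).trans ?_
  have p1 : X ^ (-(1 / 10) : ℝ) = (X ^ (-(1 / 20) : ℝ)) ^ 2 := by
    rw [← Real.rpow_natCast, ← Real.rpow_mul hX0.le]; norm_num
  have p2 : (t * X) ^ (-(1 / 2) : ℝ) = ((t * X) ^ (-(1 / 4) : ℝ)) ^ 2 := by
    rw [← Real.rpow_natCast, ← Real.rpow_mul (by positivity)]; norm_num
  rw [p1, p2]
  have q1 : 0 < X ^ (-(1 / 20) : ℝ) := by positivity
  have q2 : 0 < (t * X) ^ (-(1 / 4) : ℝ) := by positivity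
  generalize X ^ (-(1 / 20) : ℝ) = y at *
  generalize (t * X) ^ (-(1 / 4) : ℝ) = z at *
  have : 0 ≤ L ^ 10 * X ^ 2 := by positivity
  have hh : 640 * (500 * (y ^ 2 + z ^ 2)) ≤ 360000 * (y + z) ^ 2 := by nlinarith [mul_pos q1 q2]
  nlinarith

lemma bilin {X t : ℝ} {u : ℕ} (hX : 4 ≤ X) (hL : 1 ≤ Real.log X) (hu1 : X ^ (1 / 5 : ℝ) ≤ u) (hu2 : (u : ℝ) ≤ 2 * X ^ (1 / 5 : ℝ))
    (ht1 : 0 < t) (ht2 : t ≤ X ^ (2 / 25 : ℝ))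
    (f g : ℕ → ℝ) (hf : ∀ n : ℕ, 0 < n → (n : ℝ) ≤ X → |f n| ≤ Real.log X * dd n)
    (hg : ∀ n : ℕ, 0 < n → (n : ℝ) ≤ X → |g n| ≤ Real.log X * dd n)
    (hs : ∀ n : ℕ, f n ≠ 0 → u < n ∧ (n : ℝ) ^ 2 ≤ X) :
    ‖∑ n ∈ Finset.Ioc 0 ⌊X⌋₊, ∑ m ∈ JJ X n, (f n : ℂ) * (g m * EE t (n * m))‖ ≤
      1800 * Real.log X ^ 6 * X * (X ^ (-(1 / 20) : ℝ) + (t * X) ^ (-(1 / 4) : ℝ)) := by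
  have hX0 : 0 < X := by linarith
  set F : ℕ → ℂ := fun n => ∑ m ∈ JJ X n, (f n : ℂ) * (g m * EE t (n * m)) with hF
  have hF0 : ∀ n, f n = 0 → F n = 0 := by
    intro n hn; simp [hF, hn]
  have hup : 0 < u := by
    have : 0 < (u : ℝ) := lt_of_lt_of_le (by positivity) hu1
    exact_mod_cast this
  set J := Nat.log 2 ⌊X⌋₊ + 1 with hJ
  have tel : ∀ j : ℕ, ∑ n ∈ Finset.Ioc u (2 ^ j * u), F n = ∑ i ∈ Finset.range j, ∑ n ∈ Finset.Ioc (2 ^ i * u) (2 * (2 ^ i * u)), F n := by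
    intro j
    induction j with
    | zero => simp
    | succ j ih =>
      rw [Finset.sum_range_succ, ← ih, show 2 * (2 ^ j * u) = 2 ^ (j + 1) * u by ring]
      rw [← Finset.sum_union]
      · congr 1
        rw [Finset.Ioc_union_Ioc_eq_Ioc]
        · nlinarith [Nat.one_le_two_pow (n := j)]
        · rw [pow_succ]; nlinarith [Nat.one_le_two_pow (n := j)]
      · rw [Finset.disjoint_left]
        intro a ha hb
        rw [Finset.mem_Ioc] at ha hb
        omega
  have hbig : ⌊X⌋₊ ≤ 2 ^ J * u := by
    have := Nat.lt_pow_succ_log_self (b := 2) (by norm_num) ⌊X⌋₊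
    rw [hJ]; exact this.le.trans (Nat.le_mul_of_pos_right _ hup)
  have e : ∑ n ∈ Finset.Ioc 0 ⌊X⌋₊, F n = ∑ n ∈ Finset.Ioc u (2 ^ J * u), F n := by
    have s1 : ∑ n ∈ Finset.Ioc 0 ⌊X⌋₊, F n = ∑ n ∈ Finset.Ioc 0 (2 ^ J * u), F n := by
      apply Finset.sum_subset (Finset.Ioc_subset_Ioc_right hbig)
      intro n hn hn'
      apply hF0
      by_contra h
      have := (hs n h).2
      rw [Finset.mem_Ioc] at hn hn'
      apply hn'
      refine ⟨hn.1, Nat.le_floor ?_⟩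
      have : (1 : ℝ) ≤ n := by exact_mod_cast hn.1
      nlinarith
    rw [s1]; symm
    apply Finset.sum_subset (Finset.Ioc_subset_Ioc_left (by omega))
    intro n hn hn'
    apply hF0
    by_contra h
    have := (hs n h).1
    rw [Finset.mem_Ioc] at hn hn'
    omega
  rw [e, tel]
  set B := 600 * Real.log X ^ 5 * X * (X ^ (-(1 / 20) : ℝ) + (t * X) ^ (-(1 / 4) : ℝ)) with hB
  have hB0 : 0 ≤ B := by positivity
  have hblock : ∀ i ∈ Finset.range J, ‖∑ n ∈ Finset.Ioc (2 ^ i * u) (2 * (2 ^ i * u)), F n‖ ≤ B := by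
    intro i _
    by_cases hc : ((2 ^ i * u : ℕ) : ℝ) ^ 2 ≤ X
    · exact block_bound hX hL hu1 hu2 ht1 ht2 (by nlinarith [Nat.one_le_two_pow (n := i)]) hc f g hf hg
    · rw [Finset.sum_eq_zero]
      · simpa using hB0
      · intro n hn
        apply hF0
        by_contra h
        have h2 := (hs n h).2
        rw [Finset.mem_Ioc] at hn
        apply hc
        refine le_trans ?_ h2
        have : ((2 ^ i * u : ℕ) : ℝ) ≤ n := by exact_mod_cast hn.1.le
        gcongr
  refine (norm_sum_le_of_le _ hblock).trans ?_
  rw [Finset.sum_const, Finset.card_range, nsmul_eq_mul]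
  have hJL : (J : ℝ) ≤ 3 * Real.log X := by
    have h1 := Nat.pow_log_le_self 2 (x := ⌊X⌋₊) (Nat.floor_pos.mpr (by linarith)).ne'
    have h2 : ((2 ^ Nat.log 2 ⌊X⌋₊ : ℕ) : ℝ) ≤ X := (by exact_mod_cast h1 : ((2 ^ Nat.log 2 ⌊X⌋₊ : ℕ) : ℝ) ≤ (⌊X⌋₊ : ℝ)).trans (Nat.floor_le hX0.le)
    have h3 := Real.log_le_log (by positivity) h2
    push_cast at h3
    rw [Real.log_pow] at h3
    have h4 := Real.log_two_gt_d9
    rw [hJ]; push_cast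
    have : (0 : ℝ) ≤ (Nat.log 2 ⌊X⌋₊ : ℝ) := by positivity
    nlinarith
  calc (J : ℝ) * B ≤ 3 * Real.log X * B := by gcongr
    _ = _ := by rw [hB]; ring

end TLI


namespace TLI

open ArithmeticFunction (vonMangoldt)

/-- restriction of an arithmetic function by a predicate on size -/
noncomputable def low (X : ℝ) (f : ArithmeticFunction ℝ) : ArithmeticFunction ℝ :=
  ⟨fun n => if (n : ℝ) ^ 2 ≤ X then f n else 0, by simp⟩

lemma low_apply (X : ℝ) (f : ArithmeticFunction ℝ) (n : ℕ) : low X f n = if (n : ℝ) ^ 2 ≤ X then f n else 0 := rfl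

lemma type2_total {X t : ℝ} {u : ℕ} (hX : 4 ≤ X) (hL : 1 ≤ Real.log X) (hu1 : X ^ (1 / 5 : ℝ) ≤ u) (hu2 : (u : ℝ) ≤ 2 * X ^ (1 / 5 : ℝ))
    (ht1 : 0 < t) (ht2 : t ≤ X ^ (2 / 25 : ℝ))
    (a b : ArithmeticFunction ℝ) (ha : ∀ n : ℕ, 0 < n → (n : ℝ) ≤ X → |a n| ≤ Real.log X * dd n)
    (hb : ∀ n : ℕ, 0 < n → (n : ℝ) ≤ X → |b n| ≤ Real.log X * dd n)
    (hsa : ∀ n : ℕ, a n ≠ 0 → u < n) (hsb : ∀ n : ℕ, b n ≠ 0 → u < n) :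
    ‖∑ n ∈ JJ X 1, (((a * b) n : ℝ) : ℂ) * EE t n‖ ≤
      3600 * Real.log X ^ 6 * X * (X ^ (-(1 / 20) : ℝ) + (t * X) ^ (-(1 / 4) : ℝ)) := by
  have hX0 : 0 < X := by linarith
  have e : a * b = low X a * b + b * (a - low X a) := by ring
  have e2 : ∑ n ∈ JJ X 1, (((a * b) n : ℝ) : ℂ) * EE t n =
      ∑ n ∈ JJ X 1, (((low X a * b) n : ℝ) : ℂ) * EE t n + ∑ n ∈ JJ X 1, (((b * (a - low X a)) n : ℝ) : ℂ) * EE t n := by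
    rw [← Finset.sum_add_distrib]
    apply Finset.sum_congr rfl
    intro n _
    conv_lhs => rw [e]
    rw [ArithmeticFunction.add_apply]; push_cast; ring
  rw [e2, conv_sum hX0.le, conv_sum hX0.le]
  have lowb : ∀ (c : ArithmeticFunction ℝ), (∀ n : ℕ, 0 < n → (n : ℝ) ≤ X → |c n| ≤ Real.log X * dd n) →
      (∀ n : ℕ, 0 < n → (n : ℝ) ≤ X → |low X c n| ≤ Real.log X * dd n) := by
    intro c hc n hn hnX
    rw [low_apply]
    split_ifs
    · exact hc n hn hnX
    · rw [abs_zero]; exact mul_nonneg (by linarith) (dd_nonneg n)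
  have lows : ∀ (c : ArithmeticFunction ℝ), (∀ n : ℕ, c n ≠ 0 → u < n) →
      (∀ n : ℕ, low X c n ≠ 0 → u < n ∧ (n : ℝ) ^ 2 ≤ X) := by
    intro c hc n hn
    rw [low_apply] at hn
    split_ifs at hn with h
    · exact ⟨hc n hn, h⟩
    · exact absurd rfl hn
  have b1 := bilin hX hL hu1 hu2 ht1 ht2 (low X a) b (lowb a ha) hb (lows a hsa)
  have ha2 : ∀ n : ℕ, 0 < n → (n : ℝ) ≤ X → |(a - low X a) n| ≤ Real.log X * dd n := by
    intro n hn hnX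
    have : (a - low X a) n = a n - low X a n := rfl
    rw [this, low_apply]
    split_ifs
    · rw [sub_self, abs_zero]; exact mul_nonneg (by linarith) (dd_nonneg n)
    · rw [sub_zero]; exact ha n hn hnX
  have b2 := bilin hX hL hu1 hu2 ht1 ht2 (low X b) (fun n => (a - low X a) n) (lowb b hb) ha2 (lows b hsb)
  have e3 : ∑ d ∈ Finset.Ioc 0 ⌊X⌋₊, ∑ k ∈ JJ X d, (b d : ℂ) * (((a - low X a) k : ℂ) * EE t (d * k)) =
      ∑ d ∈ Finset.Ioc 0 ⌊X⌋₊, ∑ k ∈ JJ X d, (low X b d : ℂ) * (((a - low X a) k : ℂ) * EE t (d * k)) := by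
    apply Finset.sum_congr rfl; intro d hd
    apply Finset.sum_congr rfl; intro k hk
    have hd' := (Finset.mem_Ioc.mp hd).1
    rw [mem_JJ hX0.le hd'] at hk
    have : (a - low X a) k = a k - low X a k := rfl
    rw [this, low_apply, low_apply]
    by_cases h1 : (d : ℝ) ^ 2 ≤ X
    · rw [if_pos h1]
    by_cases h2 : (k : ℝ) ^ 2 ≤ X
    · rw [if_pos h2]; simp
    · exfalso
      push Not at h1 h2
      have d0 : (0 : ℝ) < d := by exact_mod_cast hd'
      have k0 : (0 : ℝ) ≤ k := by positivity
      have : X * X < (d : ℝ) ^ 2 * k ^ 2 := by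
        apply mul_lt_mul'' <;> linarith
      have : (d : ℝ) ^ 2 * k ^ 2 ≤ X ^ 2 := by
        rw [← mul_pow]; exact pow_le_pow_left₀ (by positivity) hk.2 2
      nlinarith
  rw [e3]
  refine (norm_add_le _ _).trans ?_
  linarith

lemma lambda_sum {X t : ℝ} (hX : 32 ≤ X) (ht1 : 1 / X ≤ t) (ht2 : t ≤ X ^ (2 / 25 : ℝ)) :
    ‖∑ n ∈ JJ X 1, (vonMangoldt n : ℂ) * EE t n‖ ≤
      5000 * Real.log X ^ 6 * X * (X ^ (-(1 / 20) : ℝ) + (t * X) ^ (-(1 / 4) : ℝ)) := by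
  have hX0 : 0 < X := by linarith
  have hX1 : 1 ≤ X := by linarith
  have ht0 : 0 < t := lt_of_lt_of_le (by positivity) ht1
  have htX : 1 ≤ t * X := by rwa [div_le_iff₀ hX0] at ht1
  have hL : 1 ≤ Real.log X := by
    rw [Real.le_log_iff_exp_le hX0]
    have := Real.exp_one_lt_d9
    linarith
  set L := Real.log X with hLdef
  have hp : ∀ a b : ℝ, a ≤ b → X ^ a ≤ X ^ b := fun a b h => Real.rpow_le_rpow_of_exponent_le hX1 h
  set u := ⌈X ^ (1 / 5 : ℝ)⌉₊ with hu
  have hu1 : X ^ (1 / 5 : ℝ) ≤ u := Nat.le_ceil _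
  have h15 : 1 ≤ X ^ (1 / 5 : ℝ) := Real.one_le_rpow hX1 (by norm_num)
  have hu2 : (u : ℝ) ≤ 2 * X ^ (1 / 5 : ℝ) := by
    have := Nat.ceil_lt_add_one (by positivity : 0 ≤ X ^ (1 / 5 : ℝ))
    linarith
  have huX : (u : ℝ) < X / 2 := by
    have h1 : X = X ^ (1 / 5 : ℝ) * X ^ (4 / 5 : ℝ) := by rw [← Real.rpow_add hX0]; norm_num
    have h2 : (16 : ℝ) ≤ X ^ (4 / 5 : ℝ) := by
      calc (16 : ℝ) = (32 : ℝ) ^ (4 / 5 : ℝ) := by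
            rw [show (32 : ℝ) = 2 ^ (5 : ℝ) by norm_num, ← Real.rpow_mul (by norm_num)]; norm_num
        _ ≤ _ := Real.rpow_le_rpow (by norm_num) hX (by norm_num)
    nlinarith
  have hdiv : ∀ (c : ArithmeticFunction ℝ) (n : ℕ), (c - cut u c) n = if n ≤ u then 0 else c n := by
    intro c n
    have : (c - cut u c) n = c n - cut u c n := rfl
    rw [this, cut_apply]; split_ifs <;> simp
  have hlam : ∀ n : ℕ, 0 < n → (n : ℝ) ≤ X → |vonMangoldt n| ≤ L := by
    intro n hn hnX
    rw [abs_of_nonneg ArithmeticFunction.vonMangoldt_nonneg]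
    exact ArithmeticFunction.vonMangoldt_le_log.trans (Real.log_le_log (by exact_mod_cast hn) hnX)
  have hII := type2_total (by linarith) hL hu1 hu2 ht0 ht2 (vonMangoldt - cut u vonMangoldt) ((mu - cut u mu) * ze) ?_ ?_ ?_ ?_
  rotate_left
  · intro n hn hnX
    rw [hdiv]
    have := one_le_dd hn
    split_ifs
    · rw [abs_zero]; exact mul_nonneg (by linarith) (dd_nonneg n)
    · refine (hlam n hn hnX).trans ?_
      nlinarith
  · intro n hn hnX
    have : |((mu - cut u mu) * ze) n| ≤ dd n := by
      unfold ze
      rw [ArithmeticFunction.coe_mul_zeta_apply, dd_apply]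
      refine (Finset.abs_sum_le_sum_abs _ _).trans ?_
      refine (Finset.sum_le_sum (g := fun _ => (1 : ℝ)) ?_).trans (by simp)
      intro i _
      rw [hdiv]; split_ifs
      · simp
      · exact abs_mu_le i
    have h0 := dd_nonneg n
    nlinarith
  · intro n hn
    rw [hdiv] at hn
    by_contra h
    exact hn (if_pos (by omega))
  · intro n hn
    by_contra h
    apply hn
    unfold ze
    rw [ArithmeticFunction.coe_mul_zeta_apply]
    apply Finset.sum_eq_zero
    intro i hi
    rw [hdiv, if_pos]
    exact (Nat.divisor_le hi).trans (by omega)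
  have hI1 := type1 hX1 ht0 (cut u mu) ArithmeticFunction.log 1 (240 * L) u (by norm_num) (by positivity) (by positivity) ?_ ?_ ?_
  rotate_left
  · intro d _ _
    rw [cut_apply]; split_ifs
    · exact abs_mu_le d
    · simp
  · intro d hd
    rw [cut_apply, if_neg]
    have : u < d := by exact_mod_cast hd
    omega
  · intro d hd hdX
    have h1 := inner_log hd hdX ht0
    have h2 : Real.log (2 * X) ≤ 2 * L := by
      rw [show 2 * L = Real.log (X ^ 2) by rw [Real.log_pow]; push_cast; rw [hLdef]]
      apply Real.log_le_log (by positivity); nlinarith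
    refine h1.trans ?_
    apply mul_le_mul_of_nonneg_right _ (by positivity)
    linarith
  have hI2 := type1 hX1 ht0 (cut u mu * cut u vonMangoldt) ze L 60 (u ^ 2) (by linarith) (by norm_num) (by positivity) ?_ ?_ ?_
  rotate_left
  · intro d hd hdX
    rw [ArithmeticFunction.mul_apply]
    refine (Finset.abs_sum_le_sum_abs _ _).trans ?_
    have : ∀ x ∈ d.divisorsAntidiagonal, |cut u mu x.1 * cut u vonMangoldt x.2| ≤ vonMangoldt x.2 := by
      intro x _
      rw [abs_mul]
      have h1 : |cut u mu x.1| ≤ 1 := by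
        rw [cut_apply]; split_ifs
        · exact abs_mu_le _
        · simp
      have h0 : 0 ≤ vonMangoldt x.2 := ArithmeticFunction.vonMangoldt_nonneg
      have h2 : |cut u vonMangoldt x.2| ≤ vonMangoldt x.2 := by
        rw [cut_apply]; split_ifs
        · rw [abs_of_nonneg h0]
        · simpa using h0
      calc _ ≤ 1 * vonMangoldt x.2 := mul_le_mul h1 h2 (abs_nonneg _) (by norm_num)
        _ = _ := one_mul _
    refine (Finset.sum_le_sum this).trans ?_
    rw [Nat.sum_divisorsAntidiagonal' (f := fun _ b => vonMangoldt b), ArithmeticFunction.vonMangoldt_sum]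
    exact Real.log_le_log (by exact_mod_cast hd) hdX
  · intro d hd
    rw [ArithmeticFunction.mul_apply]
    apply Finset.sum_eq_zero
    intro x hx
    have hx' := (Nat.mem_divisorsAntidiagonal.mp hx).1
    rw [cut_apply, cut_apply]
    split_ifs with h1 h2
    · exfalso
      have : d ≤ u ^ 2 := by rw [← hx', sq]; exact Nat.mul_le_mul h1 h2
      have : (d : ℝ) ≤ u ^ 2 := by exact_mod_cast this
      linarith
    all_goals simp
  · intro d hd hdX
    refine le_trans (le_of_eq ?_) (inner_one hd hdX ht0)
    congr 1
    apply Finset.sum_congr rfl; intro k hk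
    have : 0 < k := by
      unfold JJ at hk; rw [Finset.mem_Ico] at hk; omega
    rw [ze_apply this]; simp
  have h0 : ∑ n ∈ JJ X 1, (cut u vonMangoldt n : ℂ) * EE t n = 0 := by
    apply Finset.sum_eq_zero
    intro n hn
    rw [mem_JJ hX0.le one_pos] at hn
    have h1 := hn.1
    rw [cut_apply, if_neg]
    · simp
    · intro h
      have : (n : ℝ) ≤ u := by exact_mod_cast h
      simp at h1
      linarith
  have dec : ∑ n ∈ JJ X 1, (vonMangoldt n : ℂ) * EE t n =
      ∑ n ∈ JJ X 1, (cut u vonMangoldt n : ℂ) * EE t n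
      + ∑ n ∈ JJ X 1, (((cut u mu * ArithmeticFunction.log) n : ℝ) : ℂ) * EE t n
      - ∑ n ∈ JJ X 1, ((((cut u mu * cut u vonMangoldt) * ze) n : ℝ) : ℂ) * EE t n
      + ∑ n ∈ JJ X 1, ((((vonMangoldt - cut u vonMangoldt) * ((mu - cut u mu) * ze)) n : ℝ) : ℂ) * EE t n := by
    rw [← Finset.sum_add_distrib, ← Finset.sum_sub_distrib, ← Finset.sum_add_distrib]
    apply Finset.sum_congr rfl; intro n _
    conv_lhs => rw [vaughan u]
    have : ∀ (a b c d : ArithmeticFunction ℝ), (a + b - c + d) n = a n + b n - c n + d n := by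
      intros; rfl
    rw [this]; push_cast; ring
  rw [dec, h0, zero_add]
  set y := X ^ (-(1 / 20) : ℝ) with hy
  set z := (t * X) ^ (-(1 / 4) : ℝ) with hz
  have hy0 : 0 < y := by positivity
  have hz0 : 0 < z := by positivity
  have s1 : Real.sqrt (t * X) ≤ X ^ (27 / 50 : ℝ) := by
    refine le_trans (Real.sqrt_le_sqrt (y := X ^ (27 / 25 : ℝ)) ?_) ?_
    · calc t * X ≤ X ^ (2 / 25 : ℝ) * X ^ (1 : ℝ) := by rw [Real.rpow_one]; gcongr
        _ = _ := by rw [← Real.rpow_add hX0]; norm_num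
    · rw [sqrt_rpow hX0]; norm_num
  have xy : X * y = X ^ (19 / 20 : ℝ) := by
    rw [hy, ← Real.rpow_one_add' hX0.le (by norm_num)]; norm_num
  have s2 : (u : ℝ) * Real.sqrt (t * X) ≤ 2 * (X * y) := by
    calc (u : ℝ) * Real.sqrt (t * X) ≤ 2 * X ^ (1 / 5 : ℝ) * X ^ (27 / 50 : ℝ) := by gcongr
      _ = 2 * X ^ (37 / 50 : ℝ) := by rw [mul_assoc, ← Real.rpow_add hX0]; norm_num
      _ ≤ _ := by rw [xy]; have := hp (37 / 50) (19 / 20) (by norm_num); linarith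
  have s3 : (u : ℝ) ^ 2 * Real.sqrt (t * X) ≤ 4 * (X * y) := by
    calc (u : ℝ) ^ 2 * Real.sqrt (t * X) ≤ (2 * X ^ (1 / 5 : ℝ)) ^ 2 * X ^ (27 / 50 : ℝ) := by gcongr
      _ = 4 * (X ^ (1 / 5 : ℝ) * X ^ (1 / 5 : ℝ) * X ^ (27 / 50 : ℝ)) := by ring
      _ = 4 * X ^ (47 / 50 : ℝ) := by rw [← Real.rpow_add hX0, ← Real.rpow_add hX0]; norm_num
      _ ≤ _ := by rw [xy]; have := hp (47 / 50) (19 / 20) (by norm_num); linarith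
  have s4 : Real.sqrt (X / t) ≤ X * z := by
    have e1 : Real.sqrt (X / t) = X * (t * X) ^ (-(1 / 2) : ℝ) := by
      rw [Real.rpow_neg (by positivity), ← Real.sqrt_eq_rpow, ← Real.sqrt_inv]
      have : X = Real.sqrt (X ^ 2) := (Real.sqrt_sq hX0.le).symm
      conv_rhs => rw [this, ← Real.sqrt_mul (by positivity), Real.sqrt_sq hX0.le]
      congr 1; field_simp
    rw [e1]
    apply mul_le_mul_of_nonneg_left _ hX0.le
    exact Real.rpow_le_rpow_of_exponent_le htX (by norm_num)
  have f1 : (1 : ℝ) * (240 * L) * (u * Real.sqrt (t * X) + Real.sqrt (X / t) * (1 + L)) ≤ 480 * L ^ 2 * (X * y + X * z) := by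
    calc (1 : ℝ) * (240 * L) * (u * Real.sqrt (t * X) + Real.sqrt (X / t) * (1 + L)) ≤
        1 * (240 * L) * (2 * (X * y) * L + X * z * (2 * L)) := by
          refine mul_le_mul_of_nonneg_left (add_le_add ?_ ?_) (by positivity)
          · nlinarith [mul_pos hX0 hy0]
          · gcongr; linarith
      _ = _ := by ring
  have f2 : L * 60 * ((u : ℝ) ^ 2 * Real.sqrt (t * X) + Real.sqrt (X / t) * (1 + L)) ≤ 240 * L ^ 2 * (X * y + X * z) := by
    have hxy := mul_pos hX0 hy0
    have hxz := mul_pos hX0 hz0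
    calc L * 60 * ((u : ℝ) ^ 2 * Real.sqrt (t * X) + Real.sqrt (X / t) * (1 + L)) ≤
        L * 60 * (4 * (X * y) * L + X * z * (4 * L)) := by
          refine mul_le_mul_of_nonneg_left (add_le_add ?_ ?_) (by positivity)
          · nlinarith
          · refine mul_le_mul s4 (by linarith) (by linarith) hxz.le
      _ = _ := by ring
  have f3 : L ^ 2 * (X * y + X * z) ≤ L ^ 6 * (X * y + X * z) := by
    apply mul_le_mul_of_nonneg_right _ (by positivity)
    exact pow_le_pow_right₀ hL (by norm_num)
  have g1 := norm_add_le (∑ n ∈ JJ X 1, (((cut u mu * ArithmeticFunction.log) n : ℝ) : ℂ) * EE t n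
      - ∑ n ∈ JJ X 1, ((((cut u mu * cut u vonMangoldt) * ze) n : ℝ) : ℂ) * EE t n)
      (∑ n ∈ JJ X 1, ((((vonMangoldt - cut u vonMangoldt) * ((mu - cut u mu) * ze)) n : ℝ) : ℂ) * EE t n)
  have g2 := norm_sub_le (∑ n ∈ JJ X 1, (((cut u mu * ArithmeticFunction.log) n : ℝ) : ℂ) * EE t n)
      (∑ n ∈ JJ X 1, ((((cut u mu * cut u vonMangoldt) * ze) n : ℝ) : ℂ) * EE t n)
  have f4 : 0 ≤ L ^ 6 * (X * y + X * z) := by positivity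
  have f5 : 3600 * L ^ 6 * X * (y + z) = 3600 * (L ^ 6 * (X * y + X * z)) := by ring
  have f6 : 5000 * L ^ 6 * X * (y + z) = 5000 * (L ^ 6 * (X * y + X * z)) := by ring
  rw [f6]
  rw [f5] at hII
  linarith

end TLI


namespace TLI

/-- Euler-Maclaurin remainder term -/
noncomputable def hh (n : ℕ) (s : ℂ) : ℂ :=
  (n : ℂ) ^ (-s) - ((n : ℂ) ^ (1 - s) - ((n + 1 : ℕ) : ℂ) ^ (1 - s)) / (s - 1)

lemma cpow_diff_bound {n : ℕ} (hn : 0 < n) {s : ℂ} (hs : 0 < s.re) (x : ℝ) (hx : x ∈ Set.Icc (n : ℝ) (n + 1)) :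
    ‖(x : ℂ) ^ (-s) - (n : ℂ) ^ (-s)‖ ≤ ‖s‖ * (n : ℝ) ^ (-s.re - 1) := by
  have hn' : (0 : ℝ) < n := by exact_mod_cast hn
  have h := Convex.norm_image_sub_le_of_norm_hasDerivWithin_le (f := fun y : ℝ => (y : ℂ) ^ (-s))
    (f' := fun y : ℝ => (-s) * (y : ℂ) ^ (-s - 1)) (s := Set.Icc (n : ℝ) (n + 1)) (x := (n : ℝ)) (y := x)
    (C := ‖s‖ * (n : ℝ) ^ (-s.re - 1)) ?_ ?_ (convex_Icc _ _) (by simp) hx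
  · refine h.trans ?_
    have : ‖x - n‖ ≤ 1 := by
      rw [Real.norm_of_nonneg (by linarith [hx.1])]; linarith [hx.2]
    have h0 : 0 ≤ ‖s‖ * (n : ℝ) ^ (-s.re - 1) := by positivity
    nlinarith
  · intro y hy
    have hy0 : 0 < y := by linarith [hy.1]
    have hs0 : -s ≠ 0 := by
      intro h
      have := congrArg Complex.re h
      simp at this
      linarith
    exact (hasDerivAt_ofReal_cpow_const hy0.ne' hs0).hasDerivWithinAt
  · intro y hy
    have hy0 : 0 < y := by linarith [hy.1]
    rw [norm_mul, norm_neg, Complex.norm_cpow_eq_rpow_re_of_pos hy0]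
    apply mul_le_mul_of_nonneg_left _ (norm_nonneg _)
    have : (-s - 1).re = -s.re - 1 := by simp
    rw [this]
    exact Real.rpow_le_rpow_of_nonpos hn' hy.1 (by linarith)

lemma hh_bound {n : ℕ} (hn : 0 < n) {s : ℂ} (hs : 0 < s.re) (hs1 : s ≠ 1) :
    ‖hh n s‖ ≤ ‖s‖ * (n : ℝ) ^ (-s.re - 1) := by
  have hn' : (0 : ℝ) < n := by exact_mod_cast hn
  have h1s : 1 - s ≠ 0 := by
    intro h; apply hs1; linear_combination -h
  have h1s' : s - 1 ≠ 0 := by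
    intro h; apply hs1; linear_combination h
  have h := Convex.norm_image_sub_le_of_norm_hasDerivWithin_le
    (f := fun y : ℝ => (y : ℂ) ^ (1 - s) / (1 - s) - (y : ℂ) * (n : ℂ) ^ (-s))
    (f' := fun y : ℝ => (y : ℂ) ^ (-s) - (n : ℂ) ^ (-s)) (s := Set.Icc (n : ℝ) (n + 1))
    (x := (n : ℝ)) (y := (n : ℝ) + 1)
    (C := ‖s‖ * (n : ℝ) ^ (-s.re - 1)) ?_ ?_ (convex_Icc _ _) (by simp) (by simp)
  · have e : hh n s = -((((n : ℝ) + 1 : ℝ) : ℂ) ^ (1 - s) / (1 - s) - (((n : ℝ) + 1 : ℝ) : ℂ) * (n : ℂ) ^ (-s)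
        - (((n : ℝ) : ℂ) ^ (1 - s) / (1 - s) - ((n : ℝ) : ℂ) * (n : ℂ) ^ (-s))) := by
      unfold hh
      push_cast
      rw [show (1 - s) = -(s - 1) by ring, div_neg, div_neg]
      ring
    rw [e, norm_neg]
    refine h.trans ?_
    simp
  · intro y hy
    have hy0 : 0 < y := by linarith [hy.1]
    have h1 := (hasDerivAt_ofReal_cpow_const hy0.ne' h1s).div_const (1 - s)
    have h2 : HasDerivAt (fun y : ℝ => (y : ℂ) * (n : ℂ) ^ (-s)) (1 * (n : ℂ) ^ (-s)) y :=
      (Complex.ofRealCLM.hasDerivAt (x := y)).mul_const _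
    have h3 := (h1.sub h2).hasDerivWithinAt (s := Set.Icc (n : ℝ) (n + 1))
    refine HasDerivWithinAt.congr_deriv h3 ?_
    rw [show (1 - s - 1) = -s by ring]
    field_simp
  · intro y hy
    exact cpow_diff_bound hn hs y hy

lemma hh_diff {n : ℕ} (hn : 0 < n) {s : ℂ} (hs1 : s ≠ 1) : DifferentiableAt ℂ (hh n) s := by
  unfold hh
  have hn' : (n : ℂ) ≠ 0 := by exact_mod_cast hn.ne'
  have hn2 : ((n + 1 : ℕ) : ℂ) ≠ 0 := by exact_mod_cast (Nat.succ_ne_zero n)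
  have h1s' : s - 1 ≠ 0 := by
    intro h; apply hs1; linear_combination h
  refine DifferentiableAt.sub ?_ (DifferentiableAt.div (DifferentiableAt.sub ?_ ?_) (by fun_prop) h1s')
  · exact DifferentiableAt.const_cpow (by fun_prop) (Or.inl hn')
  · exact DifferentiableAt.const_cpow (by fun_prop) (Or.inl hn')
  · exact DifferentiableAt.const_cpow (by fun_prop) (Or.inl hn2)

/-- local continuation of zeta -/
noncomputable def ZN (N : ℕ) (s : ℂ) : ℂ :=
  ∑ n ∈ Finset.Ico 1 N, (n : ℂ) ^ (-s) + (N : ℂ) ^ (1 - s) / (s - 1) + ∑' n : ℕ, hh (n + N) s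

lemma tail_sum_eq {N : ℕ} (hN : 0 < N) {s : ℂ} (hs : 1 < s.re) (K : ℕ) :
    ∑ n ∈ Finset.range K, hh (n + N) s = ∑ n ∈ Finset.range K, ((n + N : ℕ) : ℂ) ^ (-s)
      - ((N : ℂ) ^ (1 - s) - ((K + N : ℕ) : ℂ) ^ (1 - s)) / (s - 1) := by
  induction K with
  | zero => simp
  | succ K ih =>
    rw [Finset.sum_range_succ, Finset.sum_range_succ, ih]
    unfold hh
    rw [show K + 1 + N = K + N + 1 by ring]
    ring

lemma ZN_eq {N : ℕ} (hN : 0 < N) {s : ℂ} (hs : 1 < s.re) : ZN N s = riemannZeta s := by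
  have hs1 : s ≠ 1 := by rintro rfl; simp at hs
  have hsum0 : Summable (fun n : ℕ => (n : ℂ) ^ (-s)) := by
    have := (Complex.summable_one_div_nat_cpow (p := s)).2 hs
    refine this.congr (fun n => ?_)
    rw [Complex.cpow_neg, one_div]
  have hz : riemannZeta s = ∑' n : ℕ, (n : ℂ) ^ (-s) := by
    rw [zeta_eq_tsum_one_div_nat_cpow hs]
    refine tsum_congr (fun n => ?_)
    rw [Complex.cpow_neg, one_div]
  have hsplit := hsum0.sum_add_tsum_nat_add N
  have hsum1 : Summable (fun n : ℕ => ((n + N : ℕ) : ℂ) ^ (-s)) := (summable_nat_add_iff N).2 hsum0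
  have hsN : Summable (fun n : ℕ => hh (n + N) s) := by
    have h1 : Summable (fun n : ℕ => ‖s‖ * ((n + N : ℕ) : ℝ) ^ (-s.re - 1)) :=
      ((summable_nat_add_iff N).2 (Real.summable_nat_rpow.2 (by linarith : -s.re - 1 < -1))).mul_left _
    exact Summable.of_norm_bounded h1 (fun n => hh_bound (by omega) (by linarith) hs1)
  have hlim : ∑' n : ℕ, hh (n + N) s = ∑' n : ℕ, ((n + N : ℕ) : ℂ) ^ (-s) - (N : ℂ) ^ (1 - s) / (s - 1) := by
    refine tendsto_nhds_unique hsN.hasSum.tendsto_sum_nat ?_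
    have h2 := hsum1.hasSum.tendsto_sum_nat
    have h3 : Filter.Tendsto (fun K : ℕ => ((K + N : ℕ) : ℂ) ^ (1 - s)) Filter.atTop (nhds 0) := by
      rw [tendsto_zero_iff_norm_tendsto_zero]
      have h4 : Filter.Tendsto (fun x : ℝ => x ^ (-(s.re - 1))) Filter.atTop (nhds 0) :=
        tendsto_rpow_neg_atTop (by linarith)
      have h5 := h4.comp (tendsto_natCast_atTop_atTop.comp (Filter.tendsto_add_atTop_nat N))
      refine h5.congr (fun K => ?_)
      simp only [Function.comp]
      rw [Complex.norm_natCast_cpow_of_pos (by omega)]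
      congr 1
      simp
    have h6 := h2.sub ((tendsto_const_nhds (x := (N : ℂ) ^ (1 - s))).sub h3 |>.div_const (s - 1))
    simp only [sub_zero] at h6
    refine h6.congr (fun K => ?_)
    rw [tail_sum_eq hN hs K]
  unfold ZN
  rw [hlim, hz, ← hsplit]
  have : ∑ n ∈ Finset.range N, (n : ℂ) ^ (-s) = ∑ n ∈ Finset.Ico 1 N, (n : ℂ) ^ (-s) := by
    rw [Finset.range_eq_Ico, Finset.sum_eq_sum_Ico_succ_bot hN]
    have : -s ≠ 0 := by
      intro h
      have := congrArg Complex.re h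
      simp at this; linarith
    simp [Complex.zero_cpow this]
  rw [this]; ring

lemma zeta_disc {δ : ℝ} (hδ : 0 < δ) (hδ4 : δ ≤ 1 / 4) : ∃ C : ℝ, 1 ≤ C ∧ ∀ s0 : ℂ, 1 < s0.re → s0.re ≤ 2 →
    1 ≤ |s0.im| → ∃ Z : ℂ → ℂ, DifferentiableOn ℂ Z (Metric.ball s0 δ) ∧
      (∀ z : ℂ, 1 < z.re → Z z = riemannZeta z) ∧
      ∀ z ∈ Metric.ball s0 δ, ‖Z z‖ ≤ C * |s0.im| ^ (2 * δ) := by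
  set S : ℝ := ∑' n : ℕ, (n : ℝ) ^ (-1 - δ) with hS
  have hSs : Summable (fun n : ℕ => (n : ℝ) ^ (-1 - δ)) := Real.summable_nat_rpow.2 (by linarith)
  have hS0 : 0 ≤ S := tsum_nonneg (fun n => by positivity)
  refine ⟨2 * (5 * S + 2), by linarith, ?_⟩
  intro s0 h1 h2 hu
  set N : ℕ := ⌈|s0.im|⌉₊ with hNdef
  have hNu : |s0.im| ≤ N := Nat.le_ceil _
  have hN1 : (1 : ℝ) ≤ N := hu.trans hNu
  have hN : 0 < N := by exact_mod_cast (by linarith : (0 : ℝ) < N)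
  have hNu2 : (N : ℝ) ≤ 2 * |s0.im| := by
    have := Nat.ceil_lt_add_one (abs_nonneg s0.im)
    linarith
  have geo : ∀ z ∈ Metric.ball s0 δ, 1 - δ < z.re ∧ ‖z‖ ≤ 4 * |s0.im| ∧ 1 / 2 ≤ ‖z - 1‖ := by
    intro z hz
    rw [Metric.mem_ball, dist_eq_norm] at hz
    have hre := (Complex.abs_re_le_norm (z - s0)).trans hz.le
    have him := (Complex.abs_im_le_norm (z - s0)).trans hz.le
    have hre' := (Complex.abs_re_le_norm (z - s0)).trans_lt hz
    simp only [Complex.sub_re, Complex.sub_im] at hre him hre'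
    refine ⟨by linarith [(abs_lt.1 hre').1], ?_, ?_⟩
    · have e1 : ‖z‖ ≤ ‖z - s0‖ + ‖s0‖ := by simpa using norm_add_le (z - s0) s0
      have e2 := Complex.norm_le_abs_re_add_abs_im s0
      rw [abs_of_pos (by linarith : 0 < s0.re)] at e2
      linarith
    · have e3 := Complex.abs_im_le_norm (z - 1)
      simp only [Complex.sub_im, Complex.one_im, sub_zero] at e3
      have : |s0.im| ≤ |z.im| + |z.im - s0.im| := by
        have := abs_sub_abs_le_abs_sub s0.im z.im
        rw [abs_sub_comm] at this
        linarith
      linarith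
  have hne : ∀ z ∈ Metric.ball s0 δ, z ≠ 1 := by
    intro z hz h
    have := (geo z hz).2.2
    rw [h] at this; norm_num at this
  have hhb : ∀ n : ℕ, ∀ z ∈ Metric.ball s0 δ, ‖hh (n + N) z‖ ≤
      4 * |s0.im| * (N : ℝ) ^ (-1 + 2 * δ) * ((n + N : ℕ) : ℝ) ^ (-1 - δ) := by
    intro n z hz
    obtain ⟨g1, g2, g3⟩ := geo z hz
    refine (hh_bound (by omega) (by linarith) (hne z hz)).trans ?_
    rw [mul_assoc]
    have hnN : (N : ℝ) ≤ ((n + N : ℕ) : ℝ) := by push_cast; linarith [(Nat.cast_nonneg n : (0 : ℝ) ≤ n)]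
    have h1n : (1 : ℝ) ≤ ((n + N : ℕ) : ℝ) := hN1.trans hnN
    apply mul_le_mul g2 _ (by positivity) (by positivity)
    calc ((n + N : ℕ) : ℝ) ^ (-z.re - 1) ≤ ((n + N : ℕ) : ℝ) ^ ((-1 + 2 * δ) + (-1 - δ)) :=
          Real.rpow_le_rpow_of_exponent_le h1n (by linarith)
      _ = ((n + N : ℕ) : ℝ) ^ (-1 + 2 * δ) * ((n + N : ℕ) : ℝ) ^ (-1 - δ) := by
          rw [Real.rpow_add (by linarith)]
      _ ≤ _ := by
          apply mul_le_mul_of_nonneg_right _ (by positivity)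
          exact Real.rpow_le_rpow_of_nonpos (by linarith) hnN (by linarith)
  have hsumm : Summable (fun n : ℕ => 4 * |s0.im| * (N : ℝ) ^ (-1 + 2 * δ) * ((n + N : ℕ) : ℝ) ^ (-1 - δ)) :=
    ((summable_nat_add_iff N).2 hSs).mul_left _
  refine ⟨ZN N, ?_, fun z hz => ZN_eq hN hz, ?_⟩
  · unfold ZN
    refine DifferentiableOn.add (DifferentiableOn.add ?_ ?_) ?_
    · refine DifferentiableOn.fun_sum (fun n hn => ?_)
      have : (n : ℂ) ≠ 0 := by
        have := (Finset.mem_Ico.1 hn).1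
        exact_mod_cast (by omega : n ≠ 0)
      exact DifferentiableOn.const_cpow (by fun_prop) (Or.inl this)
    · refine DifferentiableOn.div ?_ (by fun_prop) (fun z hz => sub_ne_zero.2 (hne z hz))
      exact DifferentiableOn.const_cpow (by fun_prop) (Or.inl (by exact_mod_cast hN.ne'))
    · exact Complex.differentiableOn_tsum_of_summable_norm hsumm
        (fun n z hz => (hh_diff (by omega) (hne z hz)).differentiableWithinAt) Metric.isOpen_ball hhb
  · intro z hz
    obtain ⟨g1, g2, g3⟩ := geo z hz
    have hP : (N : ℝ) ^ (2 * δ) ≤ 2 * |s0.im| ^ (2 * δ) := by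
      calc (N : ℝ) ^ (2 * δ) ≤ (2 * |s0.im|) ^ (2 * δ) := Real.rpow_le_rpow (by positivity) hNu2 (by positivity)
        _ = 2 ^ (2 * δ) * |s0.im| ^ (2 * δ) := Real.mul_rpow (by norm_num) (abs_nonneg _)
        _ ≤ 2 ^ (1 : ℝ) * |s0.im| ^ (2 * δ) := by
            gcongr
            · norm_num
            · linarith
        _ = _ := by norm_num
    have t1 : ‖∑ n ∈ Finset.Ico 1 N, (n : ℂ) ^ (-z)‖ ≤ (N : ℝ) ^ (2 * δ) * S := by
      refine (norm_sum_le _ _).trans ?_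
      have : ∑ n ∈ Finset.Ico 1 N, (n : ℝ) ^ (-1 - δ) ≤ S := hSs.sum_le_tsum _ (fun n _ => by positivity)
      refine le_trans ?_ (mul_le_mul_of_nonneg_left this (by positivity))
      rw [Finset.mul_sum]
      refine Finset.sum_le_sum (fun n hn => ?_)
      obtain ⟨hn1, hn2⟩ := Finset.mem_Ico.1 hn
      have hn1' : (1 : ℝ) ≤ n := by exact_mod_cast hn1
      have hn2' : (n : ℝ) ≤ N := by exact_mod_cast hn2.le
      rw [Complex.norm_natCast_cpow_of_pos (by omega)]
      calc (n : ℝ) ^ (-z).re ≤ (n : ℝ) ^ (2 * δ + (-1 - δ)) :=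
            Real.rpow_le_rpow_of_exponent_le hn1' (by simp; linarith)
        _ = (n : ℝ) ^ (2 * δ) * (n : ℝ) ^ (-1 - δ) := Real.rpow_add (by linarith) _ _
        _ ≤ _ := by gcongr
    have t2 : ‖(N : ℂ) ^ (1 - z) / (z - 1)‖ ≤ 2 * (N : ℝ) ^ (2 * δ) := by
      rw [norm_div, Complex.norm_natCast_cpow_of_pos hN, div_le_iff₀ (by linarith)]
      have : (N : ℝ) ^ (1 - z).re ≤ (N : ℝ) ^ (2 * δ) :=
        Real.rpow_le_rpow_of_exponent_le hN1 (by simp; linarith)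
      have h0 : 0 ≤ (N : ℝ) ^ (2 * δ) := by positivity
      nlinarith
    have t3 : ‖∑' n : ℕ, hh (n + N) z‖ ≤ 4 * (N : ℝ) ^ (2 * δ) * S := by
      refine (tsum_of_norm_bounded hsumm.hasSum (fun n => hhb n z hz)).trans ?_
      rw [tsum_mul_left]
      have hh1 : ∑' n : ℕ, ((n + N : ℕ) : ℝ) ^ (-1 - δ) ≤ S := by
        have := hSs.sum_add_tsum_nat_add N
        have h0 : 0 ≤ ∑ n ∈ Finset.range N, (n : ℝ) ^ (-1 - δ) := Finset.sum_nonneg (fun n _ => by positivity)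
        linarith
      apply mul_le_mul _ hh1 (tsum_nonneg (fun n => by positivity)) (by positivity)
      rw [mul_assoc]
      apply mul_le_mul_of_nonneg_left _ (by norm_num)
      calc |s0.im| * (N : ℝ) ^ (-1 + 2 * δ) ≤ N * (N : ℝ) ^ (-1 + 2 * δ) := by gcongr
        _ = (N : ℝ) ^ (1 + (-1 + 2 * δ)) := by
            rw [Real.rpow_add (by linarith) 1, Real.rpow_one]
        _ = _ := by congr 1; ring
    unfold ZN
    refine (norm_add₃_le).trans ?_
    nlinarith
end TLI


namespace TLI

lemma zeta_near_one : ∃ M : ℝ, 1 ≤ M ∧ ∀ x : ℝ, 0 < x → x ≤ 1 → ‖riemannZeta (1 + x)‖ ≤ M / x := by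
  have hc : ContinuousOn (fun x : ℝ => riemannZeta₁ (1 + x)) (Set.Icc 0 1) := by
    have := differentiable_riemannZeta₁.continuous
    fun_prop
  obtain ⟨M, hM⟩ := isCompact_Icc.exists_bound_of_continuousOn hc
  refine ⟨max M 1, le_max_right _ _, fun x hx hx1 => ?_⟩
  have hne : (1 + x : ℂ) ≠ 1 := by
    intro h
    have : (x : ℂ) = 0 := by linear_combination h
    exact hx.ne' (by exact_mod_cast this)
  rw [riemannZeta_eq_inv_sub_mul hne, norm_mul, norm_inv]
  have : ‖(1 + (x : ℂ) - 1)‖ = x := by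
    rw [show (1 + (x : ℂ) - 1) = x by ring, Complex.norm_real, Real.norm_of_nonneg hx.le]
  rw [this, div_eq_inv_mul]
  gcongr
  exact (hM x ⟨hx.le, hx1⟩).trans (le_max_left _ _)

lemma three_four_one (s : ℂ) (hs : 1 < s.re) :
    1 ≤ ‖riemannZeta (1 + ((s.re - 1 : ℝ) : ℂ))‖ ^ 3 * ‖riemannZeta s‖ ^ 4 *
      ‖riemannZeta ((s.re : ℂ) + ((2 * s.im : ℝ) : ℂ) * Complex.I)‖ := by
  have h := DirichletCharacter.norm_LFunction_product_ge_one (N := 1) 1 (x := s.re - 1) (by linarith) s.im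
  rw [DirichletCharacter.LFunctionTrivChar] at h
  simp only [DirichletCharacter.LFunction_modOne_eq] at h
  rw [norm_mul, norm_mul, norm_pow, norm_pow] at h
  have e1 : (1 + ((s.re - 1 : ℝ) : ℂ) + Complex.I * (s.im : ℂ)) = s := by
    apply Complex.ext <;> simp
  have e2 : (1 + ((s.re - 1 : ℝ) : ℂ) + 2 * Complex.I * (s.im : ℂ)) =
      (s.re : ℂ) + ((2 * s.im : ℝ) : ℂ) * Complex.I := by
    apply Complex.ext <;> simp
  rw [e1, e2] at h
  exact h

lemma zeta_lower {δ : ℝ} (hδ : 0 < δ) (hδ4 : δ ≤ 1 / 4) : ∃ C : ℝ, 1 ≤ C ∧ ∀ s0 : ℂ, 1 < s0.re → s0.re ≤ 2 →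
    1 ≤ |s0.im| → ∃ B : ℝ, B = C * |s0.im| ^ (2 * δ) ∧ 1 ≤ B ∧ 1 / B ≤ δ / 8 ∧
    1 / (16 * B ^ 7) ≤ ‖riemannZeta s0‖ ∧
    ∃ Z : ℂ → ℂ, DifferentiableOn ℂ Z (Metric.ball s0 δ) ∧
      (∀ z : ℂ, 1 < z.re → Z z = riemannZeta z) ∧
      (∀ z ∈ Metric.ball s0 δ, ‖Z z‖ ≤ B) ∧ (∀ z ∈ Metric.ball s0 (δ / 2), ‖deriv Z z‖ ≤ B) := by
  obtain ⟨C, hC1, hC⟩ := zeta_disc hδ hδ4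
  obtain ⟨M, hM1, hM⟩ := zeta_near_one
  refine ⟨8 * C / δ + M, by have : 0 < 8 * C / δ := by positivity
                            linarith, ?_⟩
  have hC8 : 8 * C ≤ 8 * C / δ := by
    rw [le_div_iff₀ hδ]; nlinarith
  intro s0 h1 h2 hu
  set P : ℝ := |s0.im| ^ (2 * δ) with hP
  have hP1 : 1 ≤ P := Real.one_le_rpow hu (by positivity)
  set B : ℝ := (8 * C / δ + M) * P with hB
  have hBM : M ≤ B := by
    have : 0 < 8 * C / δ := by positivity
    nlinarith
  have hB8 : 8 * C / δ * P ≤ B := by nlinarith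
  have hBC : 8 * C * P ≤ B := by nlinarith
  have hB1 : 1 ≤ B := hM1.trans hBM
  have hBδ : 1 / B ≤ δ / 8 := by
    rw [div_le_iff₀ (by linarith)]
    have : 8 / δ ≤ B := by
      refine le_trans ?_ hB8
      rw [div_mul_eq_mul_div]
      gcongr
      nlinarith
    rw [div_le_iff₀ hδ] at this
    linarith
  obtain ⟨Z, hZd, hZe, hZb⟩ := hC s0 h1 h2 hu
  have hZb' : ∀ z ∈ Metric.ball s0 δ, ‖Z z‖ ≤ B := fun z hz => (hZb z hz).trans (by nlinarith)
  have hZ' : ∀ z ∈ Metric.ball s0 (δ / 2), ‖deriv Z z‖ ≤ B := by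
    intro z hz
    have hsub : Metric.closedBall z (δ / 4) ⊆ Metric.ball s0 δ := by
      apply Metric.closedBall_subset_ball'
      rw [Metric.mem_ball] at hz
      linarith
    have hd : DiffContOnCl ℂ Z (Metric.ball z (δ / 4)) :=
      DifferentiableOn.diffContOnCl_ball hZd hsub
    refine (Complex.norm_deriv_le_of_forall_mem_sphere_norm_le (C := C * P) (by positivity) hd
      (fun w hw => hZb w (hsub (Metric.sphere_subset_closedBall hw)))).trans ?_
    rw [div_le_iff₀ (by positivity)]
    calc C * P ≤ (8 * C / δ * P) * (δ / 4) := by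
          field_simp
          nlinarith [mul_pos (by linarith : 0 < C) (by linarith : 0 < P)]
      _ ≤ _ := by gcongr
  refine ⟨B, rfl, hB1, hBδ, ?_, Z, hZd, hZe, hZb', hZ'⟩
  set a : ℝ := 1 / (16 * B ^ 8) with ha
  have hB0 : 0 < B := by linarith
  have ha0 : 0 < a := by positivity
  have haB : a ≤ 1 / B := by
    rw [ha]
    apply one_div_le_one_div_of_le hB0
    have : B ≤ B ^ 8 := le_self_pow₀ hB1 (by norm_num)
    nlinarith
  have ha1 : a ≤ δ / 8 := haB.trans hBδ
  have haB2 : a * B = 1 / (16 * B ^ 7) := by rw [ha]; field_simp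
  have key : ∀ s : ℂ, 1 + a ≤ s.re → s.re ≤ 2 → s.im = s0.im → 2 * a * B ≤ ‖riemannZeta s‖ := by
    intro s hs1 hs2 him
    have h341 := three_four_one s (by linarith)
    have e1 : ‖riemannZeta (1 + ((s.re - 1 : ℝ) : ℂ))‖ ≤ B / a := by
      refine (hM (s.re - 1) (by linarith) (by linarith)).trans ?_
      gcongr
      linarith
    have e2 : ‖riemannZeta ((s.re : ℂ) + ((2 * s.im : ℝ) : ℂ) * Complex.I)‖ ≤ B := by
      set s2 : ℂ := (s.re : ℂ) + ((2 * s.im : ℝ) : ℂ) * Complex.I with hs2d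
      have r2 : s2.re = s.re := by simp [hs2d]
      have i2 : s2.im = 2 * s0.im := by simp [hs2d, him]
      have hi2 : |s2.im| = 2 * |s0.im| := by rw [i2, abs_mul]; norm_num
      obtain ⟨Z2, _, hZe2, hZb2⟩ := hC s2 (by linarith) (by linarith) (by linarith)
      rw [← hZe2 s2 (by linarith)]
      refine (hZb2 s2 (Metric.mem_ball_self hδ)).trans ?_
      rw [hi2, Real.mul_rpow (by norm_num) (abs_nonneg _)]
      have : (2 : ℝ) ^ (2 * δ) ≤ 2 ^ (1 : ℝ) := Real.rpow_le_rpow_of_exponent_le (by norm_num) (by linarith)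
      rw [Real.rpow_one] at this
      calc C * (2 ^ (2 * δ) * |s0.im| ^ (2 * δ)) ≤ C * (2 * P) := by gcongr
        _ ≤ B := by nlinarith
    have h4 : 1 ≤ (B / a) ^ 3 * ‖riemannZeta s‖ ^ 4 * B := by
      refine h341.trans ?_
      gcongr
    by_contra hcon
    push Not at hcon
    have h5 : ‖riemannZeta s‖ ^ 4 < (2 * a * B) ^ 4 := pow_lt_pow_left₀ hcon (norm_nonneg _) (by norm_num)
    have h6 : (B / a) ^ 3 * ‖riemannZeta s‖ ^ 4 * B < (B / a) ^ 3 * (2 * a * B) ^ 4 * B := by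
      gcongr
    have h7 : (B / a) ^ 3 * (2 * a * B) ^ 4 * B = 1 := by
      have : a * (16 * B ^ 8) = 1 := by rw [ha]; field_simp
      calc (B / a) ^ 3 * (2 * a * B) ^ 4 * B = a * (16 * B ^ 8) := by field_simp; norm_num
        _ = 1 := this
    linarith
  rw [← haB2]
  by_cases hx : 1 + a ≤ s0.re
  · refine le_trans ?_ (key s0 hx h2 rfl)
    nlinarith [mul_pos ha0 hB0]
  · push Not at hx
    set s1 : ℂ := ((1 + a : ℝ) : ℂ) + (s0.im : ℂ) * Complex.I with hs1
    have r1 : s1.re = 1 + a := by simp [hs1]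
    have i1 : s1.im = s0.im := by simp [hs1]
    have hk := key s1 (by rw [r1]) (by rw [r1]; linarith) i1
    have hdist : ‖s1 - s0‖ ≤ a := by
      have := Complex.norm_le_abs_re_add_abs_im (s1 - s0)
      simp only [Complex.sub_re, Complex.sub_im, r1, i1, sub_self, abs_zero, add_zero] at this
      refine this.trans ?_
      rw [abs_of_pos (by linarith)]; linarith
    have hmem : s1 ∈ Metric.ball s0 (δ / 2) := by
      rw [Metric.mem_ball, dist_eq_norm]; linarith
    have hmv := Convex.norm_image_sub_le_of_norm_deriv_le (f := Z) (s := Metric.ball s0 (δ / 2)) (C := B)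
      (fun z hz => hZd.differentiableAt (Metric.isOpen_ball.mem_nhds
        (Metric.ball_subset_ball (by linarith) hz))) hZ' (convex_ball _ _)
      (Metric.mem_ball_self (by positivity)) hmem
    rw [hZe s1 (by rw [r1]; linarith), hZe s0 h1] at hmv
    have := norm_sub_norm_le (riemannZeta s1) (riemannZeta s0)
    have : B * ‖s1 - s0‖ ≤ B * a := by gcongr
    linarith

/-- the function whose Dirichlet coefficients are `Λ - 1` -/
noncomputable def DD (s : ℂ) : ℂ := -deriv riemannZeta s / riemannZeta s - riemannZeta s

lemma DD_high (k : ℕ) : ∃ C : ℝ, ∀ s0 : ℂ, 1 < s0.re → s0.re ≤ 2 → 1 ≤ |s0.im| →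
    ‖iteratedDeriv k DD s0‖ ≤ C * |s0.im| ^ 2 := by
  set δ : ℝ := 1 / (8 * ((k : ℝ) + 1)) with hδdef
  have hδ : 0 < δ := by positivity
  have hδ4 : δ ≤ 1 / 4 := by
    rw [hδdef]
    apply one_div_le_one_div_of_le (by norm_num)
    have : (0 : ℝ) ≤ k := by positivity
    linarith
  obtain ⟨C, hC1, hC⟩ := zeta_lower hδ hδ4
  refine ⟨k.factorial * 64 ^ (k + 1) * C ^ (8 * (k + 1)), ?_⟩
  intro s0 h1 h2 hu
  obtain ⟨B, hBdef, hB1, hBδ, hlow, Z, hZd, hZe, hZb, hZ'⟩ := hC s0 h1 h2 hu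
  have hB0 : 0 < B := by linarith
  set a : ℝ := 1 / (16 * B ^ 8) with ha
  have ha0 : 0 < a := by positivity
  have haB : a ≤ 1 / B := by
    rw [ha]
    apply one_div_le_one_div_of_le hB0
    have : B ≤ B ^ 8 := le_self_pow₀ hB1 (by norm_num)
    nlinarith
  have ha1 : a ≤ δ / 8 := haB.trans hBδ
  have haB2 : a * B = 1 / (16 * B ^ 7) := by rw [ha]; field_simp
  have hopen : ∀ᶠ z in nhds s0, 1 < z.re :=
    (isOpen_lt continuous_const Complex.continuous_re).mem_nhds h1
  have hee : riemannZeta =ᶠ[nhds s0] Z := by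
    filter_upwards [hopen] with z hz using (hZe z hz).symm
  have hDD : DD =ᶠ[nhds s0] fun z => -deriv Z z / Z z - Z z := by
    filter_upwards [hee, hee.deriv] with z hz1 hz2
    simp only [DD, hz1, hz2]
  rw [hDD.iteratedDeriv_eq]
  have hin : Metric.ball s0 (a / 2) ⊆ Metric.ball s0 (δ / 2) := Metric.ball_subset_ball (by linarith)
  have hin2 : Metric.ball s0 (δ / 2) ⊆ Metric.ball s0 δ := Metric.ball_subset_ball (by linarith)
  have hZlow : ∀ z ∈ Metric.ball s0 (a / 2), 1 / (32 * B ^ 7) ≤ ‖Z z‖ := by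
    intro z hz
    have hmv := Convex.norm_image_sub_le_of_norm_deriv_le (f := Z) (s := Metric.ball s0 (δ / 2)) (C := B)
      (fun z hz => hZd.differentiableAt (Metric.isOpen_ball.mem_nhds (hin2 hz))) hZ' (convex_ball _ _)
      (Metric.mem_ball_self (by positivity)) (hin hz)
    rw [hZe s0 h1] at hmv
    have h3 := norm_sub_norm_le (riemannZeta s0) (Z z)
    rw [norm_sub_rev] at h3
    have h4 : ‖z - s0‖ ≤ a / 2 := by
      rw [Metric.mem_ball, dist_eq_norm] at hz; exact hz.le
    have : B * ‖z - s0‖ ≤ B * (a / 2) := by gcongr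
    have e : 1 / (32 * B ^ 7) = (a * B) / 2 := by rw [haB2]; field_simp; norm_num
    rw [e]
    linarith
  have hb : ∀ z ∈ Metric.ball s0 (a / 2), ‖-deriv Z z / Z z - Z z‖ ≤ 64 * B ^ 8 := by
    intro z hz
    have l1 := hZlow z hz
    have l2 := hZ' z (hin hz)
    have l3 := hZb z (hin2 (hin hz))
    refine (norm_sub_le _ _).trans ?_
    rw [norm_div, norm_neg]
    have : ‖deriv Z z‖ / ‖Z z‖ ≤ B / (1 / (32 * B ^ 7)) := by
      gcongr
    have e : B / (1 / (32 * B ^ 7)) = 32 * B ^ 8 := by field_simp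
    have : B ≤ B ^ 8 := le_self_pow₀ hB1 (by norm_num)
    nlinarith [pow_pos hB0 8]
  have hsub : Metric.closedBall s0 (a / 4) ⊆ Metric.ball s0 (a / 2) :=
    Metric.closedBall_subset_ball (by linarith)
  have hZd2 : DifferentiableOn ℂ Z (Metric.ball s0 (a / 2)) := hZd.mono (hin.trans hin2)
  have hdiff : DifferentiableOn ℂ (fun z => -deriv Z z / Z z - Z z) (Metric.ball s0 (a / 2)) := by
    refine DifferentiableOn.sub (DifferentiableOn.div (hZd2.deriv Metric.isOpen_ball).neg hZd2 ?_) hZd2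
    intro z hz h0
    have := hZlow z hz
    rw [h0, norm_zero] at this
    have : 0 < 1 / (32 * B ^ 7) := by positivity
    linarith
  have hfin := Complex.norm_iteratedDeriv_le_of_forall_mem_sphere_norm_le (c := s0) (R := a / 4)
    (C := 64 * B ^ 8) k (by positivity) (hdiff.diffContOnCl_ball hsub)
    (fun z hz => hb z (hsub (Metric.sphere_subset_closedBall hz)))
  refine hfin.trans ?_
  have e1 : (k.factorial : ℝ) * (64 * B ^ 8) / (a / 4) ^ k = k.factorial * 64 ^ (k + 1) * B ^ (8 * (k + 1)) := by
    have : a / 4 = 1 / (64 * B ^ 8) := by rw [ha]; field_simp; norm_num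
    rw [this, div_pow, one_pow, div_div_eq_mul_div, div_one, pow_mul, mul_assoc, mul_assoc, mul_pow]
    ring
  rw [e1, hBdef, mul_pow, ← mul_assoc]
  apply le_of_eq
  congr 1
  rw [← Real.rpow_natCast, ← Real.rpow_mul (abs_nonneg _), ← Real.rpow_natCast]
  congr 1
  rw [hδdef]; push_cast
  field_simp

lemma DD_low (k : ℕ) : ∃ C : ℝ, ∀ s0 : ℂ, 1 < s0.re → s0.re ≤ 2 → |s0.im| ≤ 1 →
    ‖iteratedDeriv k DD s0‖ ≤ C := by
  set F : ℂ → ℂ := fun s => -deriv riemannZeta₁ s / riemannZeta₁ s - riemannZeta₀ s with hF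
  have hne : ∀ s : ℂ, 1 ≤ s.re → riemannZeta₁ s ≠ 0 := by
    intro s hs h0
    by_cases h1 : s = 1
    · rw [h1, riemannZeta₁_one] at h0; exact one_ne_zero h0
    · apply riemannZeta_ne_zero_of_one_le_re hs
      rw [riemannZeta_eq_inv_sub_mul h1, h0, mul_zero]
  have hA : AnalyticOnNhd ℂ F {s | 1 ≤ s.re} := by
    intro s hs
    have a1 : AnalyticAt ℂ riemannZeta₁ s := differentiable_riemannZeta₁.analyticAt s
    have a0 : AnalyticAt ℂ riemannZeta₀ s := differentiable_riemannZeta₀.analyticAt s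
    exact (a1.deriv.neg.div a1 (hne s hs)).sub a0
  have hcont : ContinuousOn (iteratedDeriv k F) {s | 1 ≤ s.re} := by
    rw [iteratedDeriv_eq_iterate]
    exact (hA.iterated_deriv k).continuousOn
  have hcomp : IsCompact (Set.Icc (1 : ℝ) 2 ×ℂ Set.Icc (-1 : ℝ) 1) := isCompact_Icc.reProdIm isCompact_Icc
  obtain ⟨C, hC⟩ := hcomp.exists_bound_of_continuousOn (hcont.mono (fun s hs => (Complex.mem_reProdIm.1 hs).1.1))
  refine ⟨C, fun s0 h1 h2 h3 => ?_⟩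
  have hopen : ∀ᶠ z in nhds s0, 1 < z.re :=
    (isOpen_lt continuous_const Complex.continuous_re).mem_nhds h1
  have hDD : DD =ᶠ[nhds s0] F := by
    filter_upwards [hopen] with z hz
    have hz1 : z ≠ 1 := by rintro rfl; simp at hz
    have hz0 := hne z hz.le
    have hd : deriv riemannZeta z = -((z - 1) ^ 2)⁻¹ * riemannZeta₁ z + (z - 1)⁻¹ * deriv riemannZeta₁ z := by
      have e : riemannZeta =ᶠ[nhds z] fun s => (s - 1)⁻¹ * riemannZeta₁ s := by
        filter_upwards [isOpen_ne.mem_nhds hz1] with s hs using riemannZeta_eq_inv_sub_mul hs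
      rw [e.deriv_eq]
      have d1 : HasDerivAt (fun s : ℂ => (s - 1)⁻¹) (-1 / (z - 1) ^ 2) z :=
        ((hasDerivAt_id z).sub_const 1).inv (sub_ne_zero.2 hz1)
      have d2 := (differentiable_riemannZeta₁ z).hasDerivAt
      refine (d1.mul d2).deriv.trans ?_
      ring
    have hm : z - 1 ≠ 0 := sub_ne_zero.2 hz1
    simp only [DD, hF]
    rw [hd, riemannZeta_eq_inv_sub_mul hz1]
    have : riemannZeta₁ z = 1 + (z - 1) * riemannZeta₀ z := rfl
    have e0 : riemannZeta₀ z = (riemannZeta₁ z - 1) / (z - 1) := by rw [this]; field_simp; ring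
    rw [e0]
    field_simp
    ring
  rw [hDD.iteratedDeriv_eq]
  exact hC s0 (Complex.mem_reProdIm.2 ⟨⟨h1.le, h2⟩, abs_le.1 h3⟩)

lemma DD_bound (k : ℕ) : ∃ C : ℝ, 0 ≤ C ∧ ∀ s0 : ℂ, 1 < s0.re → s0.re ≤ 2 →
    ‖iteratedDeriv k DD s0‖ ≤ C * (1 + s0.im ^ 2) := by
  obtain ⟨C1, h1⟩ := DD_high k
  obtain ⟨C2, h2⟩ := DD_low k
  refine ⟨max (max C1 C2) 0, le_max_right _ _, fun s0 ha hb => ?_⟩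
  have m1 : C1 ≤ max (max C1 C2) 0 := (le_max_left _ _).trans (le_max_left _ _)
  have m2 : C2 ≤ max (max C1 C2) 0 := (le_max_right _ _).trans (le_max_left _ _)
  have m0 : 0 ≤ max (max C1 C2) 0 := le_max_right _ _
  rcases le_total 1 |s0.im| with h | h
  · refine (h1 s0 ha hb h).trans ?_
    rw [sq_abs]
    nlinarith [sq_nonneg s0.im]
  · refine (h2 s0 ha hb h).trans ?_
    nlinarith [sq_nonneg s0.im]

lemma DD_series (k : ℕ) {s : ℂ} (hs : 1 < s.re) :
    iteratedDeriv k DD s = (-1) ^ k * LSeries (LSeries.logMul^[k]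
      (fun n => ((ArithmeticFunction.vonMangoldt n - 1 : ℝ) : ℂ))) s := by
  have hab1 : LSeries.abscissaOfAbsConv (fun n => ((ArithmeticFunction.vonMangoldt n : ℝ) : ℂ)) ≤ 1 := by
    apply LSeries.abscissaOfAbsConv_le_of_forall_lt_LSeriesSummable
    intro y hy
    exact ArithmeticFunction.LSeriesSummable_vonMangoldt (by simpa using hy)
  have hab : LSeries.abscissaOfAbsConv (fun n => ((ArithmeticFunction.vonMangoldt n - 1 : ℝ) : ℂ)) ≤ 1 := by
    apply LSeries.abscissaOfAbsConv_le_of_forall_lt_LSeriesSummable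
    intro y hy
    have s1 : LSeriesSummable (fun n => ((ArithmeticFunction.vonMangoldt n : ℝ) : ℂ)) y :=
      ArithmeticFunction.LSeriesSummable_vonMangoldt (by simpa using hy)
    have s2 : LSeriesSummable 1 (y : ℂ) := LSeriesSummable_one_iff.2 (by simpa using hy)
    have := s1.sub s2
    convert this using 1
    ext n; simp
  rw [← LSeries_iteratedDeriv k (lt_of_le_of_lt hab (by exact_mod_cast hs))]
  apply Filter.EventuallyEq.iteratedDeriv_eq
  have hopen : ∀ᶠ z in nhds s, 1 < z.re :=
    (isOpen_lt continuous_const Complex.continuous_re).mem_nhds hs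
  filter_upwards [hopen] with z hz
  rw [DD, ← ArithmeticFunction.LSeries_vonMangoldt_eq_deriv_riemannZeta_div hz, ← LSeries_one_eq_riemannZeta hz,
    ← LSeries_sub (ArithmeticFunction.LSeriesSummable_vonMangoldt hz) (LSeriesSummable_one_iff.2 hz)]
  congr 1
  ext n; simp

end TLI


namespace TLI
open ArithmeticFunction (vonMangoldt)

lemma logpow_bound (j : ℕ) {L : ℝ} (hL : 1 ≤ L) (n : ℕ) :
    Real.log n ^ j * (n : ℝ) ^ (-(1 + 1 / L)) ≤ j.factorial * (2 * L) ^ j * (n : ℝ) ^ (-(1 + 1 / (2 * L))) := by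
  rcases Nat.eq_zero_or_pos n with rfl | hn
  · have h1 : -(1 + 1 / L) ≠ 0 := by
      have : 0 < 1 / L := by positivity
      linarith
    simp only [Nat.cast_zero]
    rw [Real.zero_rpow h1]
    have : 0 ≤ (0 : ℝ) ^ (-(1 + 1 / (2 * L))) := Real.rpow_nonneg le_rfl _
    rw [mul_zero]; positivity
  · have hn' : (0 : ℝ) < n := by exact_mod_cast hn
    have hl : 0 ≤ Real.log n := Real.log_natCast_nonneg n
    have h := Real.pow_div_factorial_le_exp (Real.log n / (2 * L)) (by positivity) j
    rw [div_pow, div_div, div_le_iff₀ (by positivity)] at h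
    have e : (n : ℝ) ^ (-(1 + 1 / (2 * L))) = Real.exp (Real.log n / (2 * L)) * (n : ℝ) ^ (-(1 + 1 / L)) := by
      rw [show Real.exp (Real.log n / (2 * L)) = (n : ℝ) ^ (1 / (2 * L)) by
        rw [Real.rpow_def_of_pos hn']; congr 1; ring, ← Real.rpow_add hn']
      congr 1
      field_simp
      ring
    rw [e]
    have h0 : 0 ≤ (n : ℝ) ^ (-(1 + 1 / L)) := by positivity
    calc _ ≤ (Real.exp (Real.log n / (2 * L)) * ((2 * L) ^ j * j.factorial)) * (n : ℝ) ^ (-(1 + 1 / L)) := by gcongr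
      _ = _ := by ring

lemma summ_half {L : ℝ} (hL : 1 ≤ L) : Summable (fun n : ℕ => (n : ℝ) ^ (-(1 + 1 / (2 * L)))) := by
  apply Real.summable_nat_rpow.2
  have : 0 < 1 / (2 * L) := by positivity
  linarith

lemma sum_half : ∃ M : ℝ, 1 ≤ M ∧ ∀ L : ℝ, 1 ≤ L → ∑' n : ℕ, (n : ℝ) ^ (-(1 + 1 / (2 * L))) ≤ M * L := by
  obtain ⟨M, hM1, hM⟩ := zeta_near_one
  refine ⟨2 * M, by linarith, fun L hL => ?_⟩
  have hx : 0 < 1 / (2 * L) := by positivity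
  have hx1 : 1 / (2 * L) ≤ 1 := by
    rw [div_le_iff₀ (by positivity)]; linarith
  have h := hM (1 / (2 * L)) hx hx1
  have e : riemannZeta (1 + ((1 / (2 * L) : ℝ) : ℂ)) = ((∑' n : ℕ, (n : ℝ) ^ (-(1 + 1 / (2 * L))) : ℝ) : ℂ) := by
    rw [zeta_eq_tsum_one_div_nat_cpow (by simp; linarith), Complex.ofReal_tsum]
    refine tsum_congr (fun n => ?_)
    rw [Complex.ofReal_cpow (by positivity), one_div, ← Complex.cpow_neg]
    push_cast
    rfl
  rw [e, Complex.norm_real, div_div_eq_mul_div, div_one] at h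
  have := le_trans (le_abs_self _) h
  linarith

lemma summ_coef (k : ℕ) {L : ℝ} (hL : 1 ≤ L) :
    Summable (fun n : ℕ => (vonMangoldt n + 1) * (Real.log n ^ k * (n : ℝ) ^ (-(1 + 1 / L)))) := by
  have h1 := ((summ_half hL).mul_left ((k + 1).factorial * (2 * L) ^ (k + 1))).add
    ((summ_half hL).mul_left (k.factorial * (2 * L) ^ k))
  refine Summable.of_nonneg_of_le (fun n => ?_) (fun n => ?_) h1
  · have := ArithmeticFunction.vonMangoldt_nonneg (n := n)
    have := Real.log_natCast_nonneg n
    positivity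
  · have b1 := logpow_bound (k + 1) hL n
    have b2 := logpow_bound k hL n
    have b3 : vonMangoldt n ≤ Real.log n := ArithmeticFunction.vonMangoldt_le_log
    have b0 : 0 ≤ Real.log n ^ k * (n : ℝ) ^ (-(1 + 1 / L)) := by
      have := Real.log_natCast_nonneg n
      positivity
    calc _ = vonMangoldt n * (Real.log n ^ k * (n : ℝ) ^ (-(1 + 1 / L))) + Real.log n ^ k * (n : ℝ) ^ (-(1 + 1 / L)) := by ring
      _ ≤ Real.log n * (Real.log n ^ k * (n : ℝ) ^ (-(1 + 1 / L))) + Real.log n ^ k * (n : ℝ) ^ (-(1 + 1 / L)) := by gcongr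
      _ = Real.log n ^ (k + 1) * (n : ℝ) ^ (-(1 + 1 / L)) + Real.log n ^ k * (n : ℝ) ^ (-(1 + 1 / L)) := by ring
      _ ≤ _ := add_le_add b1 b2

/-- gaussian weight -/
noncomputable def gw (η L : ℝ) (n : ℕ) : ℝ := Real.exp (-(Real.log n - L) ^ 2 / (2 * η ^ 2))

lemma gw_pos (η L : ℝ) (n : ℕ) : 0 < gw η L n := Real.exp_pos _
lemma gw_le_one (η L : ℝ) (n : ℕ) : gw η L n ≤ 1 := by
  unfold gw
  rw [Real.exp_le_one_iff]
  apply div_nonpos_of_nonpos_of_nonneg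
  · nlinarith [sq_nonneg (Real.log n - L)]
  · positivity

lemma logMul_iter (f : ℕ → ℂ) (k : ℕ) (n : ℕ) :
    (LSeries.logMul^[k] f) n = ((Real.log n : ℝ) : ℂ) ^ k * f n := by
  induction k with
  | zero => simp
  | succ k ih =>
    rw [Function.iterate_succ_apply', LSeries.logMul, ih, Complex.natCast_log, pow_succ]
    ring

lemma term_eq (k : ℕ) (σ u : ℝ) (hσ : 0 < σ) (n : ℕ) :
    LSeries.term (LSeries.logMul^[k] (fun n => ((vonMangoldt n - 1 : ℝ) : ℂ))) ((σ : ℂ) + u * Complex.I) n =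
     (((vonMangoldt n - 1) * (Real.log n ^ k * (n : ℝ) ^ (-σ)) : ℝ) : ℂ) * Complex.exp (-(Complex.I * u * (Real.log n : ℝ))) := by
  rcases Nat.eq_zero_or_pos n with rfl | hn
  · rw [LSeries.term_zero, Nat.cast_zero, Real.zero_rpow (by linarith)]
    simp
  · have hn' : (0 : ℝ) < n := by exact_mod_cast hn
    have hn0 : (n : ℂ) ≠ 0 := by exact_mod_cast hn.ne'
    rw [LSeries.term_of_ne_zero hn.ne', logMul_iter, div_eq_mul_inv, ← Complex.cpow_neg, neg_add,
      Complex.cpow_add _ _ hn0]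
    have e1 : (n : ℂ) ^ (-(σ : ℂ)) = (((n : ℝ) ^ (-σ) : ℝ) : ℂ) := by
      rw [Complex.ofReal_cpow hn'.le]; push_cast; rfl
    have e2 : (n : ℂ) ^ (-((u : ℂ) * Complex.I)) = Complex.exp (-(Complex.I * u * (Real.log n : ℝ))) := by
      rw [Complex.cpow_def_of_ne_zero hn0, ← Complex.natCast_log]
      congr 1; ring
    rw [e1, e2]
    push_cast
    ring

lemma gauss_fourier {η : ℝ} (hη : 0 < η) (v : ℝ) :
    ∫ u : ℝ, Complex.exp (Complex.I * v * u) * Complex.exp (-((η ^ 2 / 2 : ℝ) : ℂ) * (u : ℂ) ^ 2) =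
      ((Real.sqrt (2 * Real.pi) / η * Real.exp (-v ^ 2 / (2 * η ^ 2)) : ℝ) : ℂ) := by
  have h := fourierIntegral_gaussian (b := ((η ^ 2 / 2 : ℝ) : ℂ)) (by rw [Complex.ofReal_re]; positivity) (v : ℂ)
  rw [h]
  have e1 : ((Real.pi : ℂ) / ((η ^ 2 / 2 : ℝ) : ℂ)) ^ (1 / 2 : ℂ) = ((Real.sqrt (2 * Real.pi) / η : ℝ) : ℂ) := by
    rw [show ((Real.pi : ℂ) / ((η ^ 2 / 2 : ℝ) : ℂ)) = ((2 * Real.pi / η ^ 2 : ℝ) : ℂ) by push_cast; field_simp,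
      show (1 / 2 : ℂ) = ((1 / 2 : ℝ) : ℂ) by push_cast; rfl, ← Complex.ofReal_cpow (by positivity)]
    congr 1
    rw [← Real.sqrt_eq_rpow, Real.sqrt_div (by positivity), Real.sqrt_sq hη.le]
  rw [e1]
  push_cast
  congr 2
  field_simp
  norm_num

lemma gauss_err {η : ℝ} (hη : 0 < η) (hη1 : η ≤ 1) (G : ℝ → ℂ) (C : ℝ) (hC : 0 ≤ C)
    (hG : ∀ u, ‖G u‖ ≤ C * (1 + u ^ 2) * Real.exp (-(η ^ 2 / 2) * u ^ 2)) :
    ‖∫ u, G u‖ ≤ 5 * C / η ^ 2 * (Real.sqrt (Real.pi / (η ^ 2 / 4))) := by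
  rw [← integral_gaussian (η ^ 2 / 4), ← MeasureTheory.integral_const_mul]
  refine MeasureTheory.norm_integral_le_of_norm_le ?_ ?_
  · exact (integrable_exp_neg_mul_sq (by positivity)).const_mul _
  · refine Filter.Eventually.of_forall (fun u => (hG u).trans ?_)
    have e : Real.exp (-(η ^ 2 / 2) * u ^ 2) = Real.exp (-(η ^ 2 / 4) * u ^ 2) * Real.exp (-(η ^ 2 / 4) * u ^ 2) := by
      rw [← Real.exp_add]; congr 1; ring
    rw [e, ← mul_assoc]
    apply mul_le_mul_of_nonneg_right _ (Real.exp_pos _).le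
    rw [mul_assoc, mul_comm 5 C, mul_div_assoc]
    apply mul_le_mul_of_nonneg_left _ hC
    have h1 : η ^ 2 / 4 * u ^ 2 + 1 ≤ Real.exp (η ^ 2 / 4 * u ^ 2) := Real.add_one_le_exp _
    have h2 : Real.exp (-(η ^ 2 / 4) * u ^ 2) * Real.exp (η ^ 2 / 4 * u ^ 2) = 1 := by
      rw [← Real.exp_add]; simp
    have h3 : 0 < Real.exp (-(η ^ 2 / 4) * u ^ 2) := Real.exp_pos _
    rw [le_div_iff₀ (by positivity)]
    have h4 : (1 + u ^ 2) * η ^ 2 ≤ 5 * (η ^ 2 / 4 * u ^ 2 + 1) := by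
      have : η ^ 2 ≤ 1 := by nlinarith
      nlinarith [sq_nonneg (η * u)]
    calc (1 + u ^ 2) * Real.exp (-(η ^ 2 / 4) * u ^ 2) * η ^ 2 = Real.exp (-(η ^ 2 / 4) * u ^ 2) * ((1 + u ^ 2) * η ^ 2) := by ring
      _ ≤ Real.exp (-(η ^ 2 / 4) * u ^ 2) * (5 * Real.exp (η ^ 2 / 4 * u ^ 2)) := by
          apply mul_le_mul_of_nonneg_left _ h3.le
          linarith
      _ = 5 := by rw [mul_left_comm, h2, mul_one]

lemma smooth_err (k : ℕ) : ∃ C : ℝ, 0 ≤ C ∧ ∀ L η : ℝ, 1 ≤ L → 0 < η → η ≤ 1 →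
    |∑' n : ℕ, (vonMangoldt n - 1) * (Real.log n ^ k * (n : ℝ) ^ (-(1 + 1 / L))) * gw η L n| ≤ C / η ^ 2 := by
  obtain ⟨C, hC0, hC⟩ := DD_bound k
  refine ⟨10 * C, by positivity, fun L η hL hη hη1 => ?_⟩
  set σ : ℝ := 1 + 1 / L with hσ
  have hL0 : 0 < 1 / L := by positivity
  have hL1 : 1 / L ≤ 1 := by rw [div_le_iff₀ (by linarith)]; linarith
  set a : ℕ → ℝ := fun n => (vonMangoldt n - 1) * (Real.log n ^ k * (n : ℝ) ^ (-σ)) with ha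
  have hsa : Summable (fun n => |a n|) := by
    refine Summable.of_nonneg_of_le (fun n => abs_nonneg _) (fun n => ?_) (summ_coef k hL)
    have b0 : 0 ≤ Real.log n ^ k * (n : ℝ) ^ (-(1 + 1 / L)) := by
      have := Real.log_natCast_nonneg n
      positivity
    have b1 := ArithmeticFunction.vonMangoldt_nonneg (n := n)
    rw [ha]
    simp only
    rw [abs_mul, abs_of_nonneg b0]
    gcongr
    rw [abs_le]; constructor <;> linarith
  set gq : ℝ → ℂ := fun u => Complex.exp (-((η ^ 2 / 2 : ℝ) : ℂ) * (u : ℂ) ^ 2) with hgq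
  have hgqn : ∀ u, ‖gq u‖ = Real.exp (-(η ^ 2 / 2) * u ^ 2) := by
    intro u
    rw [hgq]; simp only
    rw [show (-((η ^ 2 / 2 : ℝ) : ℂ) * (u : ℂ) ^ 2) = ((-(η ^ 2 / 2) * u ^ 2 : ℝ) : ℂ) by push_cast; ring,
      ← Complex.ofReal_exp, Complex.norm_real, Real.norm_of_nonneg (Real.exp_pos _).le]
  set F : ℕ → ℝ → ℂ := fun n u => (a n : ℂ) * (Complex.exp (Complex.I * ((L - Real.log n : ℝ) : ℂ) * u) * gq u) with hF
  have hFn : ∀ n u, ‖F n u‖ = |a n| * Real.exp (-(η ^ 2 / 2) * u ^ 2) := by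
    intro n u
    rw [hF]; simp only
    rw [norm_mul, norm_mul, hgqn, Complex.norm_real, Real.norm_eq_abs,
      show Complex.I * ((L - Real.log n : ℝ) : ℂ) * u = (((L - Real.log n) * u : ℝ) : ℂ) * Complex.I by push_cast; ring,
      Complex.norm_exp_ofReal_mul_I, one_mul]
  have hFi : ∀ n, MeasureTheory.Integrable (F n) := by
    intro n
    refine MeasureTheory.Integrable.mono' ((integrable_exp_neg_mul_sq (by positivity : 0 < η ^ 2 / 2)).const_mul |a n|) ?_
      (Filter.Eventually.of_forall (fun u => (hFn n u).le))
    apply Continuous.aestronglyMeasurable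
    rw [hF, hgq]
    fun_prop
  have hsum := MeasureTheory.hasSum_integral_of_summable_integral_norm hFi (by
    have : (fun n => ∫ u, ‖F n u‖) = fun n => |a n| * ∫ u : ℝ, Real.exp (-(η ^ 2 / 2) * u ^ 2) := by
      ext n
      rw [← MeasureTheory.integral_const_mul]
      congr 1
      ext u; exact hFn n u
    rw [this]
    exact hsa.mul_right _)
  set K : ℝ := Real.sqrt (2 * Real.pi) / η with hK
  have hK0 : 0 < K := by positivity
  have e1 : ∀ n, ∫ u, F n u = ((K * (a n * gw η L n) : ℝ) : ℂ) := by
    intro n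
    rw [hF]; simp only
    rw [MeasureTheory.integral_const_mul, gauss_fourier hη, gw, ← neg_sub (Real.log n) L, neg_sq]
    rw [hK]; push_cast; ring
  have e2 : ∀ u, ∑' n, F n u = Complex.exp (Complex.I * L * u) * gq u * ((-1) ^ k * iteratedDeriv k DD ((σ : ℂ) + u * Complex.I)) := by
    intro u
    rw [DD_series k (by simp; linarith), ← mul_assoc ((-1 : ℂ) ^ k), ← mul_pow,
      show (-1 : ℂ) * -1 = 1 by norm_num, one_pow, one_mul]
    rw [LSeries, ← tsum_mul_left]
    refine tsum_congr (fun n => ?_)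
    rw [term_eq k σ u (by linarith) n]
    rw [hF]; simp only
    rw [show Complex.I * ((L - Real.log n : ℝ) : ℂ) * u = Complex.I * L * u + -(Complex.I * u * (Real.log n : ℝ)) by push_cast; ring,
      Complex.exp_add]
    ring
  have hb := gauss_err hη hη1 (fun u => ∑' n, F n u) C hC0 (by
    intro u
    rw [e2, norm_mul, norm_mul, norm_mul, hgqn, show Complex.I * (L : ℂ) * (u : ℂ) = ((L * u : ℝ) : ℂ) * Complex.I by push_cast; ring,
      Complex.norm_exp_ofReal_mul_I, one_mul, norm_pow, norm_neg, norm_one, one_pow, one_mul, mul_comm]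
    apply mul_le_mul_of_nonneg_right _ (Real.exp_pos _).le
    have := hC ((σ : ℂ) + u * Complex.I) (by simp; linarith) (by simp; linarith)
    simpa using this)
  rw [← hsum.tsum_eq] at hb
  simp only [e1] at hb
  rw [← Complex.ofReal_tsum, Complex.norm_real, tsum_mul_left, norm_mul, Real.norm_of_nonneg hK0.le, Real.norm_eq_abs] at hb
  have hpi : Real.sqrt (Real.pi / (η ^ 2 / 4)) ≤ 2 * K := by
    rw [show Real.pi / (η ^ 2 / 4) = 4 * Real.pi / η ^ 2 by field_simp, Real.sqrt_div (by positivity), Real.sqrt_sq hη.le, hK,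
      ← mul_div_assoc]
    gcongr
    rw [Real.sqrt_le_left (by positivity), mul_pow, Real.sq_sqrt (by positivity)]
    nlinarith [Real.pi_pos]
  have h2 : K * |∑' n, a n * gw η L n| ≤ K * (10 * C / η ^ 2) := by
    refine hb.trans ?_
    calc _ ≤ 5 * C / η ^ 2 * (2 * K) := by gcongr
      _ = _ := by ring
  exact le_of_mul_le_mul_left h2 hK0

end TLI


namespace TLI
open ArithmeticFunction (vonMangoldt)

lemma ev_small (K : ℝ) (m : ℕ) : ∀ᶠ L : ℝ in Filter.atTop, K * (L ^ m * Real.exp (-(L / 2))) ≤ 1 := by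
  have h := (Real.tendsto_pow_mul_exp_neg_atTop_nhds_zero m).comp
    (Filter.tendsto_id.atTop_div_const (by norm_num : (0 : ℝ) < 2))
  have h2 := h.const_mul (K * 2 ^ m)
  rw [mul_zero] at h2
  filter_upwards [h2.eventually_le_const (by norm_num : (0 : ℝ) < 1)] with L hL
  simp only [Function.comp, id] at hL
  calc _ = K * 2 ^ m * ((L / 2) ^ m * Real.exp (-(L / 2))) := by
        rw [div_pow]; field_simp
    _ ≤ 1 := hL

/-- coefficient -/
noncomputable def cc (k : ℕ) (L : ℝ) (n : ℕ) : ℝ := Real.log n ^ k * (n : ℝ) ^ (-(1 + 1 / L))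

lemma cc_nonneg (k : ℕ) (L : ℝ) (n : ℕ) : 0 ≤ cc k L n := by
  have := Real.log_natCast_nonneg n
  unfold cc; positivity

lemma summ_one (k : ℕ) {L : ℝ} (hL : 1 ≤ L) (η : ℝ) : Summable (fun n => cc k L n * gw η L n) := by
  refine Summable.of_nonneg_of_le (fun n => mul_nonneg (cc_nonneg k L n) (gw_pos η L n).le) (fun n => ?_) (summ_coef k hL)
  have := ArithmeticFunction.vonMangoldt_nonneg (n := n)
  have h1 := cc_nonneg k L n
  have h2 := gw_le_one η L n
  have h3 := gw_pos η L n
  change _ ≤ (vonMangoldt n + 1) * cc k L n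
  nlinarith

lemma summ_lam (k : ℕ) {L : ℝ} (hL : 1 ≤ L) (η : ℝ) : Summable (fun n => vonMangoldt n * cc k L n * gw η L n) := by
  have h0 := fun n => ArithmeticFunction.vonMangoldt_nonneg (n := n)
  refine Summable.of_nonneg_of_le (fun n => mul_nonneg (mul_nonneg (h0 n) (cc_nonneg k L n)) (gw_pos η L n).le) (fun n => ?_) (summ_coef k hL)
  have h1 := cc_nonneg k L n
  have h2 := gw_le_one η L n
  have h3 := gw_pos η L n
  change _ ≤ (vonMangoldt n + 1) * cc k L n
  have := mul_nonneg (h0 n) h1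
  nlinarith

lemma main_lower (k : ℕ) {L η : ℝ} (hL : 1 ≤ L) (hη : 0 < η) (hη1 : η ≤ 1) (hx : 2 ≤ Real.exp L * η) :
    Real.exp (-4) / 2 * (η * L ^ k) ≤ ∑' n, cc k L n * gw η L n := by
  set x := Real.exp L with hxdef
  have hx0 : 0 < x := Real.exp_pos _
  have hle : x ≤ x * Real.exp η := by nlinarith [Real.add_one_le_exp η]
  set I : Finset ℕ := Finset.Ioc ⌊x⌋₊ ⌊x * Real.exp η⌋₊ with hI
  refine le_trans ?_ ((summ_one k hL η).sum_le_tsum I (fun n _ => mul_nonneg (cc_nonneg k L n) (gw_pos η L n).le))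
  have hcard : x * η / 2 ≤ (I.card : ℝ) := by
    rw [hI, Nat.card_Ioc, Nat.cast_sub (Nat.floor_le_floor hle)]
    have h1 := Nat.lt_floor_add_one (x * Real.exp η)
    have h2 := Nat.floor_le hx0.le
    have h3 : x * (η + 1) ≤ x * Real.exp η := by gcongr; exact Real.add_one_le_exp η
    linarith
  have hterm : ∀ n ∈ I, L ^ k * (Real.exp (-4) / x) ≤ cc k L n * gw η L n := by
    intro n hn
    obtain ⟨hn1, hn2⟩ := Finset.mem_Ioc.1 hn
    have hn1' : x < n := (Nat.floor_lt hx0.le).1 hn1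
    have hn2' : (n : ℝ) ≤ x * Real.exp η := (Nat.le_floor_iff (by positivity)).1 hn2
    have hn0 : (0 : ℝ) < n := hx0.trans hn1'
    have hl1 : L ≤ Real.log n := by
      rw [Real.le_log_iff_exp_le hn0]; exact hn1'.le
    have hl2 : Real.log n ≤ L + η := by
      rw [Real.log_le_iff_le_exp hn0, Real.exp_add]; exact hn2'
    have g : Real.exp (-1) ≤ gw η L n := by
      unfold gw
      apply Real.exp_le_exp.2
      rw [le_div_iff₀ (by positivity)]
      have : (Real.log n - L) ^ 2 ≤ η ^ 2 := by
        apply pow_le_pow_left₀ <;> linarith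
      nlinarith
    have p : Real.exp (-3) / x ≤ (n : ℝ) ^ (-(1 + 1 / L)) := by
      rw [hxdef, ← Real.exp_sub, Real.rpow_def_of_pos hn0]
      apply Real.exp_le_exp.2
      have h1L : 0 ≤ 1 / L := by positivity
      have h2L : 1 / L ≤ 1 := by rw [div_le_iff₀ (by linarith)]; linarith
      have h3L : 1 / L * L = 1 := by field_simp
      have : Real.log n * (1 + 1 / L) ≤ (L + η) * (1 + 1 / L) := by gcongr
      nlinarith
    have e4 : Real.exp (-4) / x = Real.exp (-3) / x * Real.exp (-1) := by
      rw [div_mul_eq_mul_div, ← Real.exp_add]; norm_num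
    rw [e4, ← mul_assoc]
    unfold cc
    gcongr
  have hs := Finset.card_nsmul_le_sum I _ _ hterm
  rw [nsmul_eq_mul] at hs
  refine le_trans ?_ hs
  calc Real.exp (-4) / 2 * (η * L ^ k) = (x * η / 2) * (L ^ k * (Real.exp (-4) / x)) := by field_simp
    _ ≤ _ := by gcongr

lemma main_upper (k : ℕ) : ∃ M : ℝ, 0 ≤ M ∧ ∀ L η : ℝ, 1 ≤ L → 0 < η → η * L ≤ 1 →
    ∑' n, vonMangoldt n * cc k L n * gw η L n ≤
      (2 * L) ^ k * (3 / Real.exp L) * ∑ n ∈ (Finset.range (⌊3 * Real.exp L⌋₊ + 1)).filter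
        (fun n : ℕ => |Real.log n - L| ≤ η * L), vonMangoldt n + M * L ^ (k + 2) * Real.exp (-(L / 2)) := by
  obtain ⟨M, hM1, hM⟩ := sum_half
  refine ⟨(k + 1).factorial * 2 ^ (k + 1) * M, by positivity, fun L η hL hη hηL => ?_⟩
  set x := Real.exp L with hxdef
  have hx0 : 0 < x := Real.exp_pos _
  set W := (Finset.range (⌊3 * x⌋₊ + 1)).filter (fun n : ℕ => |Real.log n - L| ≤ η * L) with hW
  have h0 := fun n => ArithmeticFunction.vonMangoldt_nonneg (n := n)
  set f1 : ℕ → ℝ := fun n => if n ∈ W then (2 * L) ^ k * (3 / x) * vonMangoldt n else 0 with hf1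
  set f2 : ℕ → ℝ := fun n => Real.exp (-(L / 2)) * ((k + 1).factorial * (2 * L) ^ (k + 1)) * (n : ℝ) ^ (-(1 + 1 / (2 * L))) with hf2
  have hs1 : HasSum f1 (∑ n ∈ W, (2 * L) ^ k * (3 / x) * vonMangoldt n) := by
    have : HasSum f1 (∑ n ∈ W, f1 n) := hasSum_sum_of_ne_finset_zero (fun n hn => by simp [hf1, hn])
    convert this using 1
    exact Finset.sum_congr rfl (fun n hn => by simp [hf1, hn])
  have hs2 : Summable f2 := (summ_half hL).mul_left _
  have hb : ∀ n, vonMangoldt n * cc k L n * gw η L n ≤ f1 n + f2 n := by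
    intro n
    have hf2n : 0 ≤ f2 n := by rw [hf2]; positivity
    by_cases hn : n ∈ W
    · have : f1 n = (2 * L) ^ k * (3 / x) * vonMangoldt n := by simp [hf1, hn]
      rw [this]
      have hnW := (Finset.mem_filter.1 hn).2
      rcases Nat.eq_zero_or_pos n with rfl | hn0
      · simp; exact hf2n
      have hn0' : (0 : ℝ) < n := by exact_mod_cast hn0
      have hab := abs_le.1 hnW
      have hl : Real.log n ≤ 2 * L := by linarith
      have hl0 := Real.log_natCast_nonneg n
      have hnl : x * Real.exp (-1) ≤ n := by
        rw [hxdef, ← Real.exp_add, ← Real.le_log_iff_exp_le hn0']; linarith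
      have hcc : cc k L n ≤ (2 * L) ^ k * (3 / x) := by
        unfold cc
        gcongr
        calc (n : ℝ) ^ (-(1 + 1 / L)) ≤ (n : ℝ) ^ (-1 : ℝ) := by
              apply Real.rpow_le_rpow_of_exponent_le (by exact_mod_cast hn0)
              have : 0 ≤ 1 / L := by positivity
              linarith
          _ = 1 / n := by rw [Real.rpow_neg_one, one_div]
          _ ≤ 1 / (x * Real.exp (-1)) := by gcongr
          _ = Real.exp 1 / x := by rw [Real.exp_neg]; field_simp
          _ ≤ 3 / x := by gcongr; exact Real.exp_one_lt_three.le
      have h1 := cc_nonneg k L n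
      have h2 := gw_le_one η L n
      have h3 := gw_pos η L n
      have e1 : vonMangoldt n * cc k L n ≤ vonMangoldt n * ((2 * L) ^ k * (3 / x)) := by gcongr
      have e2 := mul_nonneg (h0 n) h1
      nlinarith
    · have : f1 n = 0 := by simp [hf1, hn]
      rw [this, zero_add]
      rcases Nat.eq_zero_or_pos n with rfl | hn0
      · simp; exact hf2n
      have hn0' : (0 : ℝ) < n := by exact_mod_cast hn0
      have hfar : η * L < |Real.log n - L| := by
        by_contra hc
        push Not at hc
        apply hn
        rw [hW, Finset.mem_filter, Finset.mem_range, Nat.lt_succ_iff]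
        refine ⟨?_, hc⟩
        apply Nat.le_floor
        have hab := abs_le.1 hc
        have : (n : ℝ) ≤ Real.exp (L + 1) := by
          rw [← Real.log_le_iff_le_exp hn0']; linarith
        rw [Real.exp_add] at this
        have h3 := Real.exp_one_lt_three.le
        nlinarith
      have hg : gw η L n ≤ Real.exp (-(L / 2)) := by
        unfold gw
        apply Real.exp_le_exp.2
        rw [div_le_iff₀ (by positivity)]
        have : (η * L) ^ 2 ≤ (Real.log n - L) ^ 2 := by
          rw [← sq_abs (Real.log n - L)]
          apply pow_le_pow_left₀ (by positivity) hfar.le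
        have : η ^ 2 * L ≤ η ^ 2 * L ^ 2 := by
          gcongr; nlinarith
        nlinarith
      have hl0 := Real.log_natCast_nonneg n
      have e1 : vonMangoldt n * cc k L n ≤ Real.log n ^ (k + 1) * (n : ℝ) ^ (-(1 + 1 / L)) := by
        rw [pow_succ, cc]
        have : vonMangoldt n ≤ Real.log n := ArithmeticFunction.vonMangoldt_le_log
        calc _ ≤ Real.log n * (Real.log n ^ k * (n : ℝ) ^ (-(1 + 1 / L))) := by gcongr
          _ = _ := by ring
      have e2 := e1.trans (logpow_bound (k + 1) hL n)
      calc _ ≤ ((k + 1).factorial * (2 * L) ^ (k + 1) * (n : ℝ) ^ (-(1 + 1 / (2 * L)))) * Real.exp (-(L / 2)) := by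
            apply mul_le_mul e2 hg (gw_pos _ _ _).le (by positivity)
        _ = _ := by rw [hf2]; ring
  refine (Summable.tsum_le_tsum hb (summ_lam k hL η) (hs1.summable.add hs2)).trans ?_
  rw [hs1.summable.tsum_add hs2, hs1.tsum_eq, ← Finset.mul_sum]
  gcongr
  rw [hf2, tsum_mul_left]
  calc _ ≤ Real.exp (-(L / 2)) * ((k + 1).factorial * (2 * L) ^ (k + 1)) * (M * L) := by
        gcongr; exact hM L hL
    _ = _ := by rw [mul_pow]; ring

/-- primes in a short logarithmic window -/
noncomputable def Wd (A : ℕ) (x : ℝ) : Finset ℕ :=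
  (Finset.range (⌊3 * x⌋₊ + 1)).filter (fun p => p.Prime ∧ |Real.log p - Real.log x| ≤ 1 / Real.log x ^ A)

lemma psi_sub_theta_filter (y : ℝ) (Q : ℕ → Prop) [DecidablePred Q] :
    ∑ n ∈ (Finset.range (⌊y⌋₊ + 1)).filter Q, vonMangoldt n ≤
      ∑ n ∈ (Finset.range (⌊y⌋₊ + 1)).filter (fun p => p.Prime ∧ Q p), Real.log n + (Chebyshev.psi y - Chebyshev.theta y) := by
  have h0 := fun n => ArithmeticFunction.vonMangoldt_nonneg (n := n)
  have hr : Finset.range (⌊y⌋₊ + 1) = insert 0 (Finset.Ioc 0 ⌊y⌋₊) := by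
    ext n; simp
  have hpsi : Chebyshev.psi y = ∑ n ∈ Finset.range (⌊y⌋₊ + 1), vonMangoldt n := by
    rw [hr, Finset.sum_insert (by simp)]; simp [Chebyshev.psi]
  have hth : Chebyshev.theta y = ∑ n ∈ (Finset.range (⌊y⌋₊ + 1)).filter Nat.Prime, vonMangoldt n := by
    rw [hr, Finset.filter_insert, if_neg (by decide)]
    unfold Chebyshev.theta
    exact Finset.sum_congr rfl (fun p hp => (ArithmeticFunction.vonMangoldt_apply_prime (Finset.mem_filter.1 hp).2).symm)
  have e1 : ∑ n ∈ (Finset.range (⌊y⌋₊ + 1)).filter (fun p => p.Prime ∧ Q p), Real.log n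
      = ∑ n ∈ (Finset.range (⌊y⌋₊ + 1)).filter (fun p => p.Prime ∧ Q p), vonMangoldt n :=
    Finset.sum_congr rfl (fun p hp => (ArithmeticFunction.vonMangoldt_apply_prime (Finset.mem_filter.1 hp).2.1).symm)
  rw [e1, hpsi, hth, Finset.sum_filter, Finset.sum_filter, Finset.sum_filter, ← Finset.sum_sub_distrib, ← Finset.sum_add_distrib]
  refine Finset.sum_le_sum (fun n _ => ?_)
  have := h0 n
  by_cases h1 : n.Prime <;> by_cases h2 : Q n <;> simp [h1, h2, this]

lemma prime_window (A : ℕ) : ∃ x0 : ℝ, ∀ x ≥ x0, x / Real.log x ^ (A + 2) ≤ ∑ p ∈ Wd A x, Real.log p := by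
  set k : ℕ := 3 * A + 4 with hk
  obtain ⟨C, hC0, hC⟩ := smooth_err k
  obtain ⟨M, hM0, hM⟩ := main_upper k
  have hev : ∀ᶠ x : ℝ in Filter.atTop, x / Real.log x ^ (A + 2) ≤ ∑ p ∈ Wd A x, Real.log p := by
    have hlog := Real.tendsto_log_atTop
    filter_upwards [hlog.eventually (ev_small 2 (A + 1)), hlog.eventually (ev_small M (k + 2)),
      hlog.eventually (ev_small (36 * 2 ^ k) (k + 1)), hlog.eventually_ge_atTop 1,
      hlog.eventually_gt_atTop (2 * Real.exp 4 * (C + 3 * 2 ^ k + 2)), Filter.eventually_ge_atTop 1]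
      with x h1 h2 h3 hL hbig hx1
    have hx0 : 0 < x := by linarith
    set L := Real.log x with hLdef
    have hxe : Real.exp L = x := Real.exp_log hx0
    have hL0 : 0 < L := by linarith
    set η : ℝ := 1 / L ^ (A + 1) with hη
    have hη0 : 0 < η := by positivity
    have hη1 : η ≤ 1 := by
      rw [hη, div_le_one (by positivity)]; exact one_le_pow₀ hL
    have hηL : η * L = 1 / L ^ A := by rw [hη, pow_succ]; field_simp
    have hηL1 : η * L ≤ 1 := by
      rw [hηL, div_le_one (by positivity)]; exact one_le_pow₀ hL
    have hexph : Real.exp (-(L / 2)) * Real.exp (-(L / 2)) = 1 / x := by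
      rw [← hxe, one_div, ← Real.exp_neg, ← Real.exp_add]; congr 1; ring
    have heh0 : 0 < Real.exp (-(L / 2)) := Real.exp_pos _
    have heh1 : Real.exp (-(L / 2)) ≤ 1 := by rw [Real.exp_le_one_iff]; linarith
    have hxη : 2 ≤ Real.exp L * η := by
      rw [hxe, hη, mul_one_div, le_div_iff₀ (by positivity)]
      have h4 : 2 * (L ^ (A + 1) * (1 / x)) ≤ 1 := by
        rw [← hexph]
        refine le_trans ?_ h1
        gcongr
        nlinarith
      rw [mul_one_div, mul_div_assoc', div_le_iff₀ hx0] at h4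
      linarith
    have b1 := main_lower k hL hη0 hη1 hxη
    have b2 := hC L η hL hη0 hη1
    have b3 := hM L η hL hη0 hηL1
    have hsub : ∑' n : ℕ, (vonMangoldt n - 1) * (Real.log n ^ k * (n : ℝ) ^ (-(1 + 1 / L))) * gw η L n
        = ∑' n, vonMangoldt n * cc k L n * gw η L n - ∑' n, cc k L n * gw η L n := by
      rw [← (summ_lam k hL η).tsum_sub (summ_one k hL η)]
      refine tsum_congr (fun n => ?_)
      rw [cc]; ring
    rw [hsub] at b2
    have b2' := (abs_le.1 b2).1
    rw [hxe] at b3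
    have b4 := psi_sub_theta_filter (3 * x) (fun n : ℕ => |Real.log n - L| ≤ η * L)
    have b5 := Chebyshev.psi_sub_theta_le (x := 3 * x) (by linarith)
    have hWd : (Finset.range (⌊3 * x⌋₊ + 1)).filter (fun p : ℕ => p.Prime ∧ |Real.log p - L| ≤ η * L) = Wd A x := by
      rw [hηL]; rfl
    rw [hWd] at b4
    set S := ∑ p ∈ Wd A x, Real.log p with hS
    by_contra hcon
    push Not at hcon
    have hsq : √(3 * x) ≤ 2 * (x * Real.exp (-(L / 2))) := by
      rw [Real.sqrt_le_left (by positivity), mul_pow, mul_pow, sq (Real.exp (-(L / 2))), hexph]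
      field_simp
      linarith
    have hlog3 : Real.log (3 * x) ≤ 3 * L := by
      rw [Real.log_mul (by norm_num) hx0.ne']
      have : Real.log 3 ≤ 3 - 1 := Real.log_le_sub_one_of_pos (by norm_num)
      linarith
    have hlog30 : 0 ≤ Real.log (3 * x) := Real.log_nonneg (by linarith)
    have b6 : 2 * √(3 * x) * Real.log (3 * x) ≤ 2 * (2 * (x * Real.exp (-(L / 2)))) * (3 * L) := by gcongr
    have b7 : (2 * L) ^ k * (3 / x) * ∑ n ∈ (Finset.range (⌊3 * x⌋₊ + 1)).filter (fun n : ℕ => |Real.log n - L| ≤ η * L), vonMangoldt n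
        ≤ (2 * L) ^ k * (3 / x) * (x / L ^ (A + 2) + 2 * (2 * (x * Real.exp (-(L / 2)))) * (3 * L)) := by
      gcongr
      linarith
    have e8 : (2 * L) ^ k * (3 / x) * (x / L ^ (A + 2) + 2 * (2 * (x * Real.exp (-(L / 2)))) * (3 * L))
        = 3 * 2 ^ k * L ^ (2 * A + 2) + 36 * 2 ^ k * (L ^ (k + 1) * Real.exp (-(L / 2))) := by
      rw [mul_pow, pow_succ L k]
      have : L ^ k = L ^ (2 * A + 2) * L ^ (A + 2) := by rw [← pow_add]; congr 1; omega
      field_simp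
      rw [this]
      ring
    have e9 : η * L ^ k = L ^ (2 * A + 2) * L := by
      rw [hη]
      have : L ^ k = L ^ (2 * A + 2) * L * L ^ (A + 1) := by rw [← pow_succ, ← pow_add]; congr 1; omega
      rw [this]; field_simp
    have e10 : C / η ^ 2 = C * L ^ (2 * A + 2) := by
      rw [hη, div_pow, one_pow, div_div_eq_mul_div, div_one, ← pow_mul]
      congr 2; ring
    rw [e10] at b2'
    rw [e9] at b1
    have hP : 1 ≤ L ^ (2 * A + 2) := one_le_pow₀ hL
    rw [mul_assoc] at b3
    have hfin : Real.exp (-4) / 2 * (L ^ (2 * A + 2) * L) ≤ (C + 3 * 2 ^ k + 2) * L ^ (2 * A + 2) := by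
      linarith
    have hfin2 : Real.exp (-4) / 2 * L ≤ (C + 3 * 2 ^ k + 2) := by
      have hP0 : 0 < L ^ (2 * A + 2) := by linarith
      refine le_of_mul_le_mul_right ?_ hP0
      calc _ = Real.exp (-4) / 2 * (L ^ (2 * A + 2) * L) := by ring
        _ ≤ _ := hfin
    have he : Real.exp 4 * Real.exp (-4) = 1 := by rw [← Real.exp_add]; norm_num
    have : 2 * Real.exp 4 * (Real.exp (-4) / 2 * L) ≤ 2 * Real.exp 4 * (C + 3 * 2 ^ k + 2) := by gcongr
    have e11 : 2 * Real.exp 4 * (Real.exp (-4) / 2 * L) = (Real.exp 4 * Real.exp (-4)) * L := by ring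
    rw [e11, he] at this
    linarith
  obtain ⟨x0, hx0⟩ := Filter.eventually_atTop.1 hev
  exact ⟨x0, hx0⟩

end TLI


namespace TLI

lemma ee_cont : Continuous ee := by unfold ee; fun_prop

lemma gaussint {b : ℝ} (hb : 0 < b) (v : ℝ) :
    ∫ t : ℝ, ee (t * v) * (Real.exp (-Real.pi * b ^ 2 * t ^ 2) : ℂ) =
      ((1 / b * Real.exp (-Real.pi * v ^ 2 / b ^ 2) : ℝ) : ℂ) := by
  have hpi := Real.pi_pos
  have hsq : Real.sqrt (2 * Real.pi) ^ 2 = 2 * Real.pi := Real.sq_sqrt (by positivity)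
  have hs0 : 0 < Real.sqrt (2 * Real.pi) := by positivity
  have h := gauss_fourier (η := Real.sqrt (2 * Real.pi) * b) (by positivity) (2 * Real.pi * v)
  have e1 : (fun t : ℝ => ee (t * v) * (Real.exp (-Real.pi * b ^ 2 * t ^ 2) : ℂ)) =
      fun u : ℝ => Complex.exp (Complex.I * ((2 * Real.pi * v : ℝ) : ℂ) * u) *
        Complex.exp (-(((Real.sqrt (2 * Real.pi) * b) ^ 2 / 2 : ℝ) : ℂ) * (u : ℂ) ^ 2) := by
    ext t
    rw [mul_pow, hsq, ee, Complex.ofReal_exp]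
    congr 2
    · push_cast; ring
    · push_cast; ring
  rw [e1, h]
  congr 1
  rw [mul_pow (Real.sqrt (2 * Real.pi)) b, hsq]
  congr 1
  · field_simp
  · congr 1; field_simp

lemma gauss_integrable {b : ℝ} (hb : 0 < b) : MeasureTheory.Integrable (fun t : ℝ => Real.exp (-Real.pi * b ^ 2 * t ^ 2)) := by
  have hpi := Real.pi_pos
  have := integrable_exp_neg_mul_sq (b := Real.pi * b ^ 2) (by positivity)
  simpa [neg_mul] using this

lemma gauss_integral {b : ℝ} (hb : 0 < b) : ∫ t : ℝ, Real.exp (-Real.pi * b ^ 2 * t ^ 2) = 1 / b := by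
  have h := gaussint hb 0
  simp only [mul_zero, ee_zero, one_mul, ne_eq, OfNat.ofNat_ne_zero, not_false_eq_true, zero_pow, zero_div, Real.exp_zero, mul_one] at h
  rw [integral_complex_ofReal] at h
  exact_mod_cast h

lemma ee_gauss_integrable {b : ℝ} (hb : 0 < b) (v : ℝ) :
    MeasureTheory.Integrable (fun t : ℝ => ee (t * v) * (Real.exp (-Real.pi * b ^ 2 * t ^ 2) : ℂ)) := by
  refine MeasureTheory.Integrable.mono' (gauss_integrable hb) ?_ (Filter.Eventually.of_forall (fun t => ?_))
  · apply Continuous.aestronglyMeasurable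
    have := ee_cont
    fun_prop
  · rw [norm_mul, norm_ee, one_mul, Complex.norm_real, Real.norm_of_nonneg (Real.exp_pos _).le]

lemma gsum_integrable {ι : Type*} (s : Finset ι) (c v : ι → ℝ) {b : ℝ} (hb : 0 < b) :
    MeasureTheory.Integrable (fun t : ℝ => (∑ i ∈ s, (c i : ℂ) * ee (t * v i)) * (Real.exp (-Real.pi * b ^ 2 * t ^ 2) : ℂ)) := by
  have e : ∀ t : ℝ, (∑ i ∈ s, (c i : ℂ) * ee (t * v i)) * (Real.exp (-Real.pi * b ^ 2 * t ^ 2) : ℂ) =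
      ∑ i ∈ s, (c i : ℂ) * (ee (t * v i) * (Real.exp (-Real.pi * b ^ 2 * t ^ 2) : ℂ)) := by
    intro t
    rw [Finset.sum_mul]
    exact Finset.sum_congr rfl (fun _ _ => mul_assoc _ _ _)
  simp only [e]
  exact MeasureTheory.integrable_finset_sum s (fun i _ => (ee_gauss_integrable hb (v i)).const_mul _)

lemma gsum {ι : Type*} (s : Finset ι) (c v : ι → ℝ) {b : ℝ} (hb : 0 < b) :
    ∫ t : ℝ, (∑ i ∈ s, (c i : ℂ) * ee (t * v i)) * (Real.exp (-Real.pi * b ^ 2 * t ^ 2) : ℂ) =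
      ((1 / b * ∑ i ∈ s, c i * Real.exp (-Real.pi * v i ^ 2 / b ^ 2) : ℝ) : ℂ) := by
  have e : ∀ t : ℝ, (∑ i ∈ s, (c i : ℂ) * ee (t * v i)) * (Real.exp (-Real.pi * b ^ 2 * t ^ 2) : ℂ) =
      ∑ i ∈ s, (c i : ℂ) * (ee (t * v i) * (Real.exp (-Real.pi * b ^ 2 * t ^ 2) : ℂ)) := by
    intro t
    rw [Finset.sum_mul]
    exact Finset.sum_congr rfl (fun _ _ => mul_assoc _ _ _)
  simp only [e]
  rw [MeasureTheory.integral_finset_sum s (fun i _ => (ee_gauss_integrable hb (v i)).const_mul _)]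
  simp only [MeasureTheory.integral_const_mul, gaussint hb]
  push_cast
  rw [Finset.mul_sum]
  exact Finset.sum_congr rfl (fun i _ => by ring)

/-- the exponential sum over primes in `P` -/
noncomputable def SS (P : Finset ℕ) (t : ℝ) : ℂ := ∑ p ∈ P, (Real.log p : ℂ) * EE t p

lemma SS_cont (P : Finset ℕ) : Continuous (SS P) := by
  unfold SS EE
  have := ee_cont
  fun_prop

lemma SS_neg (P : Finset ℕ) (t : ℝ) : ‖SS P (-t)‖ = ‖SS P t‖ := by
  have : SS P (-t) = (starRingEnd ℂ) (SS P t) := by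
    unfold SS EE
    rw [map_sum]
    refine Finset.sum_congr rfl (fun p _ => ?_)
    rw [map_mul, Complex.conj_ofReal, neg_mul, ee_neg]
  rw [this, RCLike.norm_conj]

lemma SS_abs (P : Finset ℕ) (t : ℝ) : ‖SS P |t|‖ = ‖SS P t‖ := by
  rcases abs_choice t with h | h <;> rw [h]
  exact SS_neg P t

lemma SS_cube (P : Finset ℕ) (N t : ℝ) : SS P t ^ 3 * ee (-(N * t)) =
    ∑ i ∈ P ×ˢ P ×ˢ P, ((Real.log i.1 * Real.log i.2.1 * Real.log i.2.2 : ℝ) : ℂ) *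
      ee (t * (xl i.1 + xl i.2.1 + xl i.2.2 - N)) := by
  rw [Finset.sum_product, pow_three, SS, Finset.sum_mul, Finset.sum_mul]
  refine Finset.sum_congr rfl (fun p _ => ?_)
  rw [Finset.sum_product, Finset.sum_mul, Finset.mul_sum, Finset.sum_mul]
  refine Finset.sum_congr rfl (fun q _ => ?_)
  rw [Finset.mul_sum, Finset.mul_sum, Finset.sum_mul]
  refine Finset.sum_congr rfl (fun r _ => ?_)
  rw [show t * (xl p + xl q + xl r - N) = t * xl p + (t * xl q + (t * xl r + -(N * t))) by ring, ee_add, ee_add, ee_add]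
  unfold EE
  push_cast
  ring

lemma SS_sq (P : Finset ℕ) (t : ℝ) : ((‖SS P t‖ ^ 2 : ℝ) : ℂ) =
    ∑ i ∈ P ×ˢ P, ((Real.log i.1 * Real.log i.2 : ℝ) : ℂ) * ee (t * (xl i.1 - xl i.2)) := by
  have h : ((‖SS P t‖ ^ 2 : ℝ) : ℂ) = SS P t * (starRingEnd ℂ) (SS P t) := by
    rw [Complex.mul_conj, Complex.normSq_eq_norm_sq]
  rw [h, Finset.sum_product]
  unfold SS
  rw [map_sum, Finset.sum_mul]
  refine Finset.sum_congr rfl (fun p _ => ?_)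
  rw [Finset.mul_sum]
  refine Finset.sum_congr rfl (fun q _ => ?_)
  rw [map_mul, Complex.conj_ofReal, show t * (xl p - xl q) = t * xl p + -(t * xl q) by ring, ee_add, ee_neg]
  unfold EE
  push_cast
  ring

lemma xl_gap {p q : ℝ} (hp : 1 ≤ p) (hpq : p ≤ q) : q - p ≤ xl q - xl p := by
  have hp0 : 0 < p := by linarith
  have hq0 : 0 < q := by linarith
  have h1 : 1 - (q / p)⁻¹ ≤ Real.log (q / p) := Real.one_sub_inv_le_log_of_pos (by positivity)
  rw [Real.log_div hq0.ne' hp0.ne', inv_div] at h1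
  have h2 : q * (1 - p / q) ≤ q * (Real.log q - Real.log p) := by gcongr
  have h3 : q * (1 - p / q) = q - p := by field_simp
  have h4 : 0 ≤ Real.log p := Real.log_nonneg hp
  unfold xl
  nlinarith

lemma xl_gap_abs {p q : ℕ} (hp : 1 ≤ p) (hq : 1 ≤ q) : |(p : ℝ) - q| ≤ |xl p - xl q| := by
  have hp' : (1 : ℝ) ≤ p := by exact_mod_cast hp
  have hq' : (1 : ℝ) ≤ q := by exact_mod_cast hq
  rcases le_total (p : ℝ) q with h | h
  · have := xl_gap hp' h
    rw [abs_of_nonpos (by linarith), abs_of_nonpos (by linarith)]; linarith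
  · have := xl_gap hq' h
    rw [abs_of_nonneg (by linarith), abs_of_nonneg (by linarith)]; linarith

lemma geom_near (P : Finset ℕ) (p : ℕ) : ∑ q ∈ P, ((1 / 2 : ℝ) ^ (p - q) * (1 / 2 : ℝ) ^ (q - p)) ≤ 4 := by
  have hts : ∀ s : Finset ℕ, ∑ m ∈ s, (1 / 2 : ℝ) ^ m ≤ 2 := by
    intro s
    have := summable_geometric_two.sum_le_tsum s (fun n _ => by positivity)
    rwa [tsum_geometric_two] at this
  rw [← Finset.sum_filter_add_sum_filter_not P (fun q => q ≤ p)]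
  have h1 : ∑ q ∈ P.filter (fun q => q ≤ p), ((1 / 2 : ℝ) ^ (p - q) * (1 / 2 : ℝ) ^ (q - p)) ≤ 2 := by
    refine le_trans (le_of_eq ?_) (hts ((P.filter (fun q => q ≤ p)).image (fun q => p - q)))
    rw [Finset.sum_image]
    · refine Finset.sum_congr rfl (fun q hq => ?_)
      have := (Finset.mem_filter.1 hq).2
      rw [Nat.sub_eq_zero_of_le this, pow_zero, mul_one]
    · intro a ha b hb hab
      have h1 := (Finset.mem_filter.1 ha).2
      have h2 := (Finset.mem_filter.1 hb).2
      simp only at hab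
      omega
  have h2 : ∑ q ∈ P.filter (fun q => ¬ q ≤ p), ((1 / 2 : ℝ) ^ (p - q) * (1 / 2 : ℝ) ^ (q - p)) ≤ 2 := by
    refine le_trans (le_of_eq ?_) (hts ((P.filter (fun q => ¬ q ≤ p)).image (fun q => q - p)))
    rw [Finset.sum_image]
    · refine Finset.sum_congr rfl (fun q hq => ?_)
      have := (Finset.mem_filter.1 hq).2
      rw [Nat.sub_eq_zero_of_le (by omega : p ≤ q), pow_zero, one_mul]
    · intro a ha b hb hab
      have h1 := (Finset.mem_filter.1 ha).2
      have h2 := (Finset.mem_filter.1 hb).2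
      simp only at hab
      omega
  linarith

lemma exp_near {b : ℝ} (hb : 0 < b) (hb1 : b ≤ 1) {p q : ℕ} (hp : 1 ≤ p) (hq : 1 ≤ q) :
    Real.exp (-Real.pi * (xl p - xl q) ^ 2 / b ^ 2) ≤ (1 / 2 : ℝ) ^ (p - q) * (1 / 2 : ℝ) ^ (q - p) := by
  have hg := xl_gap_abs hp hq
  have hpi := Real.pi_gt_three
  set m : ℕ := (p - q) + (q - p) with hm
  have hmabs : |(p : ℝ) - q| = m := by
    rcases le_total p q with h | h
    · have h' : (p : ℝ) ≤ q := by exact_mod_cast h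
      rw [abs_of_nonpos (by linarith), hm, Nat.sub_eq_zero_of_le h, zero_add, Nat.cast_sub h]; ring
    · have h' : (q : ℝ) ≤ p := by exact_mod_cast h
      rw [abs_of_nonneg (by linarith), hm, Nat.sub_eq_zero_of_le h, add_zero, Nat.cast_sub h]
  rw [← pow_add, ← hm]
  have h1 : (m : ℝ) ^ 2 ≤ (xl p - xl q) ^ 2 := by
    rw [← sq_abs (xl p - xl q), ← hmabs]
    exact pow_le_pow_left₀ (abs_nonneg _) hg 2
  have hmm : (m : ℝ) ≤ (m : ℝ) ^ 2 := by
    rcases Nat.eq_zero_or_pos m with h | h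
    · rw [h]; simp
    · have : (1 : ℝ) ≤ m := by exact_mod_cast h
      nlinarith
  have h2 : (1 / 2 : ℝ) ^ m = Real.exp (-(m * Real.log 2)) := by
    rw [Real.exp_neg, Real.exp_nat_mul, Real.exp_log (by norm_num), one_div, inv_pow]
  rw [h2]
  apply Real.exp_le_exp.2
  rw [div_le_iff₀ (by positivity)]
  have hl2 : Real.log 2 ≤ 1 := by linarith [Real.log_two_lt_d9]
  have hl0 : 0 ≤ Real.log 2 := Real.log_nonneg (by norm_num)
  have hb2 : b ^ 2 ≤ 1 := by nlinarith
  have h3 : (m : ℝ) * Real.log 2 * b ^ 2 ≤ m := by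
    have h4 : (m : ℝ) * Real.log 2 ≤ m * 1 := by gcongr
    have h5 : (m : ℝ) * Real.log 2 * b ^ 2 ≤ (m * 1) * 1 := by gcongr
    linarith
  nlinarith [sq_nonneg (xl p - xl q)]

lemma second_moment (P : Finset ℕ) {L b : ℝ} (hP : ∀ p ∈ P, 1 ≤ p ∧ Real.log p ≤ L) (hb : 0 < b) (hb1 : b ≤ 1) :
    MeasureTheory.Integrable (fun t : ℝ => ‖SS P t‖ ^ 2 * Real.exp (-Real.pi * b ^ 2 * t ^ 2)) ∧
    ∫ t : ℝ, ‖SS P t‖ ^ 2 * Real.exp (-Real.pi * b ^ 2 * t ^ 2) ≤ 4 * P.card * L ^ 2 / b := by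
  have e : ∀ t : ℝ, ((‖SS P t‖ ^ 2 * Real.exp (-Real.pi * b ^ 2 * t ^ 2) : ℝ) : ℂ) =
    (∑ i ∈ P ×ˢ P, ((Real.log i.1 * Real.log i.2 : ℝ) : ℂ) * ee (t * (xl i.1 - xl i.2))) * (Real.exp (-Real.pi * b ^ 2 * t ^ 2) : ℂ) := by
    intro t
    rw [← SS_sq]; push_cast; rfl
  constructor
  · have h := gsum_integrable (P ×ˢ P) (fun i => Real.log i.1 * Real.log i.2) (fun i => xl i.1 - xl i.2) hb
    have h2 := h.re
    refine h2.congr (Filter.Eventually.of_forall (fun t => ?_))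
    simp only
    rw [← e]
    exact Complex.ofReal_re _
  · have h := gsum (P ×ˢ P) (fun i => Real.log i.1 * Real.log i.2) (fun i => xl i.1 - xl i.2) hb
    simp only [← e] at h
    rw [integral_complex_ofReal] at h
    have h' := Complex.ofReal_injective h
    rw [h', Finset.sum_product, one_div, inv_mul_eq_div]
    gcongr
    have hin : ∀ p ∈ P, ∑ q ∈ P, Real.log p * Real.log q * Real.exp (-Real.pi * (xl p - xl q) ^ 2 / b ^ 2) ≤ L ^ 2 * 4 := by
      intro p hp
      refine le_trans ?_ (mul_le_mul_of_nonneg_left (geom_near P p) (sq_nonneg L))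
      rw [Finset.mul_sum]
      refine Finset.sum_le_sum (fun q hq => ?_)
      have l1 := Real.log_natCast_nonneg p
      have l2 := Real.log_natCast_nonneg q
      have l3 := (hP p hp).2
      have l4 := (hP q hq).2
      rw [sq L]
      have := exp_near hb hb1 (hP p hp).1 (hP q hq).1
      have hL0 : 0 ≤ L := l1.trans l3
      apply mul_le_mul _ this (Real.exp_pos _).le (by positivity)
      exact mul_le_mul l3 l4 l2 hL0
    refine (Finset.sum_le_card_nsmul P _ _ hin).trans (le_of_eq ?_)
    rw [nsmul_eq_mul]; ring

end TLI


namespace TLI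
open ArithmeticFunction (vonMangoldt)

/-- primes in `(X/2, X]` -/
noncomputable def PP (X : ℝ) : Finset ℕ := (JJ X 1).filter Nat.Prime

lemma mem_PP {X : ℝ} (hX : 0 ≤ X) (p : ℕ) : p ∈ PP X ↔ p.Prime ∧ X / 2 < p ∧ (p : ℝ) ≤ X := by
  unfold PP
  rw [Finset.mem_filter, mem_JJ hX one_pos]
  simp; tauto

lemma PP_sub_range {X : ℝ} (hX : 0 ≤ X) : JJ X 1 ⊆ Finset.range (⌊X⌋₊ + 1) := by
  intro n hn
  rw [mem_JJ hX one_pos] at hn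
  have h := hn.2
  simp at h
  rw [Finset.mem_range]
  have := Nat.le_floor h
  omega

lemma PP_log {X : ℝ} (hX : 1 ≤ X) : ∀ p ∈ PP X, 1 ≤ p ∧ Real.log p ≤ Real.log X := by
  intro p hp
  rw [mem_PP (by linarith)] at hp
  have h1 := hp.1.pos
  have h1' : (0 : ℝ) < p := by exact_mod_cast h1
  exact ⟨h1, Real.log_le_log h1' hp.2.2⟩

lemma PP_card {X : ℝ} (hX : 1 ≤ X) : ((PP X).card : ℝ) ≤ X := by
  have h : PP X ⊆ Finset.Icc 1 ⌊X⌋₊ := by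
    intro p hp
    have h1 := PP_log hX p hp
    rw [mem_PP (by linarith)] at hp
    rw [Finset.mem_Icc]
    exact ⟨h1.1, Nat.le_floor hp.2.2⟩
  have h2 := Finset.card_le_card h
  rw [Nat.card_Icc] at h2
  have h3 : ((PP X).card : ℝ) ≤ (⌊X⌋₊ : ℝ) := by exact_mod_cast (by omega)
  exact h3.trans (Nat.floor_le (by linarith))

lemma PP_sum_log {X : ℝ} (hX : 1 ≤ X) : ∑ p ∈ PP X, Real.log p ≤ 2 * X := by
  have h1 := Chebyshev.theta_le_log4_mul_x (x := X) (by linarith)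
  have h2 : Real.log 4 ≤ 2 := by
    rw [show (4 : ℝ) = 2 ^ 2 by norm_num, Real.log_pow]
    have := Real.log_two_lt_d9
    push_cast; linarith
  have h3 : ∑ p ∈ PP X, Real.log p ≤ Chebyshev.theta X := by
    rw [Chebyshev.theta]
    apply Finset.sum_le_sum_of_subset_of_nonneg
    · intro p hp
      have h1 := PP_log hX p hp
      rw [mem_PP (by linarith)] at hp
      rw [Finset.mem_filter, Finset.mem_Ioc]
      exact ⟨⟨h1.1, Nat.le_floor hp.2.2⟩, hp.1⟩
    · intro i _ _; exact Real.log_natCast_nonneg i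
  nlinarith

lemma SS_triv {X : ℝ} (hX : 1 ≤ X) (t : ℝ) : ‖SS (PP X) t‖ ≤ 2 * X := by
  refine le_trans (norm_sum_le _ _) (le_trans (Finset.sum_le_sum (fun p _ => ?_)) (PP_sum_log hX))
  rw [norm_mul, norm_EE, mul_one, Complex.norm_real, Real.norm_of_nonneg (Real.log_natCast_nonneg p)]

lemma SS_diff {X : ℝ} (hX : 1 ≤ X) (t : ℝ) :
    ‖SS (PP X) t‖ ≤ ‖∑ n ∈ JJ X 1, (vonMangoldt n : ℂ) * EE t n‖ + 2 * Real.sqrt X * Real.log X := by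
  have h1 : ∑ n ∈ JJ X 1, (vonMangoldt n : ℂ) * EE t n =
      SS (PP X) t + ∑ n ∈ (JJ X 1).filter (fun n => ¬ n.Prime), (vonMangoldt n : ℂ) * EE t n := by
    rw [← Finset.sum_filter_add_sum_filter_not (JJ X 1) Nat.Prime]
    congr 1
    unfold SS PP
    refine Finset.sum_congr rfl (fun p hp => ?_)
    rw [ArithmeticFunction.vonMangoldt_apply_prime (Finset.mem_filter.1 hp).2]
  have h2 : ‖∑ n ∈ (JJ X 1).filter (fun n => ¬ n.Prime), (vonMangoldt n : ℂ) * EE t n‖ ≤ 2 * Real.sqrt X * Real.log X := by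
    refine (norm_sum_le _ _).trans ?_
    have h3 := psi_sub_theta_filter X (fun n => ¬ n.Prime)
    rw [Finset.filter_false_of_mem (p := fun p => Nat.Prime p ∧ ¬ Nat.Prime p) (by intro x _; simp), Finset.sum_empty, zero_add] at h3
    refine le_trans ?_ (h3.trans (Chebyshev.psi_sub_theta_le hX))
    refine le_trans (le_of_eq ?_) (Finset.sum_le_sum_of_subset_of_nonneg (Finset.filter_subset_filter _ (PP_sub_range (by linarith))) (fun i _ _ => ArithmeticFunction.vonMangoldt_nonneg))
    refine Finset.sum_congr rfl (fun p hp => ?_)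
    rw [norm_mul, norm_EE, mul_one, Complex.norm_real, Real.norm_of_nonneg ArithmeticFunction.vonMangoldt_nonneg]
  have h3 : SS (PP X) t = ∑ n ∈ JJ X 1, (vonMangoldt n : ℂ) * EE t n - ∑ n ∈ (JJ X 1).filter (fun n => ¬ n.Prime), (vonMangoldt n : ℂ) * EE t n := by
    rw [h1]; ring
  rw [h3]
  exact (norm_sub_le _ _).trans (by linarith)

lemma SS_bound {X t : ℝ} (hX : 32 ≤ X) (ht1 : 1 / X ≤ |t|) (ht2 : |t| ≤ X ^ (2 / 25 : ℝ)) :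
    ‖SS (PP X) t‖ ≤ 5002 * Real.log X ^ 6 * X * (X ^ (-(1 / 20) : ℝ) + (|t| * X) ^ (-(1 / 4) : ℝ)) := by
  have hX0 : 0 < X := by linarith
  have hL : 1 ≤ Real.log X := by
    rw [Real.le_log_iff_exp_le hX0]
    have := Real.exp_one_lt_d9
    linarith
  have h1 := SS_diff (by linarith : 1 ≤ X) |t|
  rw [SS_abs] at h1
  have h2 := lambda_sum hX ht1 ht2
  have ht0 : 0 < |t| := lt_of_lt_of_le (by positivity) ht1
  have h3 : 2 * Real.sqrt X * Real.log X ≤ 2 * Real.log X ^ 6 * X * (X ^ (-(1 / 20) : ℝ) + (|t| * X) ^ (-(1 / 4) : ℝ)) := by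
    have h4 : Real.sqrt X ≤ X * X ^ (-(1 / 20) : ℝ) := by
      rw [Real.sqrt_eq_rpow]
      nth_rw 2 [← Real.rpow_one X]
      rw [← Real.rpow_add hX0]
      exact Real.rpow_le_rpow_of_exponent_le (by linarith) (by norm_num)
    have h5 : Real.log X ≤ Real.log X ^ 6 := le_self_pow₀ hL (by norm_num)
    have h6 : 0 ≤ (|t| * X) ^ (-(1 / 4) : ℝ) := by positivity
    calc 2 * Real.sqrt X * Real.log X ≤ 2 * (X * X ^ (-(1 / 20) : ℝ)) * Real.log X ^ 6 := by gcongr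
      _ = 2 * Real.log X ^ 6 * X * (X ^ (-(1 / 20) : ℝ) + 0) := by ring
      _ ≤ _ := by gcongr
  refine h1.trans ((add_le_add h2 h3).trans (le_of_eq ?_))
  ring

/-- medium range -/
lemma SS_M1 {X t : ℝ} (hX : 32 ≤ X) (hL : Real.log X ^ 88 ≤ X ^ (1 / 5 : ℝ)) (ht1 : Real.log X ^ 88 / X ≤ |t|) (ht2 : |t| ≤ 1) :
    ‖SS (PP X) t‖ ≤ 10004 * X / Real.log X ^ 16 := by
  have hX0 : 0 < X := by linarith
  have hL1 : 1 ≤ Real.log X := by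
    rw [Real.le_log_iff_exp_le hX0]
    have := Real.exp_one_lt_d9
    linarith
  have hL0 : 0 < Real.log X := by linarith
  have h1 := SS_bound (t := t) hX (le_trans (by gcongr; exact one_le_pow₀ hL1) ht1)
    (ht2.trans (Real.one_le_rpow (by linarith) (by norm_num)))
  have e : (Real.log X ^ 88) ^ (-(1 / 4) : ℝ) = 1 / Real.log X ^ 22 := by
    rw [← Real.rpow_natCast, ← Real.rpow_mul hL0.le, ← Real.rpow_natCast (Real.log X) 22, one_div (Real.log X ^ ((22 : ℕ) : ℝ)),
      ← Real.rpow_neg hL0.le]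
    norm_num
  have h2 : X ^ (-(1 / 20) : ℝ) ≤ 1 / Real.log X ^ 22 := by
    rw [← e]
    have : X ^ (-(1 / 20) : ℝ) = (X ^ (1 / 5 : ℝ)) ^ (-(1 / 4) : ℝ) := by
      rw [← Real.rpow_mul hX0.le]; norm_num
    rw [this]
    exact Real.rpow_le_rpow_of_nonpos (by positivity) hL (by norm_num)
  have h3 : (|t| * X) ^ (-(1 / 4) : ℝ) ≤ 1 / Real.log X ^ 22 := by
    rw [← e]
    rw [div_le_iff₀ hX0] at ht1
    exact Real.rpow_le_rpow_of_nonpos (by positivity) ht1 (by norm_num)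
  refine h1.trans ?_
  calc _ ≤ 5002 * Real.log X ^ 6 * X * (1 / Real.log X ^ 22 + 1 / Real.log X ^ 22) := by gcongr
    _ = _ := by field_simp; norm_num

lemma SS_M2 {X t : ℝ} (hX : 32 ≤ X) (ht1 : 1 ≤ |t|) (ht2 : |t| ≤ X ^ (2 / 25 : ℝ)) :
    ‖SS (PP X) t‖ ≤ 10004 * Real.log X ^ 6 * X * X ^ (-(1 / 20) : ℝ) := by
  have hX0 : 0 < X := by linarith
  have hL1 : 1 ≤ Real.log X := by
    rw [Real.le_log_iff_exp_le hX0]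
    have := Real.exp_one_lt_d9
    linarith
  have h1 := SS_bound (t := t) hX (le_trans (by rw [div_le_one hX0]; linarith) ht1) ht2
  have h3 : (|t| * X) ^ (-(1 / 4) : ℝ) ≤ X ^ (-(1 / 20) : ℝ) := by
    calc (|t| * X) ^ (-(1 / 4) : ℝ) ≤ X ^ (-(1 / 4) : ℝ) :=
          Real.rpow_le_rpow_of_nonpos hX0 (by nlinarith) (by norm_num)
      _ ≤ _ := Real.rpow_le_rpow_of_exponent_le (by linarith) (by norm_num)
  refine h1.trans ?_
  calc _ ≤ 5002 * Real.log X ^ 6 * X * (X ^ (-(1 / 20) : ℝ) + X ^ (-(1 / 20) : ℝ)) := by gcongr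
    _ = _ := by ring

end TLI


namespace TLI
open MeasureTheory

/-- weighted count of triples -/
noncomputable def GG (P : Finset ℕ) (N b : ℝ) : ℝ :=
  1 / b * ∑ i ∈ P ×ˢ P ×ˢ P, Real.log i.1 * Real.log i.2.1 * Real.log i.2.2 *
    Real.exp (-Real.pi * (xl i.1 + xl i.2.1 + xl i.2.2 - N) ^ 2 / b ^ 2)

lemma GG_int (P : Finset ℕ) (N : ℝ) {b : ℝ} (hb : 0 < b) :
    Integrable (fun t : ℝ => SS P t ^ 3 * ee (-(N * t)) * (Real.exp (-Real.pi * b ^ 2 * t ^ 2) : ℂ)) ∧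
    ∫ t : ℝ, SS P t ^ 3 * ee (-(N * t)) * (Real.exp (-Real.pi * b ^ 2 * t ^ 2) : ℂ) = (GG P N b : ℂ) := by
  simp only [SS_cube]
  exact ⟨gsum_integrable (P ×ˢ P ×ˢ P) (fun i => Real.log i.1 * Real.log i.2.1 * Real.log i.2.2)
    (fun i => xl i.1 + xl i.2.1 + xl i.2.2 - N) hb,
    gsum (P ×ˢ P ×ˢ P) (fun i => Real.log i.1 * Real.log i.2.1 * Real.log i.2.2)
    (fun i => xl i.1 + xl i.2.1 + xl i.2.2 - N) hb⟩

lemma GG_diff (P : Finset ℕ) (N : ℝ) {ε Δ t0 T M0 M1 M2 J1 J2 : ℝ} (hε : 0 < ε) (hε1 : ε ≤ Δ) (ht0 : 0 ≤ t0) (hT0 : 0 ≤ T)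
    (h0 : ∀ t, ‖SS P t‖ ≤ M0) (h1 : ∀ t, t0 ≤ |t| → |t| ≤ 1 → ‖SS P t‖ ≤ M1)
    (h2 : ∀ t, 1 ≤ |t| → |t| ≤ T → ‖SS P t‖ ≤ M2) (hM1 : 0 ≤ M1) (hM2 : 0 ≤ M2)
    (hJ1 : Integrable (fun t : ℝ => ‖SS P t‖ ^ 2 * Real.exp (-Real.pi * (1 : ℝ) ^ 2 * t ^ 2)) ∧
      ∫ t : ℝ, ‖SS P t‖ ^ 2 * Real.exp (-Real.pi * (1 : ℝ) ^ 2 * t ^ 2) ≤ J1)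
    (hJ2 : Integrable (fun t : ℝ => ‖SS P t‖ ^ 2 * Real.exp (-Real.pi * ε ^ 2 * t ^ 2)) ∧
      ∫ t : ℝ, ‖SS P t‖ ^ 2 * Real.exp (-Real.pi * ε ^ 2 * t ^ 2) ≤ J2) :
    GG P N Δ - GG P N ε ≤ 2 * Real.pi * M0 ^ 3 * Δ ^ 2 * t0 ^ 3 + Real.exp Real.pi * M1 * J1 + M2 * J2 +
      M0 ^ 3 * Real.exp (-(ε ^ 2 * T ^ 2)) * (2 / ε) := by
  have hpi := Real.pi_gt_three
  have hΔ : 0 < Δ := by linarith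
  have hM0 : 0 ≤ M0 := (norm_nonneg _).trans (h0 0)
  obtain ⟨i1, e1⟩ := GG_int P N hε
  obtain ⟨i2, e2⟩ := GG_int P N hΔ
  set g : ℝ → ℝ := fun t => (Set.Icc (-t0) t0).indicator (fun _ => M0 ^ 3 * (Real.pi * Δ ^ 2 * t0 ^ 2)) t +
    Real.exp Real.pi * M1 * (‖SS P t‖ ^ 2 * Real.exp (-Real.pi * (1 : ℝ) ^ 2 * t ^ 2)) +
    M2 * (‖SS P t‖ ^ 2 * Real.exp (-Real.pi * ε ^ 2 * t ^ 2)) +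
    M0 ^ 3 * Real.exp (-(ε ^ 2 * T ^ 2)) * Real.exp (-Real.pi * (ε / 2) ^ 2 * t ^ 2) with hg
  have gi1 : Integrable ((Set.Icc (-t0) t0).indicator (fun _ : ℝ => M0 ^ 3 * (Real.pi * Δ ^ 2 * t0 ^ 2))) := by
    apply IntegrableOn.integrable_indicator _ measurableSet_Icc
    exact integrableOn_const (by simp)
  have gi4 := gauss_integrable (b := ε / 2) (by positivity)
  have gi2 := hJ1.1.const_mul (Real.exp Real.pi * M1)
  have gi3 := hJ2.1.const_mul M2
  have gi4' := gi4.const_mul (M0 ^ 3 * Real.exp (-(ε ^ 2 * T ^ 2)))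
  have gI : ∫ t, g t ≤ 2 * Real.pi * M0 ^ 3 * Δ ^ 2 * t0 ^ 3 + Real.exp Real.pi * M1 * J1 + M2 * J2 +
      M0 ^ 3 * Real.exp (-(ε ^ 2 * T ^ 2)) * (2 / ε) := by
    have key := integral_add' ((gi1.add gi2).add gi3) gi4'
    rw [integral_add' (gi1.add gi2) gi3, integral_add' gi1 gi2, integral_const_mul, integral_const_mul, integral_const_mul,
      gauss_integral (by positivity), integral_indicator_const _ measurableSet_Icc] at key
    refine le_trans (le_of_eq key) ?_
    have v : (volume : Measure ℝ).real (Set.Icc (-t0) t0) = 2 * t0 := by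
      rw [Real.volume_real_Icc_of_le (by linarith)]; ring
    rw [v, smul_eq_mul]
    have a1 := mul_le_mul_of_nonneg_left hJ1.2 (by positivity : 0 ≤ Real.exp Real.pi * M1)
    have a2 := mul_le_mul_of_nonneg_left hJ2.2 hM2
    have a3 : 1 / (ε / 2) = 2 / ε := by field_simp
    have a0 : 2 * t0 * (M0 ^ 3 * (Real.pi * Δ ^ 2 * t0 ^ 2)) = 2 * Real.pi * M0 ^ 3 * Δ ^ 2 * t0 ^ 3 := by ring
    rw [a3, a0]
    exact add_le_add (add_le_add (add_le_add le_rfl a1) a2) le_rfl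
  have gInt : Integrable g :=
    (((gi1.add gi2).add gi3).add gi4')
  have hpt : ∀ t : ℝ, ‖SS P t ^ 3 * ee (-(N * t)) * (Real.exp (-Real.pi * ε ^ 2 * t ^ 2) : ℂ) -
      SS P t ^ 3 * ee (-(N * t)) * (Real.exp (-Real.pi * Δ ^ 2 * t ^ 2) : ℂ)‖ ≤ g t := by
    intro t
    rw [← mul_sub, norm_mul, norm_mul, norm_ee, norm_pow, mul_one, ← Complex.ofReal_sub, Complex.norm_real]
    have hmono : Real.exp (-Real.pi * Δ ^ 2 * t ^ 2) ≤ Real.exp (-Real.pi * ε ^ 2 * t ^ 2) := by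
      apply Real.exp_le_exp.2
      have : ε ^ 2 * t ^ 2 ≤ Δ ^ 2 * t ^ 2 := by gcongr
      nlinarith
    rw [Real.norm_of_nonneg (by linarith)]
    set K := Real.exp (-Real.pi * ε ^ 2 * t ^ 2) - Real.exp (-Real.pi * Δ ^ 2 * t ^ 2) with hK
    have hK0 : 0 ≤ K := by linarith
    have hKe : K ≤ Real.exp (-Real.pi * ε ^ 2 * t ^ 2) := by linarith [Real.exp_pos (-Real.pi * Δ ^ 2 * t ^ 2)]
    have hE1 : Real.exp (-Real.pi * ε ^ 2 * t ^ 2) ≤ 1 := by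
      rw [Real.exp_le_one_iff]
      have : 0 ≤ Real.pi * (ε ^ 2 * t ^ 2) := by positivity
      nlinarith
    have n0 := norm_nonneg (SS P t)
    have p1 : 0 ≤ (Set.Icc (-t0) t0).indicator (fun _ => M0 ^ 3 * (Real.pi * Δ ^ 2 * t0 ^ 2)) t :=
      Set.indicator_nonneg (fun _ _ => by positivity) t
    have p2 : 0 ≤ Real.exp Real.pi * M1 * (‖SS P t‖ ^ 2 * Real.exp (-Real.pi * (1 : ℝ) ^ 2 * t ^ 2)) := by positivity
    have p3 : 0 ≤ M2 * (‖SS P t‖ ^ 2 * Real.exp (-Real.pi * ε ^ 2 * t ^ 2)) := by positivity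
    have p4 : 0 ≤ M0 ^ 3 * Real.exp (-(ε ^ 2 * T ^ 2)) * Real.exp (-Real.pi * (ε / 2) ^ 2 * t ^ 2) := by positivity
    simp only [hg]
    rcases le_total |t| t0 with c1 | c1
    · have hmem : t ∈ Set.Icc (-t0) t0 := abs_le.1 c1
      have hi : (Set.Icc (-t0) t0).indicator (fun _ => M0 ^ 3 * (Real.pi * Δ ^ 2 * t0 ^ 2)) t = M0 ^ 3 * (Real.pi * Δ ^ 2 * t0 ^ 2) :=
        Set.indicator_of_mem hmem _
      rw [hi]
      have hKs : K ≤ Real.pi * Δ ^ 2 * t0 ^ 2 := by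
        have q1 := Real.add_one_le_exp (-Real.pi * Δ ^ 2 * t ^ 2)
        have q2 : t ^ 2 ≤ t0 ^ 2 := by rw [← sq_abs t]; gcongr
        have q3 : Real.pi * Δ ^ 2 * t ^ 2 ≤ Real.pi * Δ ^ 2 * t0 ^ 2 := by gcongr
        linarith
      have : ‖SS P t‖ ^ 3 * K ≤ M0 ^ 3 * (Real.pi * Δ ^ 2 * t0 ^ 2) := by gcongr; exact h0 t
      exact ((this.trans (le_add_of_nonneg_right p2)).trans (le_add_of_nonneg_right p3)).trans (le_add_of_nonneg_right p4)
    · rcases le_total |t| 1 with c2 | c2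
      · have : ‖SS P t‖ ^ 3 * K ≤ Real.exp Real.pi * M1 * (‖SS P t‖ ^ 2 * Real.exp (-Real.pi * (1 : ℝ) ^ 2 * t ^ 2)) := by
          have q1 : 1 ≤ Real.exp Real.pi * Real.exp (-Real.pi * (1 : ℝ) ^ 2 * t ^ 2) := by
            rw [← Real.exp_add]
            apply Real.one_le_exp
            have : t ^ 2 ≤ 1 := by rw [← sq_abs]; exact pow_le_one₀ (abs_nonneg _) c2
            nlinarith
          calc ‖SS P t‖ ^ 3 * K = ‖SS P t‖ * ‖SS P t‖ ^ 2 * K := by ring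
            _ ≤ M1 * ‖SS P t‖ ^ 2 * (Real.exp Real.pi * Real.exp (-Real.pi * (1 : ℝ) ^ 2 * t ^ 2)) := by
                gcongr
                · exact h1 t c1 c2
                · linarith
            _ = _ := by ring
        exact ((this.trans (le_add_of_nonneg_left p1)).trans (le_add_of_nonneg_right p3)).trans (le_add_of_nonneg_right p4)
      · rcases le_total |t| T with c3 | c3
        · have : ‖SS P t‖ ^ 3 * K ≤ M2 * (‖SS P t‖ ^ 2 * Real.exp (-Real.pi * ε ^ 2 * t ^ 2)) := by
            calc ‖SS P t‖ ^ 3 * K = ‖SS P t‖ * (‖SS P t‖ ^ 2 * K) := by ring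
              _ ≤ _ := by
                  gcongr
                  exact h2 t c2 c3
          exact (this.trans (le_add_of_nonneg_left (add_nonneg p1 p2))).trans (le_add_of_nonneg_right p4)
        · have : ‖SS P t‖ ^ 3 * K ≤ M0 ^ 3 * Real.exp (-(ε ^ 2 * T ^ 2)) * Real.exp (-Real.pi * (ε / 2) ^ 2 * t ^ 2) := by
            rw [mul_assoc, ← Real.exp_add]
            have q2 : K ≤ Real.exp (-(ε ^ 2 * T ^ 2) + -Real.pi * (ε / 2) ^ 2 * t ^ 2) := by
              refine hKe.trans (Real.exp_le_exp.2 ?_)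
              have r1 : T ^ 2 ≤ t ^ 2 := by rw [← sq_abs t]; gcongr
              have r2 : ε ^ 2 * T ^ 2 ≤ ε ^ 2 * t ^ 2 := by gcongr
              have r3 : 0 ≤ ε ^ 2 * t ^ 2 := by positivity
              nlinarith
            gcongr
            exact h0 t
          exact this.trans (le_add_of_nonneg_left (add_nonneg (add_nonneg p1 p2) p3))
  have hfin := norm_integral_le_of_norm_le gInt (Filter.Eventually.of_forall hpt)
  rw [integral_sub i1 i2, e1, e2, ← Complex.ofReal_sub, Complex.norm_real, Real.norm_eq_abs, abs_sub_comm] at hfin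
  exact (le_abs_self _).trans (hfin.trans gI)

end TLI


namespace TLI

lemma Wd_near {B : ℕ} {x : ℝ} (hx : 0 < x) (hl : 1 ≤ Real.log x) {p : ℕ} (hp : p ∈ Wd B x) :
    p.Prime ∧ |(p : ℝ) - x| ≤ 2 * x / Real.log x ^ B ∧ |xl p - xl x| ≤ 5 * x * Real.log x / Real.log x ^ B := by
  unfold Wd at hp
  obtain ⟨_, hpp, hlog⟩ := Finset.mem_filter.1 hp
  have hp0 : (0 : ℝ) < p := by exact_mod_cast hpp.pos
  set δ := 1 / Real.log x ^ B with hδ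
  have hδ0 : 0 < δ := by positivity
  have hδ1 : δ ≤ 1 := by
    rw [hδ, div_le_one (by positivity)]; exact one_le_pow₀ hl
  set θ := Real.log p - Real.log x with hθ
  have hpx : (p : ℝ) = x * Real.exp θ := by
    rw [hθ, Real.exp_sub, Real.exp_log hp0, Real.exp_log hx]; field_simp
  have h1 : |Real.exp θ - 1| ≤ 2 * |θ| := Real.abs_exp_sub_one_le (hlog.trans hδ1)
  have h2 : |(p : ℝ) - x| ≤ 2 * x * δ := by
    rw [hpx, show x * Real.exp θ - x = x * (Real.exp θ - 1) by ring, abs_mul, abs_of_pos hx]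
    calc x * |Real.exp θ - 1| ≤ x * (2 * δ) := by
          gcongr; linarith
      _ = _ := by ring
  have h3 : (p : ℝ) ≤ 3 * x := by
    have := (abs_le.1 h2).2
    nlinarith
  refine ⟨hpp, by rw [hδ] at h2; rw [div_eq_mul_one_div]; exact h2, ?_⟩
  have e : xl p - xl x = (p - x) * Real.log x + p * θ := by
    unfold xl; rw [hθ]; ring
  rw [e, div_eq_mul_one_div, ← hδ]
  refine (abs_add_le _ _).trans ?_
  rw [abs_mul, abs_mul, abs_of_pos hp0, abs_of_nonneg (by linarith : 0 ≤ Real.log x)]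
  have h4 : |(p : ℝ) - x| * Real.log x ≤ 2 * x * δ * Real.log x := by gcongr
  have h5 : (p : ℝ) * |θ| ≤ 3 * x * δ := by gcongr
  have h6 : 3 * x * δ * 1 ≤ 3 * x * δ * Real.log x := by gcongr
  nlinarith

lemma xl_ivt {Y R : ℝ} (hY : 0 < Y) (hl : 50 ≤ Real.log Y) (hR : |R - xl Y| ≤ 10 * Y) :
    ∃ x, 4 / 5 * Y ≤ x ∧ x ≤ 6 / 5 * Y ∧ xl x = R := by
  have h1 := (xl_diff hY (by linarith : Y ≤ 6 / 5 * Y)).1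
  have h2 := (xl_diff (by linarith : 0 < 4 / 5 * Y) (by linarith : 4 / 5 * Y ≤ Y)).1
  have h3 : Real.log (4 / 5 * Y) = Real.log (4 / 5) + Real.log Y := Real.log_mul (by norm_num) hY.ne'
  have h4 : 1 - (4 / 5 : ℝ)⁻¹ ≤ Real.log (4 / 5) := Real.one_sub_inv_le_log_of_pos (by norm_num)
  norm_num at h4
  obtain ⟨h5, h6⟩ := abs_le.1 hR
  have hc : ContinuousOn xl (Set.Icc (4 / 5 * Y) (6 / 5 * Y)) := by
    have : Continuous xl := Real.continuous_mul_log
    exact this.continuousOn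
  have hmem : R ∈ Set.Icc (xl (4 / 5 * Y)) (xl (6 / 5 * Y)) := by
    constructor <;> nlinarith
  obtain ⟨x, hx, hxR⟩ := intermediate_value_Icc (by linarith) hc hmem
  exact ⟨x, hx.1, hx.2, hxR⟩

lemma GG_lower : ∃ X0 : ℝ, ∀ X ≥ X0, Real.exp (-Real.pi) / 8 * (X ^ 2 / Real.log X ^ 10) ≤
    GG (PP X) (3 * xl (2 * X / 3)) (X / Real.log X ^ 150) := by
  obtain ⟨x1, hx1⟩ := prime_window 1
  obtain ⟨x2, hx2⟩ := prime_window 152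
  refine ⟨max (max (2 * |x1|) (2 * |x2|)) (Real.exp (2 ^ 160)), fun X hX => ?_⟩
  have hXx1 : 2 * |x1| ≤ X := (le_max_left _ _).trans ((le_max_left _ _).trans hX)
  have hXx2 : 2 * |x2| ≤ X := (le_max_right _ _).trans ((le_max_left _ _).trans hX)
  have hXe : Real.exp (2 ^ 160) ≤ X := (le_max_right _ _).trans hX
  have hX0 : 0 < X := (Real.exp_pos _).trans_le hXe
  set L := Real.log X with hL
  have hLbig : (2 : ℝ) ^ 160 ≤ L := (Real.le_log_iff_exp_le hX0).2 hXe
  have hL200 : (1000 : ℝ) ≤ L := le_trans (by norm_num) hLbig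
  have hL0 : 0 < L := by linarith
  have hX4 : 4 ≤ X := by
    have := Real.add_one_le_exp ((2 : ℝ) ^ 160)
    have : (4 : ℝ) ≤ 2 ^ 160 := by norm_num
    linarith
  have hlogx : ∀ x, X / 2 ≤ x → x ≤ X → L / 2 ≤ Real.log x ∧ Real.log x ≤ L := by
    intro x hx hxX
    have hx0 : 0 < x := by linarith
    refine ⟨?_, Real.log_le_log hx0 hxX⟩
    have : Real.log (X / 2) ≤ Real.log x := Real.log_le_log (by linarith) hx
    rw [Real.log_div hX0.ne' (by norm_num)] at this
    linarith [Real.log_two_lt_d9]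
  set Y := 2 * X / 3 with hY
  have hY0 : 0 < Y := by positivity
  obtain ⟨hlY, hlYL⟩ := hlogx Y (by linarith) (by linarith)
  have hlY0 : 0 < Real.log Y := by linarith
  set W := Wd 1 Y with hW
  set P := PP X with hP
  set Δ := X / L ^ 150 with hΔ
  have hΔ0 : 0 < Δ := by positivity
  have hWn : ∀ p ∈ W, |xl p - xl Y| ≤ 5 * Y ∧ p ∈ P := by
    intro p hp
    obtain ⟨a1, a2, a3⟩ := Wd_near hY0 (by linarith) hp
    rw [pow_one] at a2 a3
    constructor
    · rwa [mul_div_assoc, div_self (by linarith : Real.log Y ≠ 0), mul_one] at a3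
    · rw [hP, mem_PP hX0.le]
      have : 2 * Y / Real.log Y ≤ Y / 10 := by
        rw [div_le_iff₀ (by linarith)]; nlinarith
      obtain ⟨b1, b2⟩ := abs_le.1 (a2.trans this)
      exact ⟨a1, by linarith, by linarith⟩
  have hWsum : X / 2 / L ^ 3 ≤ ∑ p ∈ W, Real.log p := by
    refine le_trans ?_ (hx1 Y (by linarith [le_abs_self x1]))
    gcongr
    linarith
  set C := Real.exp (-Real.pi) * (X / 2 / L ^ 154) with hC
  have hC0 : 0 ≤ C := by positivity
  set F : ℕ → ℕ → ℕ → ℝ := fun p q r => Real.log p * Real.log q * Real.log r *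
    Real.exp (-Real.pi * (xl p + xl q + xl r - 3 * xl Y) ^ 2 / Δ ^ 2) with hF
  have hF0 : ∀ p q r, 0 ≤ F p q r := by
    intro p q r
    have := Real.log_natCast_nonneg p
    have := Real.log_natCast_nonneg q
    have := Real.log_natCast_nonneg r
    simp only [hF]; positivity
  have hin : ∀ p ∈ W, ∀ q ∈ W, Real.log p * Real.log q * C ≤ ∑ r ∈ P, F p q r := by
    intro p hp q hq
    obtain ⟨p1, p2⟩ := abs_le.1 (hWn p hp).1
    obtain ⟨q1, q2⟩ := abs_le.1 (hWn q hq).1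
    obtain ⟨x, ha, hb, hxR⟩ := xl_ivt (R := 3 * xl Y - xl p - xl q) hY0 (by linarith) (abs_le.2 ⟨by linarith, by linarith⟩)
    have hx0 : 0 < x := by linarith
    obtain ⟨hlx, hlxL⟩ := hlogx x (by linarith) (by linarith)
    have hlx0 : 0 < Real.log x := by linarith
    have hsub : Wd 152 x ⊆ P := by
      intro r hr
      obtain ⟨a1, a2, a3⟩ := Wd_near hx0 (by linarith) hr
      rw [hP, mem_PP hX0.le]
      have : 2 * x / Real.log x ^ 152 ≤ x / 50 := by
        have h1 : 100 ≤ Real.log x ^ 152 := le_trans (by linarith) (le_self_pow₀ (by linarith : 1 ≤ Real.log x) (by norm_num))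
        rw [div_le_iff₀ (by positivity)]; nlinarith
      obtain ⟨b1, b2⟩ := abs_le.1 (a2.trans this)
      exact ⟨a1, by linarith, by linarith⟩
    refine le_trans ?_ (Finset.sum_le_sum_of_subset_of_nonneg hsub (fun r _ _ => hF0 p q r))
    have hr : ∀ r ∈ Wd 152 x, Real.log p * Real.log q * Real.exp (-Real.pi) * Real.log r ≤ F p q r := by
      intro r hr
      obtain ⟨a1, a2, a3⟩ := Wd_near hx0 (by linarith) hr
      have hd : |xl r - xl x| ≤ Δ := by
        refine a3.trans ?_
        rw [hΔ, div_le_div_iff₀ (by positivity) (by positivity)]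
        have e1 : (L / 2) ^ 151 ≤ Real.log x ^ 151 := by gcongr
        have e2 : 5 * L ^ 150 ≤ (L / 2) ^ 151 := by
          rw [div_pow, le_div_iff₀ (by positivity), pow_succ L 150]
          have : (5 : ℝ) * 2 ^ 151 ≤ L := le_trans (by norm_num) hLbig
          have h0 : 0 ≤ L ^ 150 := by positivity
          nlinarith
        have e3 : 5 * L ^ 150 ≤ Real.log x ^ 151 := e2.trans e1
        calc 5 * x * Real.log x * L ^ 150 = x * Real.log x * (5 * L ^ 150) := by ring
          _ ≤ X * Real.log x * Real.log x ^ 151 := by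
              gcongr
              linarith
          _ = _ := by ring
      have he : Real.exp (-Real.pi) ≤ Real.exp (-Real.pi * (xl p + xl q + xl r - 3 * xl Y) ^ 2 / Δ ^ 2) := by
        apply Real.exp_le_exp.2
        rw [le_div_iff₀ (by positivity)]
        have : (xl p + xl q + xl r - 3 * xl Y) ^ 2 ≤ Δ ^ 2 := by
          rw [show xl p + xl q + xl r - 3 * xl Y = xl r - xl x by rw [hxR]; ring, ← sq_abs]
          gcongr
        have hpi := Real.pi_pos
        nlinarith
      have l1 := Real.log_natCast_nonneg p
      have l2 := Real.log_natCast_nonneg q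
      have l3 := Real.log_natCast_nonneg r
      simp only [hF]
      calc _ = Real.log p * Real.log q * Real.log r * Real.exp (-Real.pi) := by ring
        _ ≤ _ := by gcongr
    refine le_trans ?_ (Finset.sum_le_sum hr)
    rw [← Finset.mul_sum]
    have hs := hx2 x (by linarith [le_abs_self x2])
    have l1 := Real.log_natCast_nonneg p
    have l2 := Real.log_natCast_nonneg q
    have hs2 : X / 2 / L ^ 154 ≤ ∑ r ∈ Wd 152 x, Real.log r := by
      refine le_trans ?_ hs
      gcongr
      linarith
    rw [hC, ← mul_assoc]
    gcongr
  have hout : (∑ p ∈ W, Real.log p) ^ 2 * C ≤ ∑ i ∈ P ×ˢ P ×ˢ P, F i.1 i.2.1 i.2.2 := by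
    have hWP : W ⊆ P := fun p hp => (hWn p hp).2
    rw [Finset.sum_product]
    have s1 : ∀ p ∈ W, ∑ q ∈ W, Real.log p * Real.log q * C ≤ ∑ i ∈ P ×ˢ P, F p i.1 i.2 := by
      intro p hp
      rw [Finset.sum_product]
      refine le_trans (Finset.sum_le_sum (hin p hp)) ?_
      exact Finset.sum_le_sum_of_subset_of_nonneg hWP (fun q _ _ => Finset.sum_nonneg (fun r _ => hF0 p q r))
    refine le_trans ?_ (Finset.sum_le_sum_of_subset_of_nonneg hWP (fun p _ _ => Finset.sum_nonneg (fun r _ => hF0 p r.1 r.2)))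
    refine le_trans (le_of_eq ?_) (Finset.sum_le_sum s1)
    rw [sq, Finset.sum_mul_sum, Finset.sum_mul]
    exact Finset.sum_congr rfl (fun p _ => by rw [Finset.sum_mul])
  have hsq : (X / 2 / L ^ 3) ^ 2 * C ≤ (∑ p ∈ W, Real.log p) ^ 2 * C := by gcongr
  have hgg : GG P (3 * xl Y) Δ = 1 / Δ * ∑ i ∈ P ×ˢ P ×ˢ P, F i.1 i.2.1 i.2.2 := rfl
  rw [hgg]
  calc _ = 1 / Δ * ((X / 2 / L ^ 3) ^ 2 * C) := by
        rw [hΔ, hC]; field_simp; norm_num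
    _ ≤ _ := by
        gcongr
        exact hsq.trans hout

end TLI


namespace TLI
open Filter

lemma ev_log_pow (m : ℕ) {r c : ℝ} (hr : 0 < r) (hc : 0 < c) : ∀ᶠ X : ℝ in atTop, Real.log X ^ m ≤ c * X ^ r := by
  have h := (isLittleO_log_rpow_rpow_atTop (m : ℝ) hr).bound hc
  filter_upwards [h, eventually_ge_atTop 1] with X hX h1
  have hl := Real.log_nonneg h1
  rw [Real.rpow_natCast, Real.norm_of_nonneg (by positivity), Real.norm_of_nonneg (by positivity)] at hX
  exact hX

lemma GG_upper (P : Finset ℕ) (N : ℝ) {ε H M : ℝ} (hε : 0 < ε) (hH : 0 ≤ H) (hM : ∑ p ∈ P, Real.log p ≤ M)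
    (hno : ∀ p ∈ P, ∀ q ∈ P, ∀ r ∈ P, ε * H ≤ |xl p + xl q + xl r - N|) :
    GG P N ε ≤ 1 / ε * (M ^ 3 * Real.exp (-Real.pi * H ^ 2)) := by
  unfold GG
  have hs : ∑ i ∈ P ×ˢ P ×ˢ P, Real.log i.1 * Real.log i.2.1 * Real.log i.2.2 = (∑ p ∈ P, Real.log p) ^ 3 := by
    rw [Finset.sum_product, pow_three, Finset.sum_mul]
    refine Finset.sum_congr rfl (fun p _ => ?_)
    rw [Finset.sum_product, Finset.sum_mul, Finset.mul_sum]
    refine Finset.sum_congr rfl (fun q _ => ?_)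
    rw [Finset.mul_sum, Finset.mul_sum]
    exact Finset.sum_congr rfl (fun r _ => by ring)
  have h0 : 0 ≤ ∑ p ∈ P, Real.log (p : ℝ) := Finset.sum_nonneg (fun p _ => Real.log_natCast_nonneg p)
  have h3 : (∑ p ∈ P, Real.log (p : ℝ)) ^ 3 ≤ M ^ 3 := by gcongr
  have h4 : ∑ i ∈ P ×ˢ P ×ˢ P, Real.log i.1 * Real.log i.2.1 * Real.log i.2.2 *
      Real.exp (-Real.pi * (xl i.1 + xl i.2.1 + xl i.2.2 - N) ^ 2 / ε ^ 2) ≤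
      ∑ i ∈ P ×ˢ P ×ˢ P, Real.log i.1 * Real.log i.2.1 * Real.log i.2.2 * Real.exp (-Real.pi * H ^ 2) := by
    refine Finset.sum_le_sum (fun i hi => ?_)
    rw [Finset.mem_product, Finset.mem_product] at hi
    have hv := hno i.1 hi.1 i.2.1 hi.2.1 i.2.2 hi.2.2
    have l1 := Real.log_natCast_nonneg i.1
    have l2 := Real.log_natCast_nonneg i.2.1
    have l3 := Real.log_natCast_nonneg i.2.2
    have hsq : (ε * H) ^ 2 ≤ (xl i.1 + xl i.2.1 + xl i.2.2 - N) ^ 2 := by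
      rw [← sq_abs (xl i.1 + xl i.2.1 + xl i.2.2 - N)]
      gcongr
    have hpi := Real.pi_pos
    have he : Real.exp (-Real.pi * (xl i.1 + xl i.2.1 + xl i.2.2 - N) ^ 2 / ε ^ 2) ≤ Real.exp (-Real.pi * H ^ 2) := by
      apply Real.exp_le_exp.2
      rw [div_le_iff₀ (by positivity)]
      nlinarith
    gcongr
  rw [← Finset.sum_mul, hs] at h4
  have h5 : (∑ p ∈ P, Real.log (p : ℝ)) ^ 3 * Real.exp (-Real.pi * H ^ 2) ≤ M ^ 3 * Real.exp (-Real.pi * H ^ 2) := by gcongr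
  have h6 : 0 ≤ 1 / ε := by positivity
  exact mul_le_mul_of_nonneg_left (h4.trans h5) h6

lemma main_ev : ∀ᶠ X : ℝ in atTop, ∃ p₁ p₂ p₃ : ℕ, p₁.Prime ∧ p₂.Prime ∧ p₃.Prime ∧
    |xl p₁ + xl p₂ + xl p₃ - 3 * xl (2 * X / 3)| < X ^ (-(1 : ℝ) / 25) * Real.log X ^ 8 := by
  obtain ⟨X0, hX0⟩ := GG_lower
  set E := Real.exp (-Real.pi) / 8 with hE
  have hEp : 0 < E := by positivity
  have hpi := Real.pi_gt_three
  filter_upwards [eventually_ge_atTop X0, eventually_ge_atTop (32 : ℝ),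
    Real.tendsto_log_atTop.eventually_ge_atTop (16 * Real.pi * (6 / E)),
    Real.tendsto_log_atTop.eventually_ge_atTop (40016 * Real.exp Real.pi * (6 / E)),
    Real.tendsto_log_atTop.eventually_ge_atTop 2,
    ev_log_pow 18 (r := 1 / 100) (c := E / 6 / 40016) (by norm_num) (by positivity),
    ev_log_pow 10 (r := 2) (c := E / 6 / 24) (by norm_num) (by positivity),
    ev_log_pow 1 (r := 2 / 25) (c := 1 / 4) (by norm_num) (by norm_num),
    ev_log_pow 88 (r := 1 / 5) (c := 1) (by norm_num) (by norm_num),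
    ev_log_pow 150 (r := 1) (c := 1) (by norm_num) (by norm_num)] with X k0 k1 k2 k3 k4 k5 k6 k7 k8 k9
  have hX : 0 < X := by linarith
  have hX1 : 1 ≤ X := by linarith
  set L := Real.log X with hL
  have hL0 : 0 < L := by linarith
  have hL1 : 1 ≤ L := by linarith
  have hXL : X = Real.exp L := (Real.exp_log hX).symm
  set ε : ℝ := X ^ (-(1 : ℝ) / 25) with hε
  have hε0 : 0 < ε := by positivity
  have hε1 : ε ≤ 1 := Real.rpow_le_one_of_one_le_of_nonpos hX1 (by norm_num)
  have hεi : 1 / ε = X ^ (1 / 25 : ℝ) := by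
    rw [hε, one_div, ← Real.rpow_neg hX.le]; norm_num
  have hεX : 1 / ε ≤ X := by
    rw [hεi]
    calc X ^ (1 / 25 : ℝ) ≤ X ^ (1 : ℝ) := Real.rpow_le_rpow_of_exponent_le hX1 (by norm_num)
      _ = X := Real.rpow_one X
  set T : ℝ := X ^ (2 / 25 : ℝ) with hT
  have hεT : ε ^ 2 * T ^ 2 = X ^ (2 / 25 : ℝ) := by
    rw [← mul_pow, hε, hT, ← Real.rpow_add hX, ← Real.rpow_natCast, ← Real.rpow_mul hX.le]; norm_num
  set Δ := X / L ^ 150 with hΔ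
  have hΔ1 : 1 ≤ Δ := by
    rw [hΔ, le_div_iff₀ (by positivity)]
    rw [Real.rpow_one] at k9; linarith
  by_contra hcon
  push Not at hcon
  have hlow := hX0 X k0
  set P := PP X with hP
  set N := 3 * xl (2 * X / 3) with hN
  have hup : GG P N ε ≤ 8 := by
    have h := GG_upper P N (H := L ^ 8) hε0 (by positivity) (PP_sum_log hX1) (by
      intro p hp q hq r hr
      rw [hP, mem_PP hX.le] at hp hq hr
      exact hcon p q r hp.1 hq.1 hr.1)
    refine h.trans ?_
    have h1 : Real.exp (-Real.pi * (L ^ 8) ^ 2) ≤ Real.exp (-(4 * L)) := by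
      apply Real.exp_le_exp.2
      have : 2 * L ≤ (L ^ 8) ^ 2 := by
        rw [← pow_mul]
        calc 2 * L ≤ L * L := by gcongr
          _ = L ^ 2 := by ring
          _ ≤ _ := pow_le_pow_right₀ hL1 (by norm_num)
      nlinarith
    have h2 : Real.exp (-(4 * L)) = 1 / X ^ 4 := by
      rw [Real.exp_neg, show 4 * L = (4 : ℕ) * L by norm_num, Real.exp_nat_mul, ← hXL, one_div]
    calc 1 / ε * ((2 * X) ^ 3 * Real.exp (-Real.pi * (L ^ 8) ^ 2)) ≤ X * ((2 * X) ^ 3 * (1 / X ^ 4)) := by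
          rw [← h2]; gcongr
      _ = 8 := by field_simp; norm_num
  have hcard : (P.card : ℝ) ≤ X := PP_card hX1
  have hJ1 := second_moment P (PP_log hX1) one_pos le_rfl
  have hJ2 := second_moment P (PP_log hX1) hε0 hε1
  have hJ1' : 4 * (P.card : ℝ) * L ^ 2 / 1 ≤ 4 * X * L ^ 2 := by rw [div_one]; gcongr
  have hJ2' : 4 * (P.card : ℝ) * L ^ 2 / ε ≤ 4 * X * L ^ 2 * X ^ (1 / 25 : ℝ) := by
    rw [div_eq_mul_one_div, hεi]; gcongr
  have hdiff := GG_diff P N (ε := ε) (Δ := Δ) (t0 := L ^ 88 / X) (T := T) (M0 := 2 * X)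
    (M1 := 10004 * X / L ^ 16) (M2 := 10004 * L ^ 6 * X * X ^ (-(1 / 20) : ℝ)) hε0 (hε1.trans hΔ1)
    (by positivity) (by positivity) (fun t => SS_triv hX1 t)
    (fun t h1 h2 => SS_M1 k1 (by rw [one_mul] at k8; exact k8) h1 h2) (fun t h1 h2 => SS_M2 k1 h1 h2)
    (by positivity) (by positivity) ⟨hJ1.1, hJ1.2.trans hJ1'⟩ ⟨hJ2.1, hJ2.2.trans hJ2'⟩
  set U := X ^ 2 / L ^ 10 with hU
  have hU0 : 0 < U := by positivity
  have t1 : 2 * Real.pi * (2 * X) ^ 3 * Δ ^ 2 * (L ^ 88 / X) ^ 3 ≤ E / 6 * U := by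
    have e : 2 * Real.pi * (2 * X) ^ 3 * Δ ^ 2 * (L ^ 88 / X) ^ 3 = 16 * Real.pi / L ^ 26 * U := by
      rw [hΔ, hU]; field_simp; ring
    rw [e]
    refine mul_le_mul_of_nonneg_right ?_ hU0.le
    rw [div_le_iff₀ (by positivity)]
    have h1 : L ≤ L ^ 26 := le_self_pow₀ hL1 (by norm_num)
    calc 16 * Real.pi = E / 6 * (16 * Real.pi * (6 / E)) := by field_simp
      _ ≤ E / 6 * L ^ 26 := by gcongr; exact k2.trans h1
  have t2 : Real.exp Real.pi * (10004 * X / L ^ 16) * (4 * X * L ^ 2) ≤ E / 6 * U := by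
    have e : Real.exp Real.pi * (10004 * X / L ^ 16) * (4 * X * L ^ 2) = 40016 * Real.exp Real.pi / L ^ 4 * U := by
      rw [hU]; field_simp; ring
    rw [e]
    refine mul_le_mul_of_nonneg_right ?_ hU0.le
    rw [div_le_iff₀ (by positivity)]
    have h1 : L ≤ L ^ 4 := le_self_pow₀ hL1 (by norm_num)
    calc 40016 * Real.exp Real.pi = E / 6 * (40016 * Real.exp Real.pi * (6 / E)) := by field_simp
      _ ≤ E / 6 * L ^ 4 := by gcongr; exact k3.trans h1
  have t3 : 10004 * L ^ 6 * X * X ^ (-(1 / 20) : ℝ) * (4 * X * L ^ 2 * X ^ (1 / 25 : ℝ)) ≤ E / 6 * U := by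
    have e0 : X ^ (-(1 / 20) : ℝ) * X ^ (1 / 25 : ℝ) = (X ^ (1 / 100 : ℝ))⁻¹ := by
      rw [← Real.rpow_add hX, ← Real.rpow_neg hX.le]; norm_num
    have e : 10004 * L ^ 6 * X * X ^ (-(1 / 20) : ℝ) * (4 * X * L ^ 2 * X ^ (1 / 25 : ℝ)) =
        40016 * L ^ 18 * (X ^ (1 / 100 : ℝ))⁻¹ * U := by
      rw [← e0, hU]; field_simp; ring
    rw [e]
    gcongr
    rw [← div_eq_mul_inv, div_le_iff₀ (by positivity)]
    have h1 : E / 6 * X ^ (1 / 100 : ℝ) = 40016 * (E / 6 / 40016 * X ^ (1 / 100 : ℝ)) := by field_simp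
    rw [h1]
    gcongr
  have t4 : (2 * X) ^ 3 * Real.exp (-(ε ^ 2 * T ^ 2)) * (2 / ε) ≤ 16 := by
    rw [hεT]
    have h1 : Real.exp (-(X ^ (2 / 25 : ℝ))) ≤ 1 / X ^ 4 := by
      have h2 : Real.exp (-(4 * L)) = 1 / X ^ 4 := by
        rw [Real.exp_neg, show 4 * L = (4 : ℕ) * L by norm_num, Real.exp_nat_mul, ← hXL, one_div]
      rw [← h2]
      apply Real.exp_le_exp.2
      rw [pow_one] at k7
      linarith
    have h3 : 2 / ε ≤ 2 * X := by rw [div_eq_mul_one_div]; gcongr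
    calc (2 * X) ^ 3 * Real.exp (-(X ^ (2 / 25 : ℝ))) * (2 / ε) ≤ (2 * X) ^ 3 * (1 / X ^ 4) * (2 * X) := by gcongr
      _ = 16 := by field_simp; norm_num
  have t5 : 24 ≤ E / 6 * U := by
    rw [Real.rpow_two] at k6
    rw [hU, mul_div_assoc', le_div_iff₀ (by positivity)]
    have : E / 6 / 24 * X ^ 2 * 24 = E / 6 * X ^ 2 := by ring
    linarith
  have hEU : 0 < E * U := by positivity
  linarith

end TLI

theorem stmt1 :
    ∃ N₀ : ℝ, ∀ N : ℝ, N ≥ N₀ →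
      ∀ X : ℝ, X > 3 / 2 → N = 2 * X * Real.log (2 * X / 3) →
        ∃ p₁ p₂ p₃ : ℕ, p₁.Prime ∧ p₂.Prime ∧ p₃.Prime ∧
          |(p₁ : ℝ) * Real.log p₁ + (p₂ : ℝ) * Real.log p₂ + (p₃ : ℝ) * Real.log p₃ - N|
            < X ^ (-(1 : ℝ) / 25) * Real.log X ^ 8 := by
  obtain ⟨X0, hX0⟩ := Filter.eventually_atTop.1 TLI.main_ev
  set Z := max X0 2 with hZ
  have hZ2 : 2 ≤ Z := le_max_right _ _
  refine ⟨2 * Z * Real.log (2 * Z / 3) + 1, fun N hN X hX hNX => ?_⟩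
  have hXZ : Z ≤ X := by
    by_contra hlt
    push Not at hlt
    have h1 : Real.log (2 * X / 3) ≤ Real.log (2 * Z / 3) := Real.log_le_log (by linarith) (by linarith)
    have h2 : 0 ≤ Real.log (2 * X / 3) := Real.log_nonneg (by linarith)
    have h3 : 2 * X * Real.log (2 * X / 3) ≤ 2 * Z * Real.log (2 * Z / 3) := by gcongr
    linarith
  obtain ⟨p₁, p₂, p₃, h1, h2, h3, h⟩ := hX0 X ((le_max_left _ _).trans hXZ)
  refine ⟨p₁, p₂, p₃, h1, h2, h3, ?_⟩
  have e : 3 * TLI.xl (2 * X / 3) = N := by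
    rw [hNX]; unfold TLI.xl; ring
  rw [e] at h
  exact h
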